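/- Assume g is odd. Then the projective hyperelliptic curve X₀ of genus g over K, glued from the affine charts a s² = b (t^{g+1} − b c² d)(t^{g+1} − b c² d − 2 c) and a S² = b (1 − b c² d T^{g+1})(1 − (b c² d + 2 c) T^{g+1}), violates the Hasse principle: for every place v of K and every finite field extension L of the completion K_v, the curve X₀ has an L-point (one of the two affine equations has a solution in L²), but X₀ has no K-rational point (neither affine equation has a solution in K²). In particular, for every number field K and every odd g ≥ 1 there exist explicit genus-g hyperelliptic curves over K violating the Hasse principle. -/

import Mathlib

open NumberField IsDedekindDomain

universe u

/-- `D_θ = a^{2h+1} b^{2h+1} θ^{g+1} − 1`. -/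
def Dval {F : Type*} [Field F] (a b : F) (h g : ℕ) (θ : F) : F :=
  a ^ (2 * h + 1) * b ^ (2 * h + 1) * θ ^ (g + 1) - 1

/-- `C_θ = a^{2h+1} θ^{g+1} − 1`. -/
def Cval {F : Type*} [Field F] (a : F) (h g : ℕ) (θ : F) : F :=
  a ^ (2 * h + 1) * θ ^ (g + 1) - 1

/-- `A_θ = a^{4h+3} θ^{2g+2} + b c² d D_θ²`. -/
def Aval {F : Type*} [Field F] (a b c d : F) (h g : ℕ) (θ : F) : F :=
  a ^ (4 * h + 3) * θ ^ (2 * g + 2) + b * c ^ 2 * d * (Dval a b h g θ) ^ 2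

/-- `B_θ = a^{4h+3} θ^{2g+2} + (b c² d + 2c) D_θ²`. -/
def Bval {F : Type*} [Field F] (a b c d : F) (h g : ℕ) (θ : F) : F :=
  a ^ (4 * h + 3) * θ ^ (2 * g + 2) + (b * c ^ 2 * d + 2 * c) * (Dval a b h g θ) ^ 2

/-- `D_∞ = a^{2h+1} b^{2h+1}`. -/
def Dinf {F : Type*} [Field F] (a b : F) (h : ℕ) : F := a ^ (2 * h + 1) * b ^ (2 * h + 1)

/-- `C_∞ = a^{2h+1}`. -/
def Cinf {F : Type*} [Field F] (a : F) (h : ℕ) : F := a ^ (2 * h + 1)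

/-- `A_∞ = a^{4h+3} + b c² d D_∞²`. -/
def Ainf {F : Type*} [Field F] (a b c d : F) (h : ℕ) : F :=
  a ^ (4 * h + 3) + b * c ^ 2 * d * (Dinf a b h) ^ 2

/-- `B_∞ = a^{4h+3} + (b c² d + 2c) D_∞²`. -/
def Binf {F : Type*} [Field F] (a b c d : F) (h : ℕ) : F :=
  a ^ (4 * h + 3) + (b * c ^ 2 * d + 2 * c) * (Dinf a b h) ^ 2

/-- The image of `x ∈ 𝓞 K` in the completion of `K` at the finite place `π`. -/
noncomputable def intToAdicCompletion {K : Type*} [Field K] [NumberField K]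
    (π : HeightOneSpectrum (𝓞 K)) (x : 𝓞 K) : π.adicCompletion K :=
  algebraMap K (π.adicCompletion K) (algebraMap (𝓞 K) K x)

/-- The arithmetic parameters `a, b, c, d` of Proposition 2.1 of Huang–Liang, for the
finite set `Ω⁰` of finite odd places of residue characteristic at most `4g²`;
`va, vb, vc, vd` are the finite places of `K` generated by `a, b, c, d`. -/
structure Params (K : Type u) [Field K] [NumberField K] (g : ℕ) (a b c d : 𝓞 K)
    (va vb vc vd : HeightOneSpectrum (𝓞 K)) : Prop where
  span_a : va.asIdeal = Ideal.span {a}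
  span_b : vb.asIdeal = Ideal.span {b}
  span_c : vc.asIdeal = Ideal.span {c}
  span_d : vd.asIdeal = Ideal.span {d}
  distinct : va ≠ vb ∧ va ≠ vc ∧ va ≠ vd ∧ vb ≠ vc ∧ vb ≠ vd ∧ vc ≠ vd
  not_dvd_two : (2 : 𝓞 K) ∉ va.asIdeal ∧ (2 : 𝓞 K) ∉ vb.asIdeal ∧
    (2 : 𝓞 K) ∉ vc.asIdeal ∧ (2 : 𝓞 K) ∉ vd.asIdeal
  char_odd : Odd (ringChar (𝓞 K ⧸ va.asIdeal)) ∧ Odd (ringChar (𝓞 K ⧸ vb.asIdeal)) ∧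
    Odd (ringChar (𝓞 K ⧸ vc.asIdeal)) ∧ Odd (ringChar (𝓞 K ⧸ vd.asIdeal))
  char_big : 4 * g ^ 2 < ringChar (𝓞 K ⧸ va.asIdeal) ∧
    4 * g ^ 2 < ringChar (𝓞 K ⧸ vb.asIdeal) ∧
    4 * g ^ 2 < ringChar (𝓞 K ⧸ vc.asIdeal) ∧
    4 * g ^ 2 < ringChar (𝓞 K ⧸ vd.asIdeal)
  sq_ab_bad : ∀ π : HeightOneSpectrum (𝓞 K),
    ((2 : 𝓞 K) ∈ π.asIdeal ∨ ringChar (𝓞 K ⧸ π.asIdeal) ≤ 4 * g ^ 2) →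
    IsSquare (intToAdicCompletion π a) ∧ IsSquare (intToAdicCompletion π b)
  pos_real : ∀ σ : K →+* ℝ, 0 < σ (algebraMap (𝓞 K) K a) ∧ 0 < σ (algebraMap (𝓞 K) K b)
  sq_two_a : IsSquare ((2 : va.adicCompletion K))
  sq_neg_one_a : IsSquare ((-1 : va.adicCompletion K))
  sq_two_b : IsSquare ((2 : vb.adicCompletion K))
  sq_neg_one_b : IsSquare ((-1 : vb.adicCompletion K))
  cong_a : b ∣ a - 1
  cong_bcd : a ∣ b * c ^ 2 * d - 1
  c_nsq_a : ¬ IsSquare (intToAdicCompletion va c)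
  c_nsq_b : ¬ IsSquare (intToAdicCompletion vb c)
  d_nsq_b : ¬ IsSquare (intToAdicCompletion vb d)
  d_sq_c : IsSquare (intToAdicCompletion vc d)
  d_sq_a : IsSquare (intToAdicCompletion va d)
  a_sq_b : IsSquare (intToAdicCompletion vb a)
  a_nsq_c : ¬ IsSquare (intToAdicCompletion vc a)
  b_sq_a : IsSquare (intToAdicCompletion va b)
  b_nsq_c : ¬ IsSquare (intToAdicCompletion vc b)
  not_dvd : ¬ a ∣ b * c * d + 2

/-- The hyperelliptic curve glued from the charts `a s² = b (t^{g+1} − A)(t^{g+1} − B)`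
and `a S² = b (1 − A T^{g+1})(1 − B T^{g+1})` has an `L`-point. -/
def XPoint {L : Type*} [Field L] (g : ℕ) (a b A B : L) : Prop :=
  (∃ s t : L, a * s ^ 2 = b * ((t ^ (g + 1) - A) * (t ^ (g + 1) - B))) ∨
  (∃ S T : L, a * S ^ 2 = b * ((1 - A * T ^ (g + 1)) * (1 - B * T ^ (g + 1))))

/-- The fiber `X₀` (with `A₀ = b c² d` and `B₀ = b c² d + 2c`) has an `L`-point. -/
def X0Point (L : Type*) [Field L] (g : ℕ) (a b c d : L) : Prop :=
  XPoint g a b (b * c ^ 2 * d) (b * c ^ 2 * d + 2 * c)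

/-- The image of `x ∈ 𝓞 K` in a field extension `L` of the completion `K_π`. -/
noncomputable def intToLocalExt {K : Type u} [Field K] [NumberField K]
    (π : HeightOneSpectrum (𝓞 K)) (L : Type u) [Field L]
    [Algebra (π.adicCompletion K) L] (x : 𝓞 K) : L :=
  algebraMap (π.adicCompletion K) L (intToAdicCompletion π x)

namespace GaussPhase

open Complex Filter Topology HurwitzZeta

/-- The theta function near the rational cusp `1 / (2 d)`, split by residues modulo `2 d`. -/
lemma jacobiTheta_cusp_eq {d : ℕ} (hd : 0 < d) {u : ℝ} (hu : 0 < u) :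
    jacobiTheta (1 / (2 * d) + I / (4 * d ^ 2 * u)) =
      (u : ℂ) ^ (1 / 2 : ℂ) * ∑ k : Fin (2 * d),
        cexp (2 * Real.pi * I * ((k : ℂ) ^ 2 / (4 * d))) *
          ((cosKernel ((k / (2 * d) : ℝ) : UnitAddCircle) u : ℝ) : ℂ) := by
  have hd' : (d : ℂ) ≠ 0 := by exact_mod_cast hd.ne'
  have hu' : (u : ℂ) ≠ 0 := by exact_mod_cast hu.ne'
  have hN : 0 < 2 * d := by omega
  have : NeZero (2 * d) := ⟨hN.ne'⟩
  set τ : ℂ := 1 / (2 * d) + I / (4 * d ^ 2 * u) with hτ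
  have key : ∀ k : Fin (2 * d), HasSum
      (fun n : ℤ => cexp (Real.pi * I * ((2 * d * n + k : ℤ) : ℂ) ^ 2 * τ))
      ((u : ℂ) ^ (1 / 2 : ℂ) * (cexp (2 * Real.pi * I * ((k : ℂ) ^ 2 / (4 * d))) *
          ((cosKernel ((k / (2 * d) : ℝ) : UnitAddCircle) u : ℝ) : ℂ))) := by
    intro k
    have h1 := hasSum_int_evenKernel ((k / (2 * d) : ℝ)) (t := 1 / u) (by positivity)
    rw [evenKernel_functional_equation, one_div_one_div] at h1
    have h2 := ((hasSum_ofReal.mpr h1).mul_left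
      (cexp (2 * Real.pi * I * ((k : ℂ) ^ 2 / (4 * d)))))
    have e1 : (fun n : ℤ => cexp (Real.pi * I * ((2 * d * n + k : ℤ) : ℂ) ^ 2 * τ)) =
      fun i : ℤ => cexp (2 * Real.pi * I * ((k : ℂ) ^ 2 / (4 * d))) *
        ((Real.exp (-Real.pi * ((i : ℝ) + k / (2 * d)) ^ 2 * (1 / u)) : ℝ) : ℂ) := by
      ext n
      rw [ofReal_exp, ← Complex.exp_add]
      rw [Complex.exp_eq_exp_iff_exists_int]
      refine ⟨d * n ^ 2 + n * k, ?_⟩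
      rw [hτ]
      push_cast
      field_simp
      ring_nf
      simp only [I_sq]
      ring
    have e2 : (u : ℂ) ^ (1 / 2 : ℂ) * (cexp (2 * Real.pi * I * ((k : ℂ) ^ 2 / (4 * d))) *
          ((cosKernel ((k / (2 * d) : ℝ) : UnitAddCircle) u : ℝ) : ℂ)) =
        cexp (2 * Real.pi * I * ((k : ℂ) ^ 2 / (4 * d))) *
          ((1 / (1 / u) ^ (1 / 2 : ℝ) *
            cosKernel ((k / (2 * d) : ℝ) : UnitAddCircle) u : ℝ) : ℂ) := by
      rw [ofReal_mul, mul_left_comm]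
      congr 1
      congr 1
      rw [one_div u, Real.inv_rpow hu.le, one_div ((u ^ (1 / 2 : ℝ))⁻¹), inv_inv,
        ofReal_cpow hu.le]
      norm_num
    rw [e1, e2]
    exact h2
  have hdr : (0 : ℝ) < d := by exact_mod_cast hd
  have him : 0 < τ.im := by
    have : τ = ((1 / (2 * d) : ℝ) : ℂ) + ((1 / (4 * d ^ 2 * u) : ℝ) : ℂ) * I := by
      rw [hτ]; push_cast; ring
    rw [this]
    simp only [add_im, ofReal_im, mul_im, ofReal_re, I_im, I_re]
    have : 0 < 1 / (4 * d ^ 2 * u) := by positivity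
    simpa using this
  have tot : HasSum (fun n : ℤ => cexp (Real.pi * I * (n : ℂ) ^ 2 * τ)) (jacobiTheta τ) := by
    have h := hasSum_jacobiTheta₂_term 0 him
    rw [← jacobiTheta_eq_jacobiTheta₂] at h
    refine h.congr_fun fun n => ?_
    simp [jacobiTheta₂_term]
  have tot2 := ((Equiv.prodComm _ _).trans (Int.divModEquiv (2 * d)).symm).hasSum_iff.mpr tot
  have fin := tot2.prod_fiberwise (g := fun k : Fin (2 * d) => (u : ℂ) ^ (1 / 2 : ℂ) *
    (cexp (2 * Real.pi * I * ((k : ℂ) ^ 2 / (4 * d))) *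
          ((cosKernel ((k / (2 * d) : ℝ) : UnitAddCircle) u : ℝ) : ℂ))) (fun k => by
    refine (key k).congr_fun fun n => ?_
    simp [Int.divModEquiv]
    ring_nf)
  rw [Finset.mul_sum]
  exact fin.unique (hasSum_fintype _)

/-- The quadratic Gauss sum `∑ e(k² / 4d)` over residues modulo `2 d`, up to its modulus. -/
lemma sum_exp_sq_mul_cpow {d : ℕ} (hd : 0 < d) :
    (∑ k : Fin (2 * d), cexp (2 * Real.pi * I * ((k : ℂ) ^ 2 / (4 * d)))) *
      (-I / (2 * d)) ^ (1 / 2 : ℂ) = 1 := by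
  have hd' : (d : ℂ) ≠ 0 := by exact_mod_cast hd.ne'
  have hdr : (0 : ℝ) < d := by exact_mod_cast hd
  set G := ∑ k : Fin (2 * d), cexp (2 * Real.pi * I * ((k : ℂ) ^ 2 / (4 * d)))
  let σ : ℝ → ℂ := fun u => I * u - 1 / (2 * d)
  let τ : ℝ → ℂ := fun u => 1 / (2 * d) + I / (4 * d ^ 2 * u)
  have hσim : ∀ u : ℝ, (σ u).im = u := by
    intro u
    have : σ u = ((u : ℝ) : ℂ) * I - ((1 / (2 * d) : ℝ) : ℂ) := by
      simp only [σ]; push_cast; ring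
    rw [this]; simp [-ofReal_div, -ofReal_inv]
  have hτim : ∀ u : ℝ, 0 < u → 0 < (τ u).im := by
    intro u hu
    have : τ u = ((1 / (2 * d) : ℝ) : ℂ) + ((1 / (4 * d ^ 2 * u) : ℝ) : ℂ) * I := by
      simp only [τ]; push_cast; ring
    rw [this]
    simp only [add_im, ofReal_im, mul_im, ofReal_re, I_im, I_re]
    have : 0 < 1 / (4 * d ^ 2 * u) := by positivity
    simpa using this
  have hS : ∀ z : ℂ, 0 < z.im → jacobiTheta (-1 / z) = (-I * z) ^ (1 / 2 : ℂ) * jacobiTheta z := by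
    intro z hz
    have := jacobiTheta_S_smul ⟨z, hz⟩
    rw [UpperHalfPlane.modular_S_smul] at this
    simpa [neg_div, inv_neg, one_div] using this
  have hper : ∀ (m : ℕ) (z : ℂ), jacobiTheta (z + 2 * m) = jacobiTheta z := by
    intro m
    induction m with
    | zero => simp
    | succ m ih =>
      intro z
      rw [← ih z, ← jacobiTheta_two_add (z + 2 * m)]
      congr 1; push_cast; ring
  have heq : ∀ u : ℝ, 0 < u → jacobiTheta (τ u) * (-I * τ u) ^ (1 / 2 : ℂ) =
      (-I * σ u) ^ (1 / 2 : ℂ) * jacobiTheta (σ u) := by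
    intro u hu
    rw [← hS _ (by rw [hσim]; exact hu), mul_comm, ← hS _ (hτim u hu), ← hper d (-1 / τ u)]
    congr 1
    have hu' : (u : ℂ) ≠ 0 := by exact_mod_cast hu.ne'
    have h1 : σ u ≠ 0 := by
      intro h; have := hσim u; rw [h] at this; simp at this; exact hu.ne this
    have h2 : τ u ≠ 0 := by
      intro h; have := hτim u hu; rw [h] at this; simp at this
    rw [div_add' _ _ _ h2, div_eq_div_iff h2 h1]
    simp only [σ, τ]
    field_simp
    ring_nf
    simp only [I_sq]
    ring
  have lim1 : Tendsto (fun u : ℝ => ∑ k : Fin (2 * d),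
      cexp (2 * Real.pi * I * ((k : ℂ) ^ 2 / (4 * d))) *
          ((cosKernel ((k / (2 * d) : ℝ) : UnitAddCircle) u : ℝ) : ℂ)) atTop (𝓝 G) := by
    refine tendsto_finsetSum _ fun k _ => ?_
    have : Tendsto (fun u : ℝ => cosKernel ((k / (2 * d) : ℝ) : UnitAddCircle) u) atTop (𝓝 1) := by
      obtain ⟨p, hp, hO⟩ := isBigO_atTop_cosKernel_sub ((k / (2 * d) : ℝ) : UnitAddCircle)
      have h0 : Tendsto (fun x : ℝ => Real.exp (-p * x)) atTop (𝓝 0) :=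
        Real.tendsto_exp_atBot.comp (tendsto_id.const_mul_atTop_of_neg (by linarith))
      have := (hO.trans_tendsto h0).add_const 1
      simpa using this
    have := ((continuous_ofReal.tendsto 1).comp this).const_mul
      (cexp (2 * Real.pi * I * ((k : ℂ) ^ 2 / (4 * d))))
    simpa using this
  have hinv : Tendsto (fun u : ℝ => ((u⁻¹ : ℝ) : ℂ)) atTop (𝓝 0) := by
    have := (continuous_ofReal.tendsto 0).comp tendsto_inv_atTop_zero
    rw [ofReal_zero] at this
    exact this
  have lim2 : Tendsto (fun u : ℝ => (-I * τ u) ^ (1 / 2 : ℂ)) atTop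
      (𝓝 ((-I / (2 * d)) ^ (1 / 2 : ℂ))) := by
    have h : Tendsto (fun u : ℝ => -I * τ u) atTop (𝓝 (-I / (2 * d))) := by
      have := (((hinv.const_mul (I / (4 * d ^ 2))).const_add (1 / (2 * d : ℂ))).const_mul (-I))
      rw [mul_zero, add_zero, mul_one_div] at this
      refine this.congr fun u => ?_
      simp only [τ, ofReal_inv]
      ring
    refine ((continuousAt_cpow_const ?_).tendsto).comp h
    rw [mem_slitPlane_iff]
    right
    rw [show -I / (2 * d : ℂ) = ((-(1 / (2 * d)) : ℝ) : ℂ) * I by push_cast; ring, im_ofReal_mul,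
      I_im, mul_one]
    exact neg_ne_zero.mpr (by positivity)
  have lim3 : Tendsto (fun u : ℝ => (-I * σ u / u) ^ (1 / 2 : ℂ)) atTop (𝓝 1) := by
    have h : Tendsto (fun u : ℝ => -I * σ u / u) atTop (𝓝 1) := by
      have := (hinv.const_mul (I / (2 * d))).const_add (1 : ℂ)
      rw [mul_zero, add_zero] at this
      refine this.congr' ?_
      filter_upwards [eventually_gt_atTop 0] with u hu
      have hu' : (u : ℂ) ≠ 0 := by exact_mod_cast hu.ne'
      simp only [σ, ofReal_inv]
      field_simp
      ring_nf
      simp only [I_sq]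
      ring
    have h1 : ContinuousAt (fun z : ℂ => z ^ (1 / 2 : ℂ)) 1 :=
      continuousAt_cpow_const (by simp)
    have := h1.tendsto.comp h
    rw [one_cpow] at this
    exact this
  have lim4 : Tendsto (fun u : ℝ => jacobiTheta (σ u)) atTop (𝓝 1) := by
    have h0 : Tendsto σ atTop (comap im atTop) := by
      rw [tendsto_comap_iff]
      refine tendsto_id.congr fun u => (hσim u).symm
    have h1 : Tendsto (fun z : ℂ => Real.exp (-Real.pi * z.im)) (comap im atTop) (𝓝 0) :=
      (Real.tendsto_exp_atBot.comp
        (tendsto_id.const_mul_atTop_of_neg (by linarith [Real.pi_pos]))).comp tendsto_comap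
    have := ((isBigO_at_im_infty_jacobiTheta_sub_one.trans_tendsto h1).comp h0).add_const 1
    simpa using this
  refine tendsto_nhds_unique (lim1.mul lim2) ?_
  have lim := lim3.mul lim4
  rw [mul_one] at lim
  refine lim.congr' ?_
  filter_upwards [eventually_gt_atTop 0] with u hu
  have hu' : (u : ℂ) ≠ 0 := by exact_mod_cast hu.ne'
  have hne : (u : ℂ) ^ (1 / 2 : ℂ) ≠ 0 := by
    rw [Ne, cpow_eq_zero_iff]; tauto
  have h1 := heq u hu
  have h2 := jacobiTheta_cusp_eq hd hu
  have h3 : (-I * σ u) ^ (1 / 2 : ℂ) = (u : ℂ) ^ (1 / 2 : ℂ) * (-I * σ u / u) ^ (1 / 2 : ℂ) := by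
    have hσ0 : -I * σ u ≠ 0 := by
      refine mul_ne_zero (by simp) ?_
      intro h; have := hσim u; rw [h] at this; simp at this; exact hu.ne this
    have hz : -I * σ u / u ≠ 0 := div_ne_zero hσ0 hu'
    rw [cpow_def_of_ne_zero hσ0, cpow_def_of_ne_zero hu', cpow_def_of_ne_zero hz,
      ← Complex.exp_add, ← add_mul, ← ofReal_log hu.le, ← log_ofReal_mul hu hz,
      mul_div_cancel₀ _ hu']
  simp only [τ] at h1 ⊢
  rw [h2, h3] at h1
  apply mul_left_cancel₀ hne
  rw [← mul_assoc, ← mul_assoc]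
  exact h1.symm

lemma sum_exp_sq_pos {d : ℕ} (hd : 0 < d) : ∃ r : ℝ, 0 < r ∧
    ∑ k : Fin (2 * d), cexp (2 * Real.pi * I * ((k : ℂ) ^ 2 / (4 * d))) =
      r * cexp (Real.pi * I / 4) := by
  have h := sum_exp_sq_mul_cpow hd
  have hdr : (0 : ℝ) < 1 / (2 * d) := by positivity
  have e : (-I / (2 * d) : ℂ) ^ (1 / 2 : ℂ) =
      ((Real.exp (Real.log (1 / (2 * d)) / 2) : ℝ) : ℂ) * cexp (-(Real.pi * I / 4)) := by
    have hne : (-I / (2 * d) : ℂ) ≠ 0 :=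
      div_ne_zero (by simp) (by simp; omega)
    rw [cpow_def_of_ne_zero hne,
      show (-I / (2 * d) : ℂ) = ((1 / (2 * d) : ℝ) : ℂ) * -I by push_cast; ring,
      log_ofReal_mul hdr (by simp), log_neg_I, ofReal_exp, ← Complex.exp_add]
    congr 1
    push_cast
    ring
  refine ⟨(Real.exp (Real.log (1 / (2 * d)) / 2))⁻¹, by positivity, ?_⟩
  rw [e] at h
  have h1 : cexp (-(Real.pi * I / 4)) * cexp (Real.pi * I / 4) = 1 := by
    rw [← Complex.exp_add]; simp
  have h2 : ((Real.exp (Real.log (1 / (2 * d)) / 2) : ℝ) : ℂ) ≠ 0 := by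
    exact_mod_cast (Real.exp_pos _).ne'
  rw [ofReal_inv, eq_inv_mul_iff_mul_eq₀ h2]
  linear_combination (cexp (Real.pi * I / 4)) * h -
    ((Real.exp (Real.log (1 / (2 * d)) / 2) : ℝ) : ℂ) *
      (∑ k : Fin (2 * d), cexp (2 * Real.pi * I * ((k : ℂ) ^ 2 / (4 * d)))) * h1

end GaussPhase

namespace GaussPhase

open NumberField

/-- The additive character `r ↦ e(r) = exp (2 π i r)` of `ℚ`. -/
noncomputable def eQ : AddChar ℚ ℂ where
  toFun r := Complex.exp (2 * Real.pi * Complex.I * r)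
  map_zero_eq_one' := by simp
  map_add_eq_mul' x y := by
    rw [← Complex.exp_add]; push_cast; ring_nf

lemma eQ_apply (r : ℚ) : eQ r = Complex.exp (2 * Real.pi * Complex.I * r) := rfl

lemma eQ_eq_one_iff (r : ℚ) : eQ r = 1 ↔ ∃ m : ℤ, r = m := by
  rw [eQ_apply, Complex.exp_eq_one_iff]
  have h : (2 * Real.pi * Complex.I : ℂ) ≠ 0 := Complex.two_pi_I_ne_zero
  refine exists_congr fun m => ?_
  rw [mul_comm _ (2 * Real.pi * Complex.I : ℂ), mul_right_inj' h]
  exact_mod_cast Iff.rfl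

@[simp] lemma eQ_intCast (m : ℤ) : eQ m = 1 := (eQ_eq_one_iff _).2 ⟨m, rfl⟩

lemma eQ_eq_of_sub {r s : ℚ} (m : ℤ) (h : r = s + m) : eQ r = eQ s := by
  rw [h, AddChar.map_add_eq_mul, eQ_intCast, mul_one]

lemma eQ_neg (r : ℚ) : eQ (-r) = (starRingEnd ℂ) (eQ r) := by
  rw [eQ_apply, eQ_apply, ← Complex.exp_conj]
  congr 1
  simp [Complex.conj_ofNat]

/-- The function `k ↦ e(k² / 4d)` on residues modulo `2 |d|`. -/
noncomputable def sqChar (d : ℤ) (k : ZMod (2 * d.natAbs)) : ℂ := eQ ((k.val : ℚ) ^ 2 / (4 * d))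

/-- The pairing `(k, l) ↦ e(k l / 2d)` on residues modulo `2 |d|`. -/
noncomputable def pairChar (d : ℤ) (k l : ZMod (2 * d.natAbs)) : ℂ :=
  eQ ((k.val : ℚ) * l.val / (2 * d))

lemma natAbs_pos_instance {d : ℤ} (hd : d ≠ 0) : NeZero (2 * d.natAbs) :=
  ⟨by have := Int.natAbs_pos.mpr hd; omega⟩

lemma exists_val_eq {d : ℤ} (hd : d ≠ 0) (k : ℤ) :
    ∃ m : ℤ, (((k : ZMod (2 * d.natAbs)).val : ℕ) : ℚ) = k + 2 * d * m := by
  have := natAbs_pos_instance hd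
  have h : (((k : ZMod (2 * d.natAbs)).val : ℤ) : ZMod (2 * d.natAbs)) = (k : ZMod _) := by simp
  rw [ZMod.intCast_eq_intCast_iff_dvd_sub] at h
  have h2 : (2 * d : ℤ) ∣ k - ((k : ZMod (2 * d.natAbs)).val : ℤ) := by
    refine dvd_trans ?_ h
    push_cast
    exact mul_dvd_mul_left 2 ((dvd_abs d d).mpr dvd_rfl)
  obtain ⟨m, hm⟩ := h2
  refine ⟨-m, ?_⟩
  have : (((k : ZMod (2 * d.natAbs)).val : ℕ) : ℤ) = k + 2 * d * (-m) := by linarith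
  exact_mod_cast this

lemma sqChar_intCast {d : ℤ} (hd : d ≠ 0) (k : ℤ) :
    sqChar d (k : ZMod (2 * d.natAbs)) = eQ ((k : ℚ) ^ 2 / (4 * d)) := by
  obtain ⟨m, hm⟩ := exists_val_eq hd k
  have hd' : (d : ℚ) ≠ 0 := by exact_mod_cast hd
  rw [sqChar, hm]
  apply eQ_eq_of_sub (k * m + d * m ^ 2)
  push_cast
  field_simp
  ring

lemma pairChar_intCast {d : ℤ} (hd : d ≠ 0) (k l : ℤ) :
    pairChar d (k : ZMod (2 * d.natAbs)) (l : ZMod (2 * d.natAbs)) =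
      eQ ((k : ℚ) * l / (2 * d)) := by
  obtain ⟨m, hm⟩ := exists_val_eq hd k
  obtain ⟨n, hn⟩ := exists_val_eq hd l
  have hd' : (d : ℚ) ≠ 0 := by exact_mod_cast hd
  rw [pairChar, hm, hn]
  apply eQ_eq_of_sub (k * n + m * l + 2 * d * m * n)
  push_cast
  field_simp
  ring

lemma sqChar_add {d : ℤ} (hd : d ≠ 0) (x y : ZMod (2 * d.natAbs)) :
    sqChar d (x + y) = sqChar d x * sqChar d y * pairChar d x y := by
  obtain ⟨k, rfl⟩ := ZMod.intCast_surjective x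
  obtain ⟨l, rfl⟩ := ZMod.intCast_surjective y
  have hd' : (d : ℚ) ≠ 0 := by exact_mod_cast hd
  rw [← Int.cast_add, sqChar_intCast hd, sqChar_intCast hd, sqChar_intCast hd,
    pairChar_intCast hd, ← AddChar.map_add_eq_mul, ← AddChar.map_add_eq_mul]
  congr 1
  push_cast
  field_simp
  ring

lemma pairChar_add {d : ℤ} (hd : d ≠ 0) (x y z : ZMod (2 * d.natAbs)) :
    pairChar d x (y + z) = pairChar d x y * pairChar d x z := by
  obtain ⟨k, rfl⟩ := ZMod.intCast_surjective x
  obtain ⟨l, rfl⟩ := ZMod.intCast_surjective y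
  obtain ⟨m, rfl⟩ := ZMod.intCast_surjective z
  rw [← Int.cast_add, pairChar_intCast hd, pairChar_intCast hd, pairChar_intCast hd,
    ← AddChar.map_add_eq_mul]
  congr 1
  push_cast
  ring

lemma pairChar_zero {d : ℤ} (x : ZMod (2 * d.natAbs)) : pairChar d x 0 = 1 := by
  simp [pairChar]

/-- The eighth root of unity attached to the sign of `d`. -/
noncomputable def signPhase (d : ℤ) : ℂ := Complex.exp (Real.pi * Complex.I * d.sign / 4)

lemma sum_sqChar {d : ℤ} (hd : d ≠ 0) [Fintype (ZMod (2 * d.natAbs))] :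
    ∃ r : ℝ, 0 < r ∧ ∑ k : ZMod (2 * d.natAbs), sqChar d k = r * signPhase d := by
  have := natAbs_pos_instance hd
  have hpos : 0 < d.natAbs := Int.natAbs_pos.mpr hd
  obtain ⟨r, hr, h⟩ := sum_exp_sq_pos hpos
  refine ⟨r, hr, ?_⟩
  have e : ∑ k : ZMod (2 * d.natAbs), sqChar d k =
      ∑ k : Fin (2 * d.natAbs), eQ ((k : ℚ) ^ 2 / (4 * d)) := by
    have e1 : ZMod (2 * d.natAbs) ≃ Fin (2 * d.natAbs) := (ZMod.finEquiv _).symm.toEquiv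
    refine (Fintype.sum_bijective (fun k : Fin (2 * d.natAbs) => ((k : ℕ) : ZMod (2 * d.natAbs)))
      ?_ _ _ ?_).symm
    · refine (Fintype.bijective_iff_injective_and_card _).2 ⟨?_, by simp [ZMod.card]⟩
      intro x y hxy
      have := congrArg ZMod.val hxy
      simp only [ZMod.val_natCast, Nat.mod_eq_of_lt x.2, Nat.mod_eq_of_lt y.2] at this
      exact Fin.ext this
    · intro k
      simp [sqChar, ZMod.val_natCast, Nat.mod_eq_of_lt k.2]
  rw [e]
  rcases lt_or_gt_of_ne hd with h0 | h0
  · have hd1 : (d : ℚ) = -(d.natAbs : ℚ) := by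
      have : d = -(d.natAbs : ℤ) := by omega
      exact_mod_cast this
    have := congrArg (starRingEnd ℂ) h
    rw [map_sum, map_mul] at this
    rw [signPhase, Int.sign_eq_neg_one_of_neg h0]
    convert this using 1
    · refine Finset.sum_congr rfl fun k _ => ?_
      rw [hd1, mul_neg, div_neg, eQ_neg, eQ_apply]
      push_cast
      rfl
    · rw [← Complex.exp_conj]
      simp [Complex.conj_ofNat]
  · have hd1 : (d : ℚ) = (d.natAbs : ℚ) := by
      rw [Nat.cast_natAbs, abs_of_pos h0]
    rw [signPhase, Int.sign_eq_one_of_pos h0]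
    convert h using 1
    · refine Finset.sum_congr rfl fun k _ => ?_
      rw [hd1, eQ_apply]
      push_cast
      rfl
    · simp

/-- A function on a finite group transforming under a subgroup `H` by characters that are
trivial only on `M` has the same sum over the group and over `M`. -/
lemma sum_eq_sum_of_transform {D : Type*} [AddCommGroup D] [Fintype D] (H : AddSubgroup D)
    (M : D → Prop) [DecidablePred M] (F : D → ℂ) (χ : D → AddChar H ℂ)
    (hF : ∀ x (h : H), F (x + h) = F x * χ x h) (hM : ∀ x, χ x = 1 ↔ M x) :
    ∑ x, F x = ∑ x with M x, F x := by
  classical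
  have hc : (Fintype.card H : ℂ) ≠ 0 := by exact_mod_cast Fintype.card_ne_zero
  apply mul_left_cancel₀ hc
  have h1 : ∀ h : H, ∑ x, F (x + h) = ∑ x, F x := fun h =>
    Fintype.sum_equiv (Equiv.addRight (h : D)) _ _ fun x => rfl
  calc (Fintype.card H : ℂ) * ∑ x, F x = ∑ h : H, ∑ x, F (x + h) := by
        simp [h1]
    _ = ∑ x, F x * ∑ h : H, χ x h := by
        rw [Finset.sum_comm]
        simp [hF, Finset.mul_sum]
    _ = ∑ x, F x * (if M x then (Fintype.card H : ℂ) else 0) := by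
        refine Finset.sum_congr rfl fun x _ => ?_
        congr 1
        rw [AddChar.sum_eq_ite]
        have : χ x = 0 ↔ M x := hM x
        simp only [this]
    _ = _ := by
        rw [Finset.mul_sum, Finset.sum_filter]
        refine Finset.sum_congr rfl fun x _ => ?_
        split_ifs <;> ring

/-- Summing over a finite group through a surjection. -/
lemma sum_comp_surjective {E G : Type*} [AddCommGroup E] [Fintype E] [AddCommGroup G] [Fintype G]
    (p : E →+ G) (hp : Function.Surjective p) :
    ∃ r : ℝ, 0 < r ∧ ∀ F : G → ℂ, ∑ x, F (p x) = r * ∑ y, F y := by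
  classical
  refine ⟨(Fintype.card p.ker : ℝ), by exact_mod_cast Fintype.card_pos, fun F => ?_⟩
  rw [← Finset.sum_fiberwise Finset.univ p, Finset.mul_sum]
  refine Finset.sum_congr rfl fun y _ => ?_
  rw [Finset.sum_congr rfl (g := fun _ => F y) (fun x hx => by rw [(Finset.mem_filter.1 hx).2]),
    Finset.sum_const, nsmul_eq_mul]
  congr 2
  have : (Finset.univ.filter fun x => p x = y).card = (Finset.univ.filter fun x => p x = 0).card :=
    AddMonoidHom.card_fiber_eq_of_mem_range p (hp y) (hp 0)
  rw [this, Fintype.card_subtype]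
  simp [AddMonoidHom.mem_ker]

/-- Two surjections from one group onto finite groups, and functions agreeing upstairs, have
sums that are positive multiples of each other. -/
lemma sum_eq_of_comp_eq {A G G' : Type*} [AddCommGroup A] [AddCommGroup G] [Fintype G]
    [AddCommGroup G'] [Fintype G'] (p : A →+ G) (hp : Function.Surjective p) (p' : A →+ G')
    (hp' : Function.Surjective p') (F : G → ℂ) (F' : G' → ℂ) (h : ∀ x, F (p x) = F' (p' x)) :
    ∃ r : ℝ, 0 < r ∧ ∑ x, F x = r * ∑ x, F' x := by
  classical
  let E := (p.prod p').range
  have : Fintype E := Fintype.ofFinite E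
  let q : E →+ G := (AddMonoidHom.fst G G').comp E.subtype
  let q' : E →+ G' := (AddMonoidHom.snd G G').comp E.subtype
  have hq : Function.Surjective q := fun y => by
    obtain ⟨x, rfl⟩ := hp y
    exact ⟨⟨(p x, p' x), ⟨x, rfl⟩⟩, rfl⟩
  have hq' : Function.Surjective q' := fun y => by
    obtain ⟨x, rfl⟩ := hp' y
    exact ⟨⟨(p x, p' x), ⟨x, rfl⟩⟩, rfl⟩
  obtain ⟨r, hr, h1⟩ := sum_comp_surjective q hq
  obtain ⟨r', hr', h2⟩ := sum_comp_surjective q' hq'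
  refine ⟨r' / r, by positivity, ?_⟩
  have e : ∑ x, F (q x) = ∑ x, F' (q' x) := by
    refine Finset.sum_congr rfl ?_
    rintro ⟨_, ⟨x, rfl⟩⟩ _
    exact h x
  rw [h1, h2] at e
  have : (r : ℂ) ≠ 0 := by exact_mod_cast hr.ne'
  push_cast
  field_simp
  linear_combination e

variable {K : Type*} [Field K] [NumberField K]

/-- Membership in the inverse different of `K`. -/
def InCodiff (y : K) : Prop := ∀ x : 𝓞 K, ∃ m : ℤ, Algebra.trace ℚ K (algebraMap (𝓞 K) K x * y) = m

lemma fractionalIdeal_one_ne_zero :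
    (1 : FractionalIdeal (nonZeroDivisors (𝓞 K)) K) ≠ 0 := by
  intro h
  have : (1 : K) ∈ (0 : FractionalIdeal (nonZeroDivisors (𝓞 K)) K) :=
    h ▸ FractionalIdeal.one_mem_one _
  exact one_ne_zero ((FractionalIdeal.mem_zero_iff _).1 this)

lemma inCodiff_iff (y : K) :
    InCodiff y ↔ y ∈ FractionalIdeal.dual ℤ ℚ (1 : FractionalIdeal (nonZeroDivisors (𝓞 K)) K) := by
  rw [FractionalIdeal.mem_dual fractionalIdeal_one_ne_zero]
  constructor
  · intro h a ha
    obtain ⟨x, rfl⟩ := (FractionalIdeal.mem_one_iff _).1 ha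
    obtain ⟨m, hm⟩ := h x
    exact ⟨m, by rw [Algebra.traceForm_apply, mul_comm]; exact hm.symm⟩
  · intro h x
    obtain ⟨m, hm⟩ := h _ ((FractionalIdeal.mem_one_iff _).2 ⟨x, rfl⟩)
    exact ⟨m, by rw [Algebra.traceForm_apply, mul_comm] at hm; rw [← hm]; simp⟩

lemma exists_eq_of_forall_inCodiff (X : K)
    (h : ∀ y : K, InCodiff y → ∃ m : ℤ, Algebra.trace ℚ K (X * y) = m) :
    ∃ z : 𝓞 K, algebraMap (𝓞 K) K z = X := by
  have : X ∈ (1 : FractionalIdeal (nonZeroDivisors (𝓞 K)) K) := by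
    rw [← FractionalIdeal.dual_dual ℤ ℚ (1 : FractionalIdeal (nonZeroDivisors (𝓞 K)) K),
      FractionalIdeal.mem_dual (FractionalIdeal.dual_ne_zero ℤ ℚ fractionalIdeal_one_ne_zero)]
    intro y hy
    obtain ⟨m, hm⟩ := h y ((inCodiff_iff y).2 hy)
    exact ⟨m, by rw [Algebra.traceForm_apply, hm]; simp⟩
  obtain ⟨z, hz⟩ := (FractionalIdeal.mem_one_iff _).1 this
  exact ⟨z, hz⟩

end GaussPhase

namespace GaussPhase

open NumberField

variable {K : Type*} [Field K] [NumberField K]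

/-- A `ℚ`-basis of `K`, orthogonal for the form `Tr (x y / β)` with integral diagonal `d`,
and contained in the dual of the ring of integers. -/
structure TraceBasis (β : K) {ι : Type*} (e : Module.Basis ι ℚ K) (d : ι → ℤ) : Prop where
  integral : ∀ i, ∃ z : 𝓞 K, algebraMap (𝓞 K) K z = e i
  ortho : ∀ i j, i ≠ j → Algebra.trace ℚ K (e i * e j / β) = 0
  diag : ∀ i, Algebra.trace ℚ K (e i * e i / β) = d i
  ne_zero : ∀ i, d i ≠ 0
  int : ∀ i (x : 𝓞 K), ∃ m : ℤ, Algebra.trace ℚ K (algebraMap (𝓞 K) K x * e i / β) = m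

lemma eQ_sum {ι : Type*} (s : Finset ι) (f : ι → ℚ) : eQ (∑ i ∈ s, f i) = ∏ i ∈ s, eQ (f i) := by
  classical
  induction s using Finset.induction_on with
  | empty => simp
  | insert i s hi ih => rw [Finset.sum_insert hi, Finset.prod_insert hi, AddChar.map_add_eq_mul, ih]

lemma exists_trace_eq_intCast (x : 𝓞 K) :
    ∃ m : ℤ, Algebra.trace ℚ K (algebraMap (𝓞 K) K x) = m := by
  have h := Algebra.isIntegral_trace (L := ℚ) (RingOfIntegers.isIntegral_coe x)
  obtain ⟨m, hm⟩ := IsIntegrallyClosed.isIntegral_iff.1 h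
  exact ⟨m, hm.symm⟩

lemma exists_int_mul_mem (x y : K) : ∃ n : ℤ, n ≠ 0 ∧ (∃ z : 𝓞 K, algebraMap (𝓞 K) K z = n * x) ∧
    ∃ z : 𝓞 K, algebraMap (𝓞 K) K z = n * y := by
  have halg : ∀ w : K, IsAlgebraic ℤ w := fun w =>
    (IsFractionRing.isAlgebraic_iff ℤ ℚ K).2 (Algebra.IsAlgebraic.isAlgebraic w)
  obtain ⟨m, hm, h1⟩ := (halg x).exists_integral_multiple
  obtain ⟨n, hn, h2⟩ := (halg y).exists_integral_multiple
  rw [zsmul_eq_mul] at h1 h2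
  have hlift : ∀ w : K, IsIntegral ℤ w → ∃ z : 𝓞 K, algebraMap (𝓞 K) K z = w :=
    fun w hw => ⟨⟨w, hw⟩, rfl⟩
  obtain ⟨z1, hz1⟩ := hlift _ h1
  obtain ⟨z2, hz2⟩ := hlift _ h2
  refine ⟨m * n, mul_ne_zero hm hn, ⟨(n : 𝓞 K) * z1, ?_⟩, ⟨(m : 𝓞 K) * z2, ?_⟩⟩
  · rw [map_mul, map_intCast, hz1]; push_cast; ring
  · rw [map_mul, map_intCast, hz2]; push_cast; ring

lemma exists_traceBasis {β : K} (hβ : β ≠ 0) :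
    ∃ (e : Module.Basis (Fin (Module.finrank ℚ K)) ℚ K) (d : Fin (Module.finrank ℚ K) → ℤ),
      TraceBasis β e d := by
  let B : LinearMap.BilinForm ℚ K :=
    (Algebra.traceForm ℚ K).compLeft (LinearMap.mulLeft ℚ β⁻¹)
  have hB : ∀ x y, B x y = Algebra.trace ℚ K (x * y / β) := fun x y => by
    simp only [B, LinearMap.BilinForm.compLeft_apply, LinearMap.mulLeft_apply,
      Algebra.traceForm_apply]
    congr 1
    field_simp
  have hsymm : LinearMap.IsSymm B := ⟨fun x y => by
    rw [RingHom.id_apply, hB, hB, mul_comm]⟩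
  have : Invertible (2 : ℚ) := invertibleOfNonzero two_ne_zero
  obtain ⟨v, hv⟩ := LinearMap.BilinForm.exists_orthogonal_basis hsymm
  rw [LinearMap.isOrthoᵢ_def] at hv
  choose n hn z1 hz2 using fun i => exists_int_mul_mem (v i) (v i / β)
  choose z1 hz1 using z1
  choose z2 hz2 using hz2
  let e := v.isUnitSMul (w := fun i => (n i : ℚ)) fun i => IsUnit.mk0 _ (by exact_mod_cast hn i)
  have he : ∀ i, e i = n i * v i := fun i => by
    simp only [e, Module.Basis.isUnitSMul_apply, Algebra.smul_def]; simp
  have h_int : ∀ i (x : 𝓞 K), ∃ m : ℤ, Algebra.trace ℚ K (algebraMap (𝓞 K) K x * e i / β) = m :=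
      fun i x => by
    have : algebraMap (𝓞 K) K x * e i / β = algebraMap (𝓞 K) K (x * z2 i) := by
      rw [map_mul, hz2, he]; ring
    rw [this]
    exact exists_trace_eq_intCast _
  have hZ : ∀ i, ∃ z : 𝓞 K, algebraMap (𝓞 K) K z = e i := fun i => ⟨z1 i, by rw [hz1, he]⟩
  have hO : ∀ i j, i ≠ j → Algebra.trace ℚ K (e i * e j / β) = 0 := fun i j hij => by
    have := hv i j hij
    rw [hB] at this
    rw [he, he, show (n i * v i * (n j * v j) / β : K) =
      ((n i * n j : ℤ) : ℚ) • (v i * v j / β) by rw [Algebra.smul_def]; push_cast; simp; ring,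
      map_smul, this, smul_zero]
  choose d hd using fun i => (by
    obtain ⟨z, hz⟩ := hZ i
    obtain ⟨m, hm⟩ := h_int i z
    rw [hz] at hm
    exact ⟨m, hm⟩ : ∃ m : ℤ, Algebra.trace ℚ K (e i * e i / β) = m)
  refine ⟨e, d, hZ, hO, hd, fun i h0 => ?_, h_int⟩
  have hi : ∀ y, Algebra.trace ℚ K (e i / β * y) = 0 := by
    intro y
    rw [← e.sum_repr y, Finset.mul_sum, map_sum]
    refine Finset.sum_eq_zero fun j _ => ?_
    rw [mul_smul_comm, map_smul]
    by_cases hij : i = j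
    · subst hij
      have := hd i
      rw [h0] at this
      rw [show e i / β * e i = e i * e i / β by ring, this]; simp
    · rw [show e i / β * e j = e i * e j / β by ring, hO i j hij, smul_zero]
  have := (traceForm_nondegenerate ℚ K).1 (e i / β) hi
  exact (div_ne_zero (e.ne_zero i) hβ) this

section Milgram

variable {β : K} {ι : Type*} [Fintype ι] {e : Module.Basis ι ℚ K} {d : ι → ℤ}

lemma TraceBasis.trace_sum_mul (h : TraceBasis β e d) (q : ι → ℚ) (j : ι) :
    Algebra.trace ℚ K ((∑ i, q i • e i) * e j / β) = q j * d j := by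
  classical
  rw [Finset.sum_mul, Finset.sum_div, map_sum, Finset.sum_eq_single j]
  · rw [smul_mul_assoc, smul_div_assoc, map_smul, h.diag, smul_eq_mul]
  · intro i _ hij
    rw [smul_mul_assoc, smul_div_assoc, map_smul, h.ortho i j hij, smul_zero]
  · simp

lemma TraceBasis.eq_sum (h : TraceBasis β e d) (x : K) :
    x = ∑ i, (Algebra.trace ℚ K (x * e i / β) / d i) • e i := by
  conv_lhs => rw [← e.sum_repr x]
  refine Finset.sum_congr rfl fun j _ => ?_
  congr 1
  have := h.trace_sum_mul (e.repr x) j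
  rw [e.sum_repr] at this
  have hd : (d j : ℚ) ≠ 0 := by exact_mod_cast h.ne_zero j
  rw [this, mul_div_cancel_right₀ _ hd]

lemma TraceBasis.trace_mul (h : TraceBasis β e d) (x y : K) :
    Algebra.trace ℚ K (x * y / β) =
      ∑ i, Algebra.trace ℚ K (x * e i / β) * Algebra.trace ℚ K (y * e i / β) / d i := by
  conv_lhs => rw [h.eq_sum y]
  rw [Finset.mul_sum, Finset.sum_div, map_sum]
  refine Finset.sum_congr rfl fun j _ => ?_
  rw [mul_smul_comm, smul_div_assoc, map_smul, smul_eq_mul]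
  ring

/-- Milgram's formula for the form `Tr (x² / β)`: the phase of a sum of `e (Tr (x² / β))` over
any finite quotient of the ring of integers only depends on the signs of a diagonalisation. -/
theorem TraceBasis.sum_eq (h : TraceBasis β e d)
    (hβ : ∀ y : K, InCodiff y → ∃ z : 𝓞 K, algebraMap (𝓞 K) K z = β * y / 4) (hβ0 : β ≠ 0)
    {G : Type*} [AddCommGroup G] [Fintype G] (p : 𝓞 K →+ G) (hp : Function.Surjective p)
    (F : G → ℂ) (hF : ∀ x : 𝓞 K, F (p x) =
      eQ (Algebra.trace ℚ K ((algebraMap (𝓞 K) K x) ^ 2 / β))) :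
    ∃ r : ℝ, 0 < r ∧ ∑ x, F x = r * ∏ i, signPhase (d i) := by
  classical
  have hd0 : ∀ i, (d i : ℚ) ≠ 0 := fun i => by exact_mod_cast h.ne_zero i
  have inst : ∀ i, NeZero (2 * (d i).natAbs) := fun i => natAbs_pos_instance (h.ne_zero i)
  choose n hn using h.int
  let N : 𝓞 K →+ (ι → ℤ) := AddMonoidHom.mk' (fun x i => 2 * n i x) (by
    intro x y
    ext i
    have : (n i (x + y) : ℚ) = n i x + n i y := by
      rw [← hn, ← hn, ← hn, ← map_add]; congr 1; rw [map_add]; ring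
    have : n i (x + y) = n i x + n i y := by exact_mod_cast this
    simp [this, mul_add])
  have hN : ∀ x i, (N x i : ℚ) = 2 * Algebra.trace ℚ K (algebraMap (𝓞 K) K x * e i / β) :=
      fun x i => by
    rw [hn]; simp [N]
  let D := ∀ i, ZMod (2 * (d i).natAbs)
  let φ : 𝓞 K →+ D := AddMonoidHom.mk' (fun x i => (N x i : ZMod _)) (by
    intro x y; ext i; simp only [map_add, Pi.add_apply, Int.cast_add]; rfl)
  let Φ : D → ℂ := fun k => ∏ i, sqChar (d i) (k i)
  have hΦ : ∀ x : 𝓞 K, Φ (φ x) = eQ (Algebra.trace ℚ K ((algebraMap (𝓞 K) K x) ^ 2 / β)) := by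
    intro x
    have : ∀ i, sqChar (d i) (φ x i) = eQ ((N x i : ℚ) ^ 2 / (4 * d i)) := fun i =>
      sqChar_intCast (h.ne_zero i) _
    simp only [Φ, this]
    rw [← eQ_sum, sq, h.trace_mul]
    congr 1
    refine Finset.sum_congr rfl fun i _ => ?_
    rw [hN]
    have := hd0 i
    field_simp
    ring
  let L : AddSubgroup (𝓞 K) :=
    { carrier := {x | ∀ y : 𝓞 K, ∃ m : ℤ,
          Algebra.trace ℚ K (2 * algebraMap (𝓞 K) K x * algebraMap (𝓞 K) K y / β) = m}
      add_mem' := by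
        intro x x' hx hx' y
        obtain ⟨m, hm⟩ := hx y
        obtain ⟨m', hm'⟩ := hx' y
        refine ⟨m + m', ?_⟩
        have e : 2 * algebraMap (𝓞 K) K (x + x') * algebraMap (𝓞 K) K y / β =
          2 * algebraMap (𝓞 K) K x * algebraMap (𝓞 K) K y / β +
          2 * algebraMap (𝓞 K) K x' * algebraMap (𝓞 K) K y / β := by rw [map_add]; ring
        rw [e, map_add, hm, hm', Int.cast_add]
      zero_mem' := fun y => ⟨0, by simp⟩
      neg_mem' := by
        intro x hx y
        obtain ⟨m, hm⟩ := hx y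
        refine ⟨-m, ?_⟩
        have e : 2 * algebraMap (𝓞 K) K (-x) * algebraMap (𝓞 K) K y / β =
          -(2 * algebraMap (𝓞 K) K x * algebraMap (𝓞 K) K y / β) := by rw [map_neg]; ring
        rw [e, map_neg, hm, Int.cast_neg] }
  have hL : ∀ x ∈ L, ∃ m : ℤ, Algebra.trace ℚ K ((algebraMap (𝓞 K) K x) ^ 2 / β) = m := by
    intro x hx
    have h1 : InCodiff (2 * algebraMap (𝓞 K) K x / β) := fun y => by
      obtain ⟨m, hm⟩ := hx y
      exact ⟨m, by rw [← hm]; congr 1; ring⟩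
    obtain ⟨z, hz⟩ := hβ _ h1
    obtain ⟨m, hm⟩ := h1 z
    refine ⟨m, ?_⟩
    rw [← hm, hz]
    congr 1
    field_simp
    ring
  let H : AddSubgroup D := L.map φ
  let χ : D → AddChar H ℂ := fun k =>
    { toFun := fun l => ∏ i, pairChar (d i) (k i) ((l : D) i)
      map_zero_eq_one' := by exact Finset.prod_eq_one fun i _ => pairChar_zero _
      map_add_eq_mul' := fun x y => by
        rw [← Finset.prod_mul_distrib]
        refine Finset.prod_congr rfl fun i _ => ?_
        exact pairChar_add (h.ne_zero i) _ _ _ }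
  have hχ : ∀ (k : ι → ℤ) (x : 𝓞 K), ∏ i, pairChar (d i) (k i) (φ x i) =
      eQ (Algebra.trace ℚ K ((∑ i, ((k i : ℚ) / d i) • e i) * algebraMap (𝓞 K) K x / β)) := by
    intro k x
    have : ∀ i, pairChar (d i) (k i) (φ x i) = eQ ((k i : ℚ) * N x i / (2 * d i)) := fun i =>
      pairChar_intCast (h.ne_zero i) _ _
    simp only [this]
    rw [← eQ_sum, h.trace_mul]
    congr 1
    refine Finset.sum_congr rfl fun i _ => ?_
    rw [hN, h.trace_sum_mul]
    have := hd0 i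
    field_simp
  have hhalf : ∀ k : ι → ℤ, ∑ i, ((k i : ℚ) / d i) • e i =
      2 * ∑ i, ((k i : ℚ) / (2 * d i)) • e i := by
    intro k
    rw [Finset.mul_sum]
    refine Finset.sum_congr rfl fun i _ => ?_
    simp only [Algebra.smul_def, ← mul_assoc]
    congr 1
    have : (2 : K) = algebraMap ℚ K 2 := by simp
    rw [this, ← map_mul]
    congr 1
    have := hd0 i
    field_simp
  have key := sum_eq_sum_of_transform H (fun k => k ∈ φ.range) Φ χ (by
      rintro k ⟨_, x, hx, rfl⟩
      have h1 : Φ (φ x) = 1 := by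
        rw [hΦ, eQ_eq_one_iff]
        exact hL x hx
      have h2 : Φ (k + φ x) = Φ k * Φ (φ x) * ∏ i, pairChar (d i) (k i) (φ x i) := by
        simp only [Φ, ← Finset.prod_mul_distrib]
        exact Finset.prod_congr rfl fun i _ => sqChar_add (h.ne_zero i) _ _
      rw [h1, mul_one] at h2
      exact h2) (by
    intro k
    constructor
    · intro hk
      choose k' hk' using fun i => ZMod.intCast_surjective (k i)
      obtain ⟨z, hz⟩ := exists_eq_of_forall_inCodiff
        (∑ i, ((k' i : ℚ) / (2 * d i)) • e i) (by
        intro y hy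
        obtain ⟨z, hz⟩ := hβ y hy
        have hzL : 2 * z ∈ L := fun w => by
          obtain ⟨m, hm⟩ := hy w
          refine ⟨m, ?_⟩
          rw [← hm]
          congr 1
          rw [map_mul, map_ofNat, hz]
          field_simp
          ring
        have h1 := DFunLike.congr_fun hk ⟨φ (2 * z), 2 * z, hzL, rfl⟩
        have h2 : ∏ i, pairChar (d i) (k i) (φ (2 * z) i) = 1 := h1
        simp only [← hk'] at h2
        rw [hχ, eQ_eq_one_iff] at h2
        obtain ⟨m, hm⟩ := h2
        refine ⟨m, ?_⟩
        rw [← hm]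
        congr 1
        rw [map_mul, map_ofNat, hz]
        rw [hhalf]
        field_simp
        ring)
      refine ⟨z, ?_⟩
      ext i
      have h3 := hN z i
      rw [hz, h.trace_sum_mul] at h3
      have := hd0 i
      have h4 : (N z i : ℚ) = k' i := by rw [h3]; field_simp
      have h5 : N z i = k' i := by exact_mod_cast h4
      change ((N z i : ℤ) : ZMod _) = k i
      rw [h5, hk']
    · rintro ⟨z, rfl⟩
      ext ⟨_, x, hx, rfl⟩
      change ∏ i, pairChar (d i) ((N z i : ℤ) : ZMod _) (φ x i) = 1
      rw [hχ, eQ_eq_one_iff]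
      obtain ⟨m, hm⟩ := hx z
      refine ⟨m, ?_⟩
      rw [← hm]
      congr 1
      have : algebraMap (𝓞 K) K z = ∑ i, ((N z i : ℚ) / (2 * d i)) • e i := by
        conv_lhs => rw [h.eq_sum (algebraMap (𝓞 K) K z)]
        refine Finset.sum_congr rfl fun i _ => ?_
        rw [hN]
        congr 1
        have := hd0 i
        field_simp
      rw [hhalf, this]
      ring)
  obtain ⟨r1, hr1, h1⟩ := sum_eq_of_comp_eq p hp φ.rangeRestrict φ.rangeRestrict_surjective F
    (fun k => Φ k) (fun x => by rw [hF]; exact (hΦ x).symm)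
  choose r hr h2 using fun i => sum_sqChar (h.ne_zero i)
  refine ⟨r1 * ∏ i, r i, mul_pos hr1 (Finset.prod_pos fun i _ => hr i), ?_⟩
  rw [h1]
  have h3 : ∑ k : φ.range, Φ k = ∑ k, Φ k := by
    rw [key]
    exact (Finset.sum_subtype _ (fun x => by simp) Φ).symm
  have h4 : ∑ k, Φ k = ∏ i, ∑ k, sqChar (d i) k := (Fintype.prod_sum _).symm
  rw [h3, h4, Finset.prod_congr rfl fun i _ => h2 i, Finset.prod_mul_distrib]
  push_cast
  ring

end Milgram

end GaussPhase

namespace GaussPhase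

open NumberField

lemma card_pos_le_of_congruence {ι ι' : Type*} [Fintype ι] [Fintype ι'] [DecidableEq ι']
    (d : ι → ℤ) (d' : ι' → ℤ) (L : ι → ι' → ℝ)
    (h : ∀ j k, ∑ i, d i * L i j * L i k = if j = k then (d' j : ℝ) else 0) :
    Fintype.card {j // 0 < d' j} ≤ Fintype.card {i // 0 < d i} := by
  classical
  by_contra! hlt
  let f := Matrix.mulVecLin (Matrix.of fun (i : {i // 0 < d i}) (j : {j // 0 < d' j}) => L i j)
  have hker : LinearMap.ker f ≠ ⊥ := LinearMap.ker_ne_bot_of_finrank_lt (by simpa using hlt)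
  obtain ⟨μ, hμ, hμ0⟩ := (Submodule.ne_bot_iff _).1 hker
  have hμ1 : ∀ i : {i // 0 < d i}, ∑ j : {j // 0 < d' j}, L i j * μ j = 0 := fun i =>
    congrFun (LinearMap.mem_ker.1 hμ) i
  have h1 : ∑ i, (d i : ℝ) * (∑ j : {j // 0 < d' j}, L i j * μ j) ^ 2 =
      ∑ j : {j // 0 < d' j}, (d' j : ℝ) * μ j ^ 2 := by
    calc _ = ∑ i, ∑ j : {j // 0 < d' j}, ∑ k : {j // 0 < d' j},
          μ j * μ k * (d i * L i j * L i k) := by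
          refine Finset.sum_congr rfl fun i _ => ?_
          rw [sq, Finset.sum_mul_sum, Finset.mul_sum]
          refine Finset.sum_congr rfl fun j _ => ?_
          rw [Finset.mul_sum]
          exact Finset.sum_congr rfl fun k _ => by ring
      _ = ∑ j : {j // 0 < d' j}, ∑ k : {j // 0 < d' j},
          μ j * μ k * ∑ i, (d i * L i j * L i k) := by
          rw [Finset.sum_comm]
          refine Finset.sum_congr rfl fun j _ => ?_
          rw [Finset.sum_comm]
          exact Finset.sum_congr rfl fun k _ => by rw [Finset.mul_sum]
      _ = _ := by
          refine Finset.sum_congr rfl fun j _ => ?_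
          rw [Finset.sum_eq_single j]
          · rw [h, if_pos rfl]; ring
          · intro k _ hk
            rw [h, if_neg fun e => hk (Subtype.ext e.symm), mul_zero]
          · simp
  have h2 : ∑ i, (d i : ℝ) * (∑ j : {j // 0 < d' j}, L i j * μ j) ^ 2 ≤ 0 := by
    refine Finset.sum_nonpos fun i _ => ?_
    by_cases hi : 0 < d i
    · rw [hμ1 ⟨i, hi⟩]; simp
    · have : (d i : ℝ) ≤ 0 := by exact_mod_cast not_lt.1 hi
      exact mul_nonpos_of_nonpos_of_nonneg this (sq_nonneg _)
  obtain ⟨j, hj⟩ := Function.ne_iff.1 hμ0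
  have hpos : ∀ j : {j // 0 < d' j}, 0 < (d' j : ℝ) := fun j => by exact_mod_cast j.2
  have h3 : 0 < ∑ j : {j // 0 < d' j}, (d' j : ℝ) * μ j ^ 2 :=
    Finset.sum_pos' (fun j _ => mul_nonneg (hpos j).le (sq_nonneg _))
      ⟨j, Finset.mem_univ _, mul_pos (hpos j) (by have : μ j ≠ 0 := hj; positivity)⟩
  linarith

variable {K : Type*} [Field K] [NumberField K]

lemma trace_eq_sum_ringHom (x : K) :
    ((Algebra.trace ℚ K x : ℚ) : ℂ) = ∑ σ : K →+* ℂ, σ x := by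
  have h := trace_eq_sum_embeddings (K := ℚ) (L := K) ℂ (x := x)
  rw [eq_ratCast] at h
  rw [h]
  exact (Fintype.sum_equiv (RingHom.equivRatAlgHom K ℂ) _ _ fun σ => rfl).symm

/-- Square roots of a totally positive element in all complex embeddings, compatible with
complex conjugation. -/
lemma exists_sqrt_embeddings (b : K) (hb : ∀ σ : K →+* ℝ, 0 < σ b) :
    ∃ s : (K →+* ℂ) → ℂ, (∀ σ, s σ ^ 2 = σ b) ∧
      ∀ σ, s (ComplexEmbedding.conjugate σ) = starRingEnd ℂ (s σ) := by
  classical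
  choose r hr using fun w : InfinitePlace K =>
    IsAlgClosed.exists_pow_nat_eq (w.embedding b) two_pos
  have hreal : ∀ w : InfinitePlace K, ComplexEmbedding.IsReal w.embedding →
      starRingEnd ℂ (r w) = r w := by
    intro w hw
    have h1 := hb hw.embedding
    have h2 : (hw.embedding b : ℂ) = w.embedding b :=
      ComplexEmbedding.IsReal.coe_embedding_apply hw b
    have h3 : r w ^ 2 = ((Real.sqrt (hw.embedding b) : ℝ) : ℂ) ^ 2 := by
      rw [hr, ← h2, ← Complex.ofReal_pow, Real.sq_sqrt h1.le]
    rcases sq_eq_sq_iff_eq_or_eq_neg.1 h3 with h | h <;> rw [h] <;> simp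
  refine ⟨fun σ => if (InfinitePlace.mk σ).embedding = σ then r (InfinitePlace.mk σ)
    else starRingEnd ℂ (r (InfinitePlace.mk σ)), fun σ => ?_, fun σ => ?_⟩
  · dsimp only
    split_ifs with h
    · rw [hr, h]
    · have h1 := (InfinitePlace.embedding_mk_eq σ).resolve_left h
      rw [← map_pow, hr, h1, ComplexEmbedding.conjugate_coe_eq]
      simp
  · simp only [InfinitePlace.mk_conjugate_eq]
    by_cases hσ : ComplexEmbedding.IsReal σ
    · have h1 : ComplexEmbedding.conjugate σ = σ := ComplexEmbedding.isReal_iff.1 hσ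
      have h2 : (InfinitePlace.mk σ).embedding = σ := by
        rcases InfinitePlace.embedding_mk_eq σ with h | h
        · exact h
        · rw [h, h1]
      rw [h1, if_pos h2, hreal _ (by rw [h2]; exact hσ)]
    · have h1 : ComplexEmbedding.conjugate σ ≠ σ := fun h =>
        hσ (ComplexEmbedding.isReal_iff.2 h)
      rcases InfinitePlace.embedding_mk_eq σ with h | h
      · rw [h, if_neg h1.symm, if_pos rfl]
      · rw [h, if_pos rfl, if_neg h1, Complex.conj_conj]

section

variable {β b : K} {ι ι' : Type*} [Fintype ι] [Fintype ι'] {e : Module.Basis ι ℚ K} {d : ι → ℤ}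
  {e' : Module.Basis ι' ℚ K} {d' : ι' → ℤ}

lemma TraceBasis.card_pos_le (h : TraceBasis β e d) (h' : TraceBasis (b * β) e' d')
    (hb0 : b ≠ 0) (hb : ∀ σ : K →+* ℝ, 0 < σ b) :
    Fintype.card {j // 0 < d' j} ≤ Fintype.card {i // 0 < d i} := by
  classical
  obtain ⟨s, hs, hconj⟩ := exists_sqrt_embeddings b hb
  have hs0 : ∀ σ, s σ ≠ 0 := fun σ h0 => by
    have := hs σ
    rw [h0, zero_pow two_ne_zero] at this
    exact hb0 ((map_eq_zero σ).1 this.symm)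
  have hd0 : ∀ i, (d i : ℂ) ≠ 0 := fun i => by exact_mod_cast h.ne_zero i
  have hr : ∀ x : K, starRingEnd ℂ (∑ σ, σ x / s σ) = ∑ σ, σ x / s σ := by
    intro x
    rw [map_sum]
    refine Fintype.sum_equiv (ComplexEmbedding.involutive_conjugate K).toPerm _ _ fun σ => ?_
    simp [hconj]
  choose R hR using fun x : K => Complex.conj_eq_iff_real.1 (hr x)
  refine card_pos_le_of_congruence d d' (fun i j => R (e i * e' j / β) / d i) fun j k => ?_
  have hcard : Fintype.card ι = Fintype.card (K →+* ℂ) := by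
    rw [Embeddings.card, Module.finrank_eq_card_basis e]
  let M : Matrix ι (K →+* ℂ) ℂ := Matrix.of fun i σ => σ (e i) / d i
  let N : Matrix (K →+* ℂ) ι ℂ := Matrix.of fun σ i => σ (e i) / σ β
  have hMN : M * N = 1 := by
    ext i l
    rw [Matrix.mul_apply]
    have : ∀ σ : K →+* ℂ, M i σ * N σ l = σ (e i * e l / β) / d i := fun σ => by
      simp only [M, N, Matrix.of_apply, map_div₀, map_mul]; ring
    simp only [this]
    rw [← Finset.sum_div, ← trace_eq_sum_ringHom]
    by_cases hil : i = l
    · subst hil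
      rw [h.diag, Matrix.one_apply_eq]
      push_cast
      exact div_self (hd0 i)
    · rw [h.ortho i l hil, Matrix.one_apply_ne hil]; simp
  have hNM : N * M = 1 := (Matrix.mul_eq_one_comm_of_equiv (Fintype.equivOfCardEq hcard)).1 hMN
  have hNM' : ∀ σ τ : K →+* ℂ, ∑ i, σ (e i) / σ β * (τ (e i) / d i) = if σ = τ then 1 else 0 :=
    fun σ τ => by
      have := congrFun (congrFun hNM σ) τ
      rw [Matrix.mul_apply, Matrix.one_apply] at this
      exact this
  have hC : ((∑ i, (d i : ℝ) * (R (e i * e' j / β) / d i) * (R (e i * e' k / β) / d i) : ℝ) : ℂ) =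
      ((if j = k then (d' j : ℝ) else 0 : ℝ) : ℂ) := by
    push_cast
    simp only [← hR]
    calc _ = ∑ i, ∑ σ : K →+* ℂ, ∑ τ : K →+* ℂ, (σ (e' j) / s σ * (τ (e' k) / (s τ * τ β))) *
          (σ (e i) / σ β * (τ (e i) / d i)) := by
          refine Finset.sum_congr rfl fun i _ => ?_
          rw [mul_div_cancel₀ _ (hd0 i), mul_div_assoc', Finset.sum_mul_sum, Finset.sum_div]
          refine Finset.sum_congr rfl fun σ _ => ?_
          rw [Finset.sum_div]
          refine Finset.sum_congr rfl fun τ _ => ?_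
          simp only [map_div₀, map_mul]
          ring
      _ = ∑ σ : K →+* ℂ, ∑ τ : K →+* ℂ, (σ (e' j) / s σ * (τ (e' k) / (s τ * τ β))) *
          ∑ i, (σ (e i) / σ β * (τ (e i) / d i)) := by
          rw [Finset.sum_comm]
          refine Finset.sum_congr rfl fun σ _ => ?_
          rw [Finset.sum_comm]
          exact Finset.sum_congr rfl fun τ _ => by rw [Finset.mul_sum]
      _ = ∑ σ : K →+* ℂ, σ (e' j * e' k / (b * β)) := by
          refine Finset.sum_congr rfl fun σ _ => ?_
          simp only [hNM', mul_ite, mul_one, mul_zero, Finset.sum_ite_eq, Finset.mem_univ, if_true]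
          simp only [map_div₀, map_mul, ← hs σ]
          have := hs0 σ
          field_simp
      _ = _ := by
          rw [← trace_eq_sum_ringHom]
          split_ifs with hjk
          · subst hjk
            rw [h'.diag]; simp
          · rw [h'.ortho j k hjk]; simp
  exact_mod_cast hC

lemma prod_signPhase {α : Type*} [Fintype α] (f : α → ℤ) (hf : ∀ i, f i ≠ 0) :
    ∏ i, signPhase (f i) = signPhase 1 ^ Fintype.card {i // 0 < f i} *
      signPhase (-1) ^ (Fintype.card α - Fintype.card {i // 0 < f i}) := by
  classical
  have : ∀ i, signPhase (f i) = if 0 < f i then signPhase 1 else signPhase (-1) := by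
    intro i
    split_ifs with hi
    · simp [signPhase, Int.sign_eq_one_of_pos hi]
    · simp [signPhase, Int.sign_eq_neg_one_of_neg (lt_of_le_of_ne (not_lt.1 hi) (hf i))]
  simp only [this]
  rw [Finset.prod_ite, Finset.prod_const, Finset.prod_const, Fintype.card_subtype,
    ← Finset.card_univ, ← Finset.card_filter_add_card_filter_not (s := Finset.univ)
      (fun i => 0 < f i), Nat.add_sub_cancel_left]

/-- Scaling a trace form by a totally positive element does not change its phase. -/
lemma TraceBasis.prod_signPhase_eq (h : TraceBasis β e d) (h' : TraceBasis (b * β) e' d')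
    (hb0 : b ≠ 0) (hb : ∀ σ : K →+* ℝ, 0 < σ b) :
    ∏ i, signPhase (d i) = ∏ j, signPhase (d' j) := by
  classical
  have h'' : TraceBasis (b⁻¹ * (b * β)) e d := by rwa [inv_mul_cancel_left₀ hb0]
  have hle := h.card_pos_le h' hb0 hb
  have hge := h'.card_pos_le h'' (inv_ne_zero hb0) fun σ => by
    rw [map_inv₀]; exact inv_pos.2 (hb σ)
  have hcard : Fintype.card ι = Fintype.card ι' := by
    rw [← Module.finrank_eq_card_basis e, ← Module.finrank_eq_card_basis e']
  rw [prod_signPhase d h.ne_zero, prod_signPhase d' h'.ne_zero, hcard, le_antisymm hge hle]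

end

end GaussPhase

namespace GaussPhase

section FiniteRing

variable {R : Type*} [CommRing R] [Fintype R] (Ψ : AddChar R ℂ)

/-- The quadratic Gauss sum attached to an additive character of a finite ring. -/
noncomputable def gaussQ (c : R) : ℂ := ∑ x, Ψ (c * x ^ 2)

/-- The Gauss sum of the binary form `c (x² - b y²)`. -/
noncomputable def normSum (b c : R) : ℂ := gaussQ Ψ c * gaussQ Ψ (-(c * b))

lemma card_mul_gaussQ {u v c : R} (h : IsCoprime u v) (h0 : 2 * c * (u * v) = 0) :
    (Fintype.card R : ℂ) * gaussQ Ψ c = gaussQ Ψ (c * u ^ 2) * gaussQ Ψ (c * v ^ 2) := by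
  classical
  obtain ⟨p, q, hpq⟩ := h
  let φ : R × R → R × R := fun z => (u * z.1 + v * z.2, -q * z.1 + p * z.2)
  have hφ : Function.Bijective φ := by
    refine Function.bijective_iff_has_inverse.2
      ⟨fun z => (p * z.1 - v * z.2, q * z.1 + u * z.2), fun z => ?_, fun z => ?_⟩
    · ext
      · simp only [φ]; linear_combination z.1 * hpq
      · simp only [φ]; linear_combination z.2 * hpq
    · ext
      · simp only [φ]; linear_combination z.1 * hpq
      · simp only [φ]; linear_combination z.2 * hpq
  have h1 : ∑ z : R × R, Ψ (c * z.1 ^ 2) = Fintype.card R * gaussQ Ψ c := by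
    rw [Fintype.sum_prod_type_right]
    dsimp only
    rw [Finset.sum_const, gaussQ, Finset.card_univ, nsmul_eq_mul]
  rw [← h1, ← hφ.sum_comp, Fintype.sum_prod_type, gaussQ, gaussQ, Finset.sum_mul_sum]
  refine Finset.sum_congr rfl fun x _ => Finset.sum_congr rfl fun y _ => ?_
  rw [← AddChar.map_add_eq_mul]
  congr 1
  simp only [φ]
  linear_combination x * y * h0

lemma card_sq_mul_normSum {u v b c : R} (h : IsCoprime u v) (h0 : 2 * c * (u * v) = 0) :
    (Fintype.card R : ℂ) ^ 2 * normSum Ψ b c =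
      normSum Ψ b (c * u ^ 2) * normSum Ψ b (c * v ^ 2) := by
  have h1 := card_mul_gaussQ Ψ h h0
  have h2 := card_mul_gaussQ Ψ (c := -(c * b)) h (by linear_combination -b * h0)
  have e : ∀ w : R, -(c * b) * w ^ 2 = -(c * w ^ 2 * b) := fun w => by ring
  rw [e, e] at h2
  simp only [normSum]
  linear_combination h1 * (Fintype.card R : ℂ) * gaussQ Ψ (-(c * b)) +
    gaussQ Ψ (c * u ^ 2) * gaussQ Ψ (c * v ^ 2) * h2

lemma normSum_eq (b c : R) :
    normSum Ψ b c = ∑ z : R × R, Ψ (c * (z.1 ^ 2 - b * z.2 ^ 2)) := by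
  rw [normSum, gaussQ, gaussQ, Finset.sum_mul_sum, Fintype.sum_prod_type]
  refine Finset.sum_congr rfl fun x _ => Finset.sum_congr rfl fun y _ => ?_
  rw [← AddChar.map_add_eq_mul]
  congr 1
  ring

lemma normSum_mul_norm {b c c' x₀ y₀ : R} (hN : IsUnit (x₀ ^ 2 - b * y₀ ^ 2))
    (hc : c * (x₀ ^ 2 - b * y₀ ^ 2) = c') : normSum Ψ b c' = normSum Ψ b c := by
  obtain ⟨n, hn⟩ := hN.exists_right_inv
  let φ : R × R → R × R := fun z => (x₀ * z.1 + b * y₀ * z.2, y₀ * z.1 + x₀ * z.2)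
  have hφ : Function.Bijective φ := by
    refine Function.bijective_iff_has_inverse.2
      ⟨fun z => (n * (x₀ * z.1 - b * y₀ * z.2), n * (x₀ * z.2 - y₀ * z.1)), fun z => ?_,
        fun z => ?_⟩
    · ext
      · simp only [φ]; linear_combination z.1 * hn
      · simp only [φ]; linear_combination z.2 * hn
    · ext
      · simp only [φ]; linear_combination z.1 * hn
      · simp only [φ]; linear_combination z.2 * hn
  rw [normSum_eq, normSum_eq, ← hφ.sum_comp fun z => Ψ (c * (z.1 ^ 2 - b * z.2 ^ 2))]
  refine Finset.sum_congr rfl fun z _ => ?_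
  congr 1
  simp only [φ, ← hc]
  ring

end FiniteRing

section Field

variable {F : Type*} [Field F] [Fintype F]

lemma sum_sq_add_sum_nonsquare (h2 : ringChar F ≠ 2) {f : F} (hf : ¬ IsSquare f)
    (χ : AddChar F ℂ) (hχ : χ ≠ 1) : ∑ y, χ (y ^ 2) + ∑ y, χ (f * y ^ 2) = 0 := by
  classical
  have hf0 : f ≠ 0 := fun h => hf (h ▸ IsSquare.zero)
  have h1 : ∑ y, χ (y ^ 2) = ∑ z, ((quadraticChar F z : ℂ) + 1) * χ z := by
    rw [← Finset.sum_fiberwise Finset.univ fun y : F => y ^ 2]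
    refine Finset.sum_congr rfl fun z _ => ?_
    rw [Finset.sum_congr rfl (g := fun _ => χ z)
      (fun x hx => by rw [(Finset.mem_filter.1 hx).2]), Finset.sum_const, nsmul_eq_mul]
    congr 1
    have := quadraticChar_card_sqrts h2 z
    rw [Set.toFinset_ofPred] at this
    exact_mod_cast this
  have h3 : ∑ y, χ (f * y ^ 2) = ∑ z, ((quadraticChar F z : ℂ) + 1) * χ (f * z) := by
    rw [← Finset.sum_fiberwise Finset.univ fun y : F => y ^ 2]
    refine Finset.sum_congr rfl fun z _ => ?_
    rw [Finset.sum_congr rfl (g := fun _ => χ (f * z))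
      (fun x hx => by rw [(Finset.mem_filter.1 hx).2]), Finset.sum_const, nsmul_eq_mul]
    congr 1
    have := quadraticChar_card_sqrts h2 z
    rw [Set.toFinset_ofPred] at this
    exact_mod_cast this
  have h4 : ∑ z, ((quadraticChar F z : ℂ) + 1) * χ (f * z) =
      ∑ z, (-(quadraticChar F z : ℂ) + 1) * χ z := by
    refine Fintype.sum_equiv (Equiv.mulLeft₀ f hf0) _ _ fun z => ?_
    simp only [Equiv.mulLeft₀_apply, map_mul]
    rw [(quadraticChar_neg_one_iff_not_isSquare).2 hf]
    push_cast
    ring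
  rw [h1, h3, h4, ← Finset.sum_add_distrib]
  have : ∀ z, ((quadraticChar F z : ℂ) + 1) * χ z + (-(quadraticChar F z : ℂ) + 1) * χ z =
      2 * χ z := fun z => by ring
  simp only [this]
  rw [← Finset.mul_sum, AddChar.sum_eq_zero_of_ne_one hχ, mul_zero]

lemma gaussQ_mul_nonsquare {R : Type*} [CommRing R] [Fintype R] (Ψ : AddChar R ℂ)
    (h2 : ringChar F ≠ 2) (p : R →+* F) (hp : Function.Surjective p) {k f : R}
    (hk : ∀ x, p x = 0 → k * x = 0) (hk0 : ∃ x, Ψ (k * x) ≠ 1) (hf : ¬ IsSquare (p f)) :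
    gaussQ Ψ (k * f) = - gaussQ Ψ k := by
  have hwd : ∀ x y, p x = p y → k * x = k * y := fun x y h => by
    have := hk (x - y) (by rw [map_sub, h, sub_self])
    linear_combination this
  let q := Function.surjInv hp
  have hq : ∀ y, p (q y) = y := Function.surjInv_eq hp
  let χ : AddChar F ℂ :=
    { toFun := fun y => Ψ (k * q y)
      map_zero_eq_one' := by
        rw [hwd (q 0) 0 (by rw [hq, map_zero]), mul_zero, AddChar.map_zero_eq_one]
      map_add_eq_mul' := fun x y => by
        rw [hwd (q (x + y)) (q x + q y) (by rw [map_add, hq, hq, hq]), mul_add,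
          AddChar.map_add_eq_mul] }
  have hχ : ∀ x, χ (p x) = Ψ (k * x) := fun x => by
    change Ψ (k * q (p x)) = _
    rw [hwd _ x (hq _)]
  have hχ1 : χ ≠ 1 := by
    rintro h
    obtain ⟨x, hx⟩ := hk0
    rw [← hχ, h] at hx
    exact hx rfl
  obtain ⟨r, hr, h⟩ := sum_comp_surjective p.toAddMonoidHom hp
  have h3 := h fun y => χ (y ^ 2) + χ (p f * y ^ 2)
  rw [Finset.sum_add_distrib (s := (Finset.univ : Finset F)),
    sum_sq_add_sum_nonsquare h2 hf χ hχ1, mul_zero] at h3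
  have h4 : ∀ x, χ ((p.toAddMonoidHom x) ^ 2) + χ (p f * (p.toAddMonoidHom x) ^ 2) =
      Ψ (k * x ^ 2) + Ψ (k * f * x ^ 2) := fun x => by
    have e1 : (p.toAddMonoidHom x) ^ 2 = p (x ^ 2) := (map_pow p x 2).symm
    rw [e1, ← map_mul, hχ, hχ, mul_assoc]
  simp only [h4] at h3
  rw [Finset.sum_add_distrib] at h3
  rw [gaussQ, gaussQ]
  linear_combination h3

end Field

/-- Units of a finite ring of odd order are values of `x² - b y²`. -/
lemma exists_norm_eq {R : Type*} [CommRing R] [Finite R] (h2 : IsUnit (2 : R)) {b f : R}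
    (hb : IsUnit b) (hf : IsUnit f) : ∃ x y : R, x ^ 2 - b * y ^ 2 = f := by
  classical
  have hfield : ∀ I : MaximalSpectrum R, ∃ x y : R ⧸ I.asIdeal,
      x ^ 2 - Ideal.Quotient.mk _ b * y ^ 2 = Ideal.Quotient.mk _ f := by
    intro I
    have := I.isMaximal
    let _ : Field (R ⧸ I.asIdeal) := Ideal.Quotient.field _
    have : Finite (R ⧸ I.asIdeal) := Finite.of_surjective _ Ideal.Quotient.mk_surjective
    have := Fintype.ofFinite (R ⧸ I.asIdeal)
    have h2' : (2 : R ⧸ I.asIdeal) ≠ 0 := by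
      have := (h2.map (Ideal.Quotient.mk I.asIdeal)).ne_zero
      rwa [map_ofNat] at this
    have hb' := (hb.map (Ideal.Quotient.mk I.asIdeal)).ne_zero
    have hodd : Fintype.card (R ⧸ I.asIdeal) % 2 = 1 :=
      FiniteField.odd_card_of_char_ne_two fun h => h2' (by
        have := CharP.cast_eq_zero (R ⧸ I.asIdeal) (ringChar (R ⧸ I.asIdeal))
        rw [h] at this; exact_mod_cast this)
    obtain ⟨x, y, hxy⟩ := FiniteField.exists_root_sum_quadratic
      (f := Polynomial.X ^ 2) (g := Polynomial.C (-Ideal.Quotient.mk I.asIdeal b) * Polynomial.X ^ 2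
        - Polynomial.C (Ideal.Quotient.mk I.asIdeal f))
      (by simp) (by
        rw [Polynomial.degree_sub_C, Polynomial.degree_C_mul_X_pow] <;> simp [hb']) hodd
    refine ⟨x, y, ?_⟩
    simp at hxy
    linear_combination hxy
  choose x y hxy using hfield
  let e := IsArtinianRing.quotNilradicalEquivPi R
  obtain ⟨X, hX⟩ := Ideal.Quotient.mk_surjective (e.symm x)
  obtain ⟨Y, hY⟩ := Ideal.Quotient.mk_surjective (e.symm y)
  have hn : X ^ 2 - b * Y ^ 2 - f ∈ nilradical R := by
    have he : e (Ideal.Quotient.mk _ (X ^ 2 - b * Y ^ 2 - f)) = 0 := by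
      have h1 : Ideal.Quotient.mk (nilradical R) (X ^ 2 - b * Y ^ 2 - f) =
          e.symm x ^ 2 - Ideal.Quotient.mk _ b * e.symm y ^ 2 - Ideal.Quotient.mk _ f := by
        rw [map_sub, map_sub, map_mul, map_pow, map_pow, hX, hY]
      rw [h1, map_sub, map_sub, map_mul, map_pow, map_pow, e.apply_symm_apply, e.apply_symm_apply]
      ext I
      exact sub_eq_zero.2 (hxy I)
    rw [← Ideal.Quotient.eq_zero_iff_mem]
    exact (map_eq_zero_iff e e.injective).1 he
  obtain ⟨ν, hν⟩ := hf.exists_right_inv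
  have hN : IsUnit (X ^ 2 - b * Y ^ 2) := by
    have := IsNilpotent.isUnit_add_left_of_commute (mem_nilradical.1 hn) hf (Commute.all _ _)
    convert this using 1
    ring
  obtain ⟨m, hm⟩ := hN.exists_right_inv
  obtain ⟨w, ⟨-, hw⟩, -⟩ := Polynomial.existsUnique_nilpotent_sub_and_aeval_eq_zero
    (P := Polynomial.X ^ 2 - Polynomial.C (f * m)) (x := (1 : R)) (by
      have h1 : Polynomial.aeval (1 : R) (Polynomial.X ^ 2 - Polynomial.C (f * m)) =
          m * (X ^ 2 - b * Y ^ 2 - f) := by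
        simp; linear_combination -hm
      rw [h1]
      exact (Commute.all _ _).isNilpotent_mul_left (mem_nilradical.1 hn)) (by
      simpa [one_add_one_eq_two] using h2)
  simp [sub_eq_zero] at hw
  refine ⟨w * X, w * Y, ?_⟩
  linear_combination hw * (X ^ 2 - b * Y ^ 2) + f * hm

end GaussPhase

namespace GaussPhase

open Ideal

section Lagrangian

variable {O : Type*} [CommRing O]

lemma mem_of_mul_mem_of_isCoprime {s X : O} {J : Ideal O} (h : IsCoprime (span {s}) J)
    (hX : s * X ∈ J) : X ∈ J := by
  obtain ⟨i, hi, j, hj, hij⟩ := Ideal.isCoprime_iff_exists.1 h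
  obtain ⟨α, rfl⟩ := Ideal.mem_span_singleton'.1 hi
  have := J.add_mem (J.mul_mem_left α hX) (J.mul_mem_right X hj)
  convert this using 1
  linear_combination -X * hij

variable [IsDedekindDomain O]

lemma mem_of_forall_mul_mem {X : O} {I J : Ideal O} (hJ : J ≠ ⊥)
    (h : ∀ x ∈ J, X * x ∈ I * J) : X ∈ I := by
  have h1 : span {X} * J ≤ I * J := by
    rw [Ideal.span_singleton_mul_le_iff]
    exact h
  rw [← Ideal.dvd_iff_le, mul_dvd_mul_iff_right (by simpa using hJ), Ideal.dvd_iff_le,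
    Ideal.span_singleton_le_iff_mem] at h1
  exact h1

/-- The Gauss sum of `c (x² - b y²)` is positive as soon as this form has a self-dual isotropic
lattice. -/
lemma normSum_pos (𝔐 : Ideal O) [Fintype (O ⧸ 𝔐)] (Ψ : AddChar (O ⧸ 𝔐) ℂ)
    (hΨ : ∀ x, (∀ y, Ψ (x * y) = 1) → x = 0) {b c s : O} {S T : Ideal O} (hS : S ≠ ⊥) (hT : T ≠ ⊥)
    (h2 : (2 : O) ≠ 0) (hc : ∀ X, c * X ∈ 𝔐 ↔ X ∈ span {4} * (S * T ^ 2))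
    (hs : s ^ 2 - b ∈ span {4} * S) (hsc : IsCoprime (span {s}) (span {2} * (S * T)))
    (hbT : IsCoprime (span {b}) T) :
    ∃ r : ℝ, 0 < r ∧ normSum Ψ (Ideal.Quotient.mk 𝔐 b) (Ideal.Quotient.mk 𝔐 c) = r := by
  classical
  set J : Ideal O := span {2} * (S * T) with hJ
  have h4 : (span {4} : Ideal O) = span {2} * span {2} := by
    rw [Ideal.span_singleton_mul_span_singleton]; norm_num
  have h2' : (span {2} : Ideal O) ≠ ⊥ := by simpa using h2
  have hJ0 : J ≠ ⊥ := by
    simp only [hJ, ne_eq, Ideal.mul_eq_bot, not_or]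
    exact ⟨h2', hS, hT⟩
  have hJT : J ≤ T := Ideal.mul_le_right.trans Ideal.mul_le_right
  have hJ2T : J ≤ span {2} * T := Ideal.mul_mono_right Ideal.mul_le_right
  have h4J : span {4} * (S * T ^ 2) = (span {2} * T) * J := by rw [h4, hJ]; ring
  have h4S : span {4} * S * T ≤ J := by
    have : span {4} * S * T = span {2} * J := by rw [h4, hJ]; ring
    rw [this]
    exact Ideal.mul_le_right
  have hiso : ∀ x y, y ∈ T → x - s * y ∈ J → x ^ 2 - b * y ^ 2 ∈ span {4} * (S * T ^ 2) := by
    intro x y hy hx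
    have e : x ^ 2 - b * y ^ 2 = (s ^ 2 - b) * y ^ 2 + 2 * y * (x - s * y) * s +
      (x - s * y) * (x - s * y) := by ring
    rw [e]
    refine add_mem (add_mem ?_ ?_) ?_
    · rw [← mul_assoc]
      exact Ideal.mul_mem_mul hs (Ideal.pow_mem_pow hy 2)
    · rw [h4J]
      exact Ideal.mul_mem_right _ _ (Ideal.mul_mem_mul
        (Ideal.mul_mem_mul (Ideal.mem_span_singleton_self 2) hy) hx)
    · rw [h4J]
      exact Ideal.mul_mem_mul (hJ2T hx) hx
  have hdual : ∀ X Y, (∀ x y, y ∈ T → x - s * y ∈ J →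
      2 * (X * x - b * Y * y) ∈ span {4} * (S * T ^ 2)) → Y ∈ T ∧ X - s * Y ∈ J := by
    intro X Y h
    have h' : ∀ x y, y ∈ T → x - s * y ∈ J → X * x - b * Y * y ∈ T * J := by
      intro x y hy hx
      refine mem_of_forall_mul_mem h2' fun z hz => ?_
      obtain ⟨w, rfl⟩ := Ideal.mem_span_singleton'.1 hz
      have := Ideal.mul_mem_left _ w (h x y hy hx)
      rw [h4J] at this
      convert this using 1
      · ring
      · ring
    have hX : X ∈ T := mem_of_forall_mul_mem hJ0 fun x hx => by
      have := h' x 0 T.zero_mem (by simpa using hx)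
      simpa using this
    have h1 : s * X - b * Y ∈ J := mem_of_forall_mul_mem hT fun y hy => by
      have := h' (s * y) y hy (by simp)
      rw [mul_comm J]
      convert this using 1
      ring
    have hY : Y ∈ T := mem_of_mul_mem_of_isCoprime hbT (by
      have := T.sub_mem (T.mul_mem_left s hX) (hJT h1)
      convert this using 1
      ring)
    refine ⟨hY, mem_of_mul_mem_of_isCoprime hsc ?_⟩
    have := J.sub_mem h1 (h4S (Ideal.mul_mem_mul hs hY))
    convert this using 1
    ring
  let q := Ideal.Quotient.mk 𝔐
  have hq : ∀ x, q x = 0 ↔ x ∈ 𝔐 := fun x => Ideal.Quotient.eq_zero_iff_mem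
  let H0 : AddSubgroup (O × O) :=
    { carrier := {z | z.2 ∈ T ∧ z.1 - s * z.2 ∈ J}
      add_mem' := fun {z w} hz hw => ⟨T.add_mem hz.1 hw.1, by
        have := J.add_mem hz.2 hw.2
        convert this using 1
        simp only [Prod.fst_add, Prod.snd_add]; ring⟩
      zero_mem' := by simp
      neg_mem' := fun {z} hz => ⟨T.neg_mem hz.1, by
        have := J.neg_mem hz.2
        convert this using 1
        simp only [Prod.fst_neg, Prod.snd_neg]; ring⟩ }
  let p : O × O →+ (O ⧸ 𝔐) × (O ⧸ 𝔐) := (q : O →+ O ⧸ 𝔐).prodMap (q : O →+ O ⧸ 𝔐)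
  let H := H0.map p
  let F : (O ⧸ 𝔐) × (O ⧸ 𝔐) → ℂ := fun z => Ψ (q c * (z.1 ^ 2 - q b * z.2 ^ 2))
  have hF : ∀ z ∈ H, F z = 1 := by
    rintro _ ⟨⟨x, y⟩, ⟨hy, hx⟩, rfl⟩
    have : q c * (q x ^ 2 - q b * q y ^ 2) = 0 := by
      rw [← map_pow, ← map_pow, ← map_mul, ← map_sub, ← map_mul, hq, hc]
      exact hiso x y hy hx
    change Ψ (q c * (q x ^ 2 - q b * q y ^ 2)) = 1
    rw [this, AddChar.map_zero_eq_one]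
  let χ : (O ⧸ 𝔐) × (O ⧸ 𝔐) → AddChar H ℂ := fun z =>
    { toFun := fun w => Ψ (2 * q c * (z.1 * w.1.1 - q b * z.2 * w.1.2))
      map_zero_eq_one' := by
        simp
      map_add_eq_mul' := fun w w' => by
        rw [← AddChar.map_add_eq_mul]
        congr 1
        simp only [AddSubgroup.coe_add, Prod.fst_add, Prod.snd_add]
        ring }
  have hFχ : ∀ z w, F (z + w) = F z * F w * Ψ (2 * q c * (z.1 * w.1 - q b * z.2 * w.2)) := by
    intro z w
    simp only [F]
    rw [← AddChar.map_add_eq_mul, ← AddChar.map_add_eq_mul]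
    congr 1
    simp only [Prod.fst_add, Prod.snd_add]
    ring
  have key := sum_eq_sum_of_transform H (fun z => z ∈ H) F χ (fun z w => by
      rw [hFχ, hF _ w.2, mul_one]; rfl) (fun z => by
    constructor
    · intro hz
      obtain ⟨X, hX⟩ := Ideal.Quotient.mk_surjective z.1
      obtain ⟨Y, hY⟩ := Ideal.Quotient.mk_surjective z.2
      refine ⟨(X, Y), ?_, Prod.ext hX hY⟩
      refine hdual X Y fun x y hy hx => ?_
      rw [← hc, ← hq]
      refine hΨ _ fun v => ?_
      obtain ⟨v, rfl⟩ := Ideal.Quotient.mk_surjective v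
      have := DFunLike.congr_fun hz ⟨p (x * v, y * v), (x * v, y * v), ⟨T.mul_mem_right v hy, by
        have := J.mul_mem_right v hx
        convert this using 1
        ring⟩, rfl⟩
      change Ψ (2 * q c * (z.1 * q (x * v) - q b * z.2 * q (y * v))) = 1 at this
      rw [← this]
      congr 1
      rw [← hX, ← hY]
      simp only [q, map_mul, map_sub, map_ofNat]
      ring
    · intro hz
      ext w
      have h1 := hFχ z w
      rw [hF _ hz, hF _ w.2, hF _ (H.add_mem hz w.2), one_mul, one_mul] at h1
      exact h1.symm)
  rw [normSum_eq]
  change ∃ r : ℝ, 0 < r ∧ ∑ z, F z = r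
  rw [key, Finset.sum_congr rfl (g := fun _ => 1) fun z hz => hF z (Finset.mem_filter.1 hz).2]
  refine ⟨(Finset.univ.filter fun z => z ∈ H).card, ?_, by simp⟩
  have : 0 < (Finset.univ.filter fun z => z ∈ H).card :=
    Finset.card_pos.2 ⟨0, Finset.mem_filter.2 ⟨Finset.mem_univ _, H.zero_mem⟩⟩
  exact_mod_cast this

end Lagrangian

end GaussPhase

namespace GaussPhase

open NumberField Ideal

variable {K : Type*} [Field K] [NumberField K]

/-- The ideal of all integers `x` such that `x / θ` is in the inverse different. -/
def codiffIdeal (θ : K) : Ideal (𝓞 K) where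
  carrier := {x | InCodiff (algebraMap (𝓞 K) K x / θ)}
  add_mem' := fun {x y} hx hy z => by
    obtain ⟨m, hm⟩ := hx z
    obtain ⟨n, hn⟩ := hy z
    refine ⟨m + n, ?_⟩
    rw [map_add, add_div, mul_add, map_add, hm, hn, Int.cast_add]
  zero_mem' := fun z => ⟨0, by simp⟩
  smul_mem' := fun c x hx z => by
    obtain ⟨m, hm⟩ := hx (z * c)
    refine ⟨m, ?_⟩
    have e : algebraMap (𝓞 K) K z * (algebraMap (𝓞 K) K (c • x) / θ) =
        algebraMap (𝓞 K) K (z * c) * (algebraMap (𝓞 K) K x / θ) := by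
      rw [smul_eq_mul, map_mul (algebraMap (𝓞 K) K), map_mul (algebraMap (𝓞 K) K)]
      ring
    rw [e, hm]

lemma mem_codiffIdeal {θ : K} {x : 𝓞 K} :
    x ∈ codiffIdeal θ ↔ InCodiff (algebraMap (𝓞 K) K x / θ) := Iff.rfl

lemma exists_different_multiple (m : 𝓞 K) (hm : m ≠ 0) :
    ∃ δ : K, δ ≠ 0 ∧ (∀ y : K, InCodiff y → ∃ z : 𝓞 K, algebraMap (𝓞 K) K z = δ * y / 4) ∧
      (∃ z : 𝓞 K, algebraMap (𝓞 K) K z = δ) ∧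
      ∃ r : 𝓞 K, r ∈ codiffIdeal (δ / 4) ∧ m ∣ r - 1 := by
  let D := differentIdeal ℤ (𝓞 K)
  have hD : D ≠ ⊥ := differentIdeal_ne_bot
  have hDd : (D : FractionalIdeal (nonZeroDivisors (𝓞 K)) K) =
    (FractionalIdeal.dual ℤ ℚ 1)⁻¹ := coeIdeal_differentIdeal ℤ ℚ _ _
  have hD0 : (D : FractionalIdeal (nonZeroDivisors (𝓞 K)) K) ≠ 0 := by simpa using hD
  have hDi : (D : FractionalIdeal (nonZeroDivisors (𝓞 K)) K)⁻¹ =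
    FractionalIdeal.dual ℤ ℚ 1 := by rw [hDd, inv_inv]
  have hco : ∀ y : K, InCodiff y ↔ ∀ d ∈ D, ∃ z : 𝓞 K,
      algebraMap (𝓞 K) K z = y * algebraMap (𝓞 K) K d := by
    intro y
    rw [inCodiff_iff, ← hDi, FractionalIdeal.mem_inv_iff hD0]
    constructor
    · intro h d hd
      exact (FractionalIdeal.mem_one_iff _).1 (h _ ((FractionalIdeal.mem_coeIdeal _).2 ⟨d, hd, rfl⟩))
    · intro h x hx
      obtain ⟨d, hd, rfl⟩ := (FractionalIdeal.mem_coeIdeal _).1 hx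
      exact (FractionalIdeal.mem_one_iff _).2 (h d hd)
  let E : Ideal (𝓞 K) := span {4} * D
  have hE : E ≠ ⊥ := by simp [E, hD]
  have key : ∀ δ ∈ E, (∀ y : K, InCodiff y → ∃ z : 𝓞 K,
      algebraMap (𝓞 K) K z = algebraMap (𝓞 K) K δ * y / 4) := by
    intro δ hδ y hy
    obtain ⟨d, hd, rfl⟩ := Ideal.mem_span_singleton_mul.1 hδ
    obtain ⟨z, hz⟩ := (hco y).1 hy d hd
    refine ⟨z, ?_⟩
    rw [hz, map_mul, map_ofNat]
    ring
  by_cases hm1 : span {m} = ⊤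
  · obtain ⟨δ, hδ, hδ0⟩ := Submodule.exists_mem_ne_zero_of_ne_bot hE
    refine ⟨algebraMap (𝓞 K) K δ, by simpa using hδ0, key δ hδ, ⟨δ, rfl⟩, 0,
      Ideal.zero_mem _, (Ideal.span_singleton_eq_top.1 hm1).dvd⟩
  have hEm : E * span {m} ≠ ⊥ := by simp only [ne_eq, Ideal.mul_eq_bot, not_or]; exact ⟨hE, by simpa⟩
  obtain ⟨δ, hδ⟩ := IsDedekindDomain.exists_sup_span_eq (I := E * span {m}) (J := E)
    Ideal.mul_le_left hEm
  have hδE : span {δ} ≤ E := hδ ▸ le_sup_right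
  obtain ⟨r', hr'⟩ := Ideal.dvd_iff_le.2 hδE
  have htop : span {m} ⊔ r' = ⊤ := by
    have h1 : E * (span {m} ⊔ r') = E * ⊤ := by
      rw [Ideal.mul_sup, ← hr', hδ, Ideal.mul_top]
    exact mul_left_cancel₀ (by simpa using hE) h1
  obtain ⟨i, hi, r, hr, hir⟩ := Submodule.mem_sup.1 ((Ideal.eq_top_iff_one _).1 htop)
  have hδ' := (Ideal.span_singleton_le_iff_mem _).1 hδE
  have hδ0 : δ ≠ 0 := by
    intro h1
    rw [h1, Ideal.span_singleton_zero, sup_bot_eq] at hδ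
    apply hm1
    exact mul_left_cancel₀ (a := E) (by simpa using hE) (by rw [hδ, Ideal.mul_top])
  have hδ0' : algebraMap (𝓞 K) K δ ≠ 0 := by simpa using hδ0
  refine ⟨algebraMap (𝓞 K) K δ, hδ0', key δ hδ', ⟨δ, rfl⟩, r, ?_, ?_⟩
  · rw [mem_codiffIdeal, hco]
    intro d hd
    have h1 : 4 * d * r ∈ span {δ} := by
      rw [hr']
      exact Ideal.mul_mem_mul (Ideal.mul_mem_mul (Ideal.mem_span_singleton_self _) hd) hr
    obtain ⟨z, hz⟩ := Ideal.mem_span_singleton'.1 h1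
    refine ⟨z, ?_⟩
    have h2 := congrArg (algebraMap (𝓞 K) K) hz
    simp only [map_mul, map_ofNat] at h2
    field_simp
    linear_combination h2
  · rw [Ideal.mem_span_singleton] at hi
    rw [← hir, sub_add_cancel_right]
    exact hi.neg_right

lemma signPhase_mul_conj (d : ℤ) : signPhase d * (starRingEnd ℂ) (signPhase d) = 1 := by
  rw [signPhase, ← Complex.exp_conj, ← Complex.exp_add]
  rw [Complex.exp_eq_one_iff]
  refine ⟨0, ?_⟩
  have h4 : (starRingEnd ℂ) (4 : ℂ) = 4 := map_ofNat _ 4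
  simp [h4]
  ring

lemma sum_mul_sum_pos {β b : K} (hβ0 : β ≠ 0) (hb0 : b ≠ 0)
    (hβ : ∀ y : K, InCodiff y → ∃ z : 𝓞 K, algebraMap (𝓞 K) K z = β * y / 4)
    (hbβ : ∀ y : K, InCodiff y → ∃ z : 𝓞 K, algebraMap (𝓞 K) K z = b * β * y / 4)
    (hb : ∀ σ : K →+* ℝ, 0 < σ b)
    {G : Type*} [AddCommGroup G] [Fintype G] (p : 𝓞 K →+ G) (hp : Function.Surjective p)
    (F F' : G → ℂ)
    (hF : ∀ x : 𝓞 K, F (p x) = eQ (Algebra.trace ℚ K ((algebraMap (𝓞 K) K x) ^ 2 / β)))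
    (hF' : ∀ x : 𝓞 K,
      F' (p x) = eQ (-Algebra.trace ℚ K ((algebraMap (𝓞 K) K x) ^ 2 / (b * β)))) :
    ∃ r : ℝ, 0 < r ∧ (∑ x, F x) * ∑ x, F' x = r := by
  obtain ⟨e, d, h⟩ := exists_traceBasis hβ0
  obtain ⟨e', d', h'⟩ := exists_traceBasis (mul_ne_zero hb0 hβ0)
  obtain ⟨r, hr, hrF⟩ := h.sum_eq hβ hβ0 p hp F hF
  obtain ⟨r', hr', hrF'⟩ := h'.sum_eq hbβ (mul_ne_zero hb0 hβ0) p hp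
    (fun x => (starRingEnd ℂ) (F' x)) fun x => by
      rw [hF', eQ_neg, Complex.conj_conj]
  have hphase := h.prod_signPhase_eq h' hb0 hb
  have h1 : ∑ x, F' x = (starRingEnd ℂ) (r' * ∏ i, signPhase (d i)) := by
    rw [hphase, ← hrF', map_sum]
    simp
  refine ⟨r * r', mul_pos hr hr', ?_⟩
  have h2 : (∏ i, signPhase (d i)) * (starRingEnd ℂ) (∏ i, signPhase (d i)) = 1 := by
    rw [map_prod, ← Finset.prod_mul_distrib]
    exact Finset.prod_eq_one fun i _ => signPhase_mul_conj _
  rw [hrF, h1, map_mul, Complex.conj_ofReal]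
  push_cast
  linear_combination (r * r' : ℂ) * h2

lemma exists_primitive_char (θ : K) : ∃ Ψ : AddChar (𝓞 K ⧸ codiffIdeal θ) ℂ,
    (∀ x : 𝓞 K, Ψ (Ideal.Quotient.mk _ x) =
      eQ (Algebra.trace ℚ K (algebraMap (𝓞 K) K x / θ))) ∧
    ∀ x, (∀ y, Ψ (x * y) = 1) → x = 0 := by
  let φ : 𝓞 K ⧸ codiffIdeal θ → ℂ := fun x =>
    eQ (Algebra.trace ℚ K (algebraMap (𝓞 K) K (Quotient.out x) / θ))
  have hφ : ∀ x : 𝓞 K, φ (Ideal.Quotient.mk _ x) =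
      eQ (Algebra.trace ℚ K (algebraMap (𝓞 K) K x / θ)) := by
    intro x
    have h1 : Ideal.Quotient.mk (codiffIdeal θ) (Quotient.out (Ideal.Quotient.mk (codiffIdeal θ) x)) =
      Ideal.Quotient.mk _ x := Quotient.out_eq _
    have h2 := Ideal.Quotient.eq.1 h1
    obtain ⟨m, hm⟩ := h2 1
    refine eQ_eq_of_sub m ?_
    rw [← hm, ← map_add, map_one, one_mul, map_sub, ← add_div, add_sub_cancel]
  refine ⟨⟨φ, ?_, ?_⟩, hφ, ?_⟩
  · rw [← map_zero (Ideal.Quotient.mk _), hφ]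
    simp
  · intro x y
    obtain ⟨x, rfl⟩ := Ideal.Quotient.mk_surjective x
    obtain ⟨y, rfl⟩ := Ideal.Quotient.mk_surjective y
    rw [← map_add, hφ, hφ, hφ, ← AddChar.map_add_eq_mul, ← map_add, map_add, add_div]
  · intro x hx
    obtain ⟨x, rfl⟩ := Ideal.Quotient.mk_surjective x
    rw [Ideal.Quotient.eq_zero_iff_mem]
    intro z
    have h1 : φ (Ideal.Quotient.mk _ (x * z)) = 1 := by
      rw [map_mul]; exact hx _
    rw [hφ, eQ_eq_one_iff] at h1
    obtain ⟨m, hm⟩ := h1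
    refine ⟨m, ?_⟩
    have e : algebraMap (𝓞 K) K z * (algebraMap (𝓞 K) K x / θ) =
        algebraMap (𝓞 K) K (x * z) / θ := by
      rw [map_mul (algebraMap (𝓞 K) K)]
      ring
    rw [e, hm]

lemma mem_codiffIdeal_mul {δ : K} (hδ0 : δ ≠ 0)
    (hδ : ∀ y : K, InCodiff y → ∃ z : 𝓞 K, algebraMap (𝓞 K) K z = δ * y / 4) {m : 𝓞 K}
    (hm : m ≠ 0) {x : 𝓞 K} :
    x ∈ codiffIdeal (algebraMap (𝓞 K) K m * δ) ↔ ∃ ρ ∈ codiffIdeal (δ / 4), x = 4 * m * ρ := by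
  have hm' : algebraMap (𝓞 K) K m ≠ 0 := by simpa using hm
  constructor
  · intro hx
    obtain ⟨z, hz⟩ := hδ _ hx
    refine ⟨z, ?_, ?_⟩
    · rw [mem_codiffIdeal, hz]
      convert mem_codiffIdeal.1 hx using 1
      field_simp
    · apply FaithfulSMul.algebraMap_injective (𝓞 K) K
      rw [map_mul, map_mul, map_ofNat, hz]
      field_simp
  · rintro ⟨ρ, hρ, rfl⟩
    rw [mem_codiffIdeal] at hρ ⊢
    convert hρ using 1
    rw [map_mul, map_mul, map_ofNat]
    field_simp

end GaussPhase

namespace GaussPhase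

open NumberField Ideal

variable {K : Type*} [Field K] [NumberField K]

lemma exists_norm_unit {O : Type*} [CommRing O] {b f r k : O} (ρ 𝔐 : Ideal O) [Finite (O ⧸ ρ)]
    (hr : r ∈ ρ) (hk : r - 1 = 2 * (b * f) * k) (h𝔐 : ∀ x ∈ ρ, 4 * (b * f) * x ∈ 𝔐) :
    ∃ x y : O, x ^ 2 - b * y ^ 2 - f ∈ ρ ∧ IsUnit (Ideal.Quotient.mk 𝔐 (x ^ 2 - b * y ^ 2)) := by
  have hr0 : Ideal.Quotient.mk ρ r = 0 := Ideal.Quotient.eq_zero_iff_mem.2 hr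
  have hk' := congrArg (Ideal.Quotient.mk ρ) hk
  simp only [map_sub, map_mul, map_one, map_ofNat, hr0] at hk'
  obtain ⟨X, Y, hXY⟩ := exists_norm_eq (R := O ⧸ ρ) (b := Ideal.Quotient.mk ρ b)
    (f := Ideal.Quotient.mk ρ f)
    (IsUnit.of_mul_eq_one (-(Ideal.Quotient.mk ρ (b * f * k)))
      (by simp only [map_mul]; linear_combination hk'))
    (IsUnit.of_mul_eq_one (-(Ideal.Quotient.mk ρ (2 * f * k)))
      (by simp only [map_mul, map_ofNat]; linear_combination hk'))
    (IsUnit.of_mul_eq_one (-(Ideal.Quotient.mk ρ (2 * b * k)))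
      (by simp only [map_mul, map_ofNat]; linear_combination hk'))
  obtain ⟨X, rfl⟩ := Ideal.Quotient.mk_surjective X
  obtain ⟨Y, rfl⟩ := Ideal.Quotient.mk_surjective Y
  have hN : (X + r * (1 - X)) ^ 2 - b * (Y * (1 - r)) ^ 2 - f ∈ ρ := by
    rw [← Ideal.Quotient.eq_zero_iff_mem]
    simp only [map_sub, map_mul, map_add, map_pow, map_one, hr0]
    linear_combination hXY
  refine ⟨X + r * (1 - X), Y * (1 - r), hN, ?_⟩
  set N := (X + r * (1 - X)) ^ 2 - b * (Y * (1 - r)) ^ 2 with hNdef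
  have hN1 : ∃ w, N = 1 + 2 * (b * f) * w := by
    have hr1 : r = 1 + 2 * (b * f) * k := by linear_combination hk
    refine ⟨2 * (k * (1 - X)) + 2 * (b * f) * (k * (1 - X)) ^ 2 -
      b * Y ^ 2 * (2 * (b * f)) * k ^ 2, ?_⟩
    rw [hNdef, hr1]
    ring
  obtain ⟨w, hw⟩ := hN1
  have hcop : IsCoprime N (4 * (b * f)) := by
    have h1 : IsCoprime N (2 * (b * f)) := ⟨1, -w, by rw [hw]; ring⟩
    exact (h1.pow_right (n := 2)).of_isCoprime_of_dvd_right ⟨b * f, by ring⟩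
  obtain ⟨α, β, hαβ⟩ := hcop
  have hinv : N * (-(2 * b * k)) - 1 ∈ ρ := by
    rw [← Ideal.Quotient.eq_zero_iff_mem]
    have h2 := Ideal.Quotient.eq_zero_iff_mem.2 hN
    simp only [map_sub, map_mul, map_one, map_ofNat, map_neg] at h2 ⊢
    linear_combination (-2 * Ideal.Quotient.mk ρ b * Ideal.Quotient.mk ρ k) * h2 + hk'
  refine IsUnit.of_mul_eq_one (Ideal.Quotient.mk 𝔐 (α + 4 * (b * f) * β * (-(2 * b * k)))) ?_
  have h3 := Ideal.Quotient.eq_zero_iff_mem.2 (𝔐.mul_mem_left β (h𝔐 _ hinv))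
  have h4 := congrArg (Ideal.Quotient.mk 𝔐) hαβ
  simp only [map_sub, map_mul, map_one, map_ofNat, map_neg, map_add] at h3 h4 ⊢
  linear_combination h3 + h4

set_option maxHeartbeats 1000000 in
theorem isSquare_of_real_pos (b f s : 𝓞 K) [hbm : (span {b}).IsMaximal]
    (hb0 : b ≠ 0) (h2b : (2 : 𝓞 K) ∉ span {b})
    (hpos : ∀ σ : K →+* ℝ, 0 < σ (algebraMap (𝓞 K) K b)) (hfb : f ∉ span {b}) (S T : Ideal (𝓞 K))
    (hST : S * T ^ 2 = span {f}) (hs : s ^ 2 - b ∈ span {4} * S)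
    (hsc : IsCoprime (span {s}) (span {2} * (S * T))) :
    IsSquare (Ideal.Quotient.mk (span {b}) f) := by
  classical
  by_contra hnsq
  have hf0 : f ≠ 0 := fun h => hfb (h ▸ Ideal.zero_mem _)
  have hbf0 : b * f ≠ 0 := mul_ne_zero hb0 hf0
  obtain ⟨δ, hδ0, hδ, ⟨δ', hδ'⟩, r, hr, k, hk⟩ :=
    exists_different_multiple (2 * (b * f)) (mul_ne_zero two_ne_zero hbf0)
  have hmem : ∀ x, x ∈ codiffIdeal (algebraMap (𝓞 K) K (b * f) * δ) ↔
    ∃ ρ ∈ codiffIdeal (δ / 4), x = 4 * (b * f) * ρ := fun x => mem_codiffIdeal_mul hδ0 hδ hbf0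
  set 𝔐 := codiffIdeal (algebraMap (𝓞 K) K (b * f) * δ) with h𝔐
  set ρ := codiffIdeal (δ / 4) with hρ
  obtain ⟨Ψ, hΨ, hprim⟩ : ∃ Ψ : AddChar (𝓞 K ⧸ 𝔐) ℂ, (∀ x : 𝓞 K, Ψ (Ideal.Quotient.mk 𝔐 x) =
      eQ (Algebra.trace ℚ K (algebraMap (𝓞 K) K x / (algebraMap (𝓞 K) K (b * f) * δ)))) ∧
      ∀ x, (∀ y, Ψ (x * y) = 1) → x = 0 := exists_primitive_char _
  have hr0 : r ≠ 0 := by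
    rintro rfl
    apply hbm.ne_top
    rw [Ideal.eq_top_iff_one, Ideal.mem_span_singleton]
    exact ⟨-(2 * f * k), by linear_combination -hk⟩
  have hmr : 4 * (b * f) * r ∈ 𝔐 := (hmem _).2 ⟨r, hr, rfl⟩
  have hfin : Finite (𝓞 K ⧸ 𝔐) := Ideal.finiteQuotientOfFreeOfNeBot _ fun h => by
    rw [h, Ideal.mem_bot] at hmr
    exact mul_ne_zero (mul_ne_zero (OfNat.ofNat_ne_zero 4) hbf0) hr0 hmr
  have hfinρ : Finite (𝓞 K ⧸ ρ) := Ideal.finiteQuotientOfFreeOfNeBot _ fun h => by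
    rw [h, Ideal.mem_bot] at hr
    exact hr0 hr
  let _ : Fintype (𝓞 K ⧸ 𝔐) := Fintype.ofFinite _
  let q := Ideal.Quotient.mk 𝔐
  have hq : Function.Surjective q := Ideal.Quotient.mk_surjective
  have hq0 : ∀ x, q x = 0 ↔ x ∈ 𝔐 := fun x => Ideal.Quotient.eq_zero_iff_mem
  have hΨq : ∀ c x : 𝓞 K, Ψ (q c * (q x) ^ 2) =
      eQ (Algebra.trace ℚ K (algebraMap (𝓞 K) K c * (algebraMap (𝓞 K) K x) ^ 2 /
        (algebraMap (𝓞 K) K (b * f) * δ))) := by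
    intro c x
    rw [← map_pow, ← map_mul, hΨ, map_mul (algebraMap (𝓞 K) K) c, map_pow]
  have hb0' : algebraMap (𝓞 K) K b ≠ 0 := by simpa using hb0
  have hf0' : algebraMap (𝓞 K) K f ≠ 0 := by simpa using hf0
  have hcond : ∀ (m : 𝓞 K) (y : K), InCodiff y →
      ∃ z : 𝓞 K, algebraMap (𝓞 K) K z = algebraMap (𝓞 K) K m * δ * y / 4 := by
    intro m y hy
    obtain ⟨z, hz⟩ := hδ y hy
    exact ⟨m * z, by rw [map_mul, hz]; ring⟩
  have hkey : ∀ m n : 𝓞 K, m * n = f → ∃ p : ℝ, 0 < p ∧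
      gaussQ Ψ (q (n * b)) * gaussQ Ψ (-q n) = p := by
    intro m n hmn
    have hm0 : algebraMap (𝓞 K) K m ≠ 0 := by
      intro h
      rw [map_eq_zero_iff _ (FaithfulSMul.algebraMap_injective (𝓞 K) K)] at h
      exact hf0 (by rw [← hmn, h, zero_mul])
    have hmn' : algebraMap (𝓞 K) K m * algebraMap (𝓞 K) K n = algebraMap (𝓞 K) K f := by
      rw [← hmn, map_mul]
    have hn0 : algebraMap (𝓞 K) K n ≠ 0 := fun h => hf0' (by rw [← hmn', h, mul_zero])
    refine sum_mul_sum_pos (β := algebraMap (𝓞 K) K m * δ) (b := algebraMap (𝓞 K) K b)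
      (mul_ne_zero hm0 hδ0) hb0' (hcond m) ?_ hpos q.toAddMonoidHom hq _ _ ?_ ?_
    · intro y hy
      obtain ⟨z, hz⟩ := hcond (b * m) y hy
      exact ⟨z, by rw [hz, map_mul]; ring⟩
    · intro x
      refine (hΨq (n * b) x).trans ?_
      congr 2
      rw [map_mul (algebraMap (𝓞 K) K), map_mul (algebraMap (𝓞 K) K), ← hmn']
      field_simp
    · intro x
      have := hΨq (-n) x
      rw [map_neg] at this
      refine this.trans ?_
      rw [← map_neg]
      congr 2
      rw [map_neg (algebraMap (𝓞 K) K), map_mul (algebraMap (𝓞 K) K), ← hmn']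
      field_simp
  obtain ⟨p₁, hp₁, hP₁⟩ := hkey f 1 (mul_one f)
  obtain ⟨p₂, hp₂, hP₂⟩ := hkey 1 f (one_mul f)
  have hcop : ∀ x, x ∣ (4 * (b * f) ^ 2) → IsCoprime r x := by
    intro x hx
    refine IsCoprime.of_isCoprime_of_dvd_right ?_ hx
    have h1 : IsCoprime r (2 * (b * f)) := ⟨1, -k, by linear_combination hk⟩
    convert h1.pow_right (n := 2) using 1
    ring
  have hcopb : ∀ x ∉ span {b}, IsCoprime b x := by
    intro x hx
    obtain ⟨y, i, hi, h⟩ := hbm.exists_inv hx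
    obtain ⟨z, rfl⟩ := Ideal.mem_span_singleton'.1 hi
    exact ⟨z, y, by rw [← h]; ring⟩
  have hb2 : IsCoprime b 2 := hcopb _ h2b
  have hbf : IsCoprime b f := hcopb _ hfb
  have hbr : IsCoprime b r := (hcop b ⟨4 * b * f ^ 2, by ring⟩).symm
  have hub : IsCoprime (4 * f * r) b := by
    have h4 : IsCoprime 4 b := by
      convert (hb2.symm.pow_left (m := 2)) using 1
      norm_num
    exact (h4.mul_left hbf.symm).mul_left hbr.symm
  have hr4f : IsCoprime r (4 * f) := hcop _ ⟨b ^ 2 * f, by ring⟩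
  set C : ℂ := (Fintype.card (𝓞 K ⧸ 𝔐) : ℂ) with hC
  have hmr' : 4 * q b * q f * q r = 0 := by
    have := (hq0 _).2 hmr
    simp only [map_mul, map_ofNat] at this
    linear_combination this
  have hA : ∀ n : 𝓞 K, C * gaussQ Ψ (-q n) =
      gaussQ Ψ (-q n * q (4 * f * r) ^ 2) * gaussQ Ψ (-q n * q b ^ 2) := by
    intro n
    refine card_mul_gaussQ Ψ (hub.map q) ?_
    simp only [map_mul, map_ofNat]
    linear_combination -2 * q n * hmr'
  have hA' : ∀ n : 𝓞 K, normSum Ψ (q b) (q (n * b)) * gaussQ Ψ (-q n * q (4 * f * r) ^ 2) =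
      C * (gaussQ Ψ (q (n * b)) * gaussQ Ψ (-q n)) := by
    intro n
    have e : -(q (n * b) * q b) = -q n * q b ^ 2 := by rw [map_mul]; ring
    rw [normSum, e]
    linear_combination -gaussQ Ψ (q (n * b)) * hA n
  have hB : gaussQ Ψ (-q f * q (4 * f * r) ^ 2) = -gaussQ Ψ (-q 1 * q (4 * f * r) ^ 2) := by
    let _ : Field (𝓞 K ⧸ span {b}) := Ideal.Quotient.field _
    have hfinb : Finite (𝓞 K ⧸ span {b}) :=
      Ideal.finiteQuotientOfFreeOfNeBot _ (by simpa using hb0)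
    let _ : Fintype (𝓞 K ⧸ span {b}) := Fintype.ofFinite _
    have hle : 𝔐 ≤ span {b} := by
      intro x hx
      obtain ⟨y, _, rfl⟩ := (hmem x).1 hx
      exact Ideal.mem_span_singleton.2 ⟨4 * f * y, by ring⟩
    have := gaussQ_mul_nonsquare (F := 𝓞 K ⧸ span {b}) Ψ ?_ (Ideal.Quotient.factor hle)
      (Ideal.Quotient.factor_surjective hle) (k := -q 1 * q (4 * f * r) ^ 2) (f := q f) ?_ ?_ ?_
    · rw [← this]
      congr 1
      rw [map_one]
      ring
    · intro hchar
      apply h2b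
      rw [← Ideal.Quotient.eq_zero_iff_mem, map_ofNat]
      have := ringChar.Nat.cast_ringChar (R := 𝓞 K ⧸ span {b})
      rw [hchar] at this
      exact_mod_cast this
    · intro x hx
      obtain ⟨x, rfl⟩ := hq x
      have hx' : x ∈ span {b} := Ideal.Quotient.eq_zero_iff_mem.1 hx
      obtain ⟨y, rfl⟩ := Ideal.mem_span_singleton.1 hx'
      simp only [map_mul, map_ofNat, map_one]
      linear_combination -4 * q f * q r * q y * hmr'
    · by_contra! hall
      have h0 := hprim _ hall
      have h1 : (4 * f * r) ^ 2 ∈ 𝔐 := by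
        rw [← hq0, map_pow]
        rw [map_one] at h0
        linear_combination -h0
      have h2 := hle h1
      have h3 : IsCoprime b ((4 * f * r) ^ 2) := hub.symm.pow_right
      exact hbm.ne_top (Ideal.eq_top_iff_one _ |>.2 (by
        obtain ⟨α, β, h⟩ := h3
        rw [← h]
        exact Ideal.add_mem _ (Ideal.mul_mem_left _ _ (Ideal.mem_span_singleton_self b))
          (Ideal.mul_mem_left _ _ h2)))
    · exact hnsq
  have hD : ∀ n : 𝓞 K, C ^ 2 * normSum Ψ (q b) (q (n * b)) =
      normSum Ψ (q b) (q (n * b) * q r ^ 2) * normSum Ψ (q b) (q (n * b) * q (4 * f) ^ 2) := by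
    intro n
    refine card_sq_mul_normSum Ψ (hr4f.map q) ?_
    simp only [map_mul, map_ofNat]
    linear_combination 2 * q n * hmr'
  have hr4 : IsCoprime r 4 := hcop _ ⟨(b * f) ^ 2, by ring⟩
  have hsT : S ≠ ⊥ ∧ T ≠ ⊥ := by
    constructor <;> rintro rfl <;> simp at hST <;> exact hf0 (Ideal.span_singleton_eq_bot.1 hST.symm)
  obtain ⟨P₁, hP₁0, hPP₁⟩ : ∃ x : ℝ, 0 < x ∧ normSum Ψ (q b) (q (1 * b) * q r ^ 2) = x := by
    rw [← map_pow, ← map_mul]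
    refine normSum_pos 𝔐 Ψ hprim hsT.1 hsT.2 two_ne_zero ?_ hs hsc ?_
    · intro X
      rw [hST, Ideal.span_singleton_mul_span_singleton, Ideal.mem_span_singleton, hmem]
      constructor
      · rintro ⟨y, hy, h⟩
        have h1 : r ^ 2 * X = 4 * f * y := mul_left_cancel₀ hb0 (by linear_combination h)
        exact (hr4f.symm.pow_right (n := 2)).dvd_of_dvd_mul_left ⟨y, h1⟩
      · rintro ⟨y, rfl⟩
        exact ⟨r ^ 2 * y, ρ.mul_mem_right _ (ρ.pow_mem_of_mem hr 2 two_pos), by ring⟩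
    · have h1 : span {f} ≤ T := by
        rw [← hST]
        exact Ideal.mul_le_right.trans (Ideal.pow_le_self two_ne_zero)
      exact IsCoprime.of_isCoprime_of_dvd_right ((Ideal.isCoprime_span_singleton_iff _ _).2 hbf)
        (Ideal.dvd_iff_le.2 h1)
  obtain ⟨P₂, hP₂0, hPP₂⟩ : ∃ x : ℝ, 0 < x ∧ normSum Ψ (q b) (q (f * b) * q r ^ 2) = x := by
    rw [← map_pow, ← map_mul]
    refine normSum_pos 𝔐 Ψ hprim (S := 1) (T := 1) one_ne_zero one_ne_zero two_ne_zero ?_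
      (s := s) ?_ ?_ ?_
    · intro X
      rw [one_pow, mul_one, mul_one, Ideal.mem_span_singleton, hmem]
      constructor
      · rintro ⟨y, hy, h⟩
        have h1 : r ^ 2 * X = 4 * y := mul_left_cancel₀ hbf0 (by linear_combination h)
        exact (hr4.symm.pow_right (n := 2)).dvd_of_dvd_mul_left ⟨y, h1⟩
      · rintro ⟨y, rfl⟩
        exact ⟨r ^ 2 * y, ρ.mul_mem_right _ (ρ.pow_mem_of_mem hr 2 two_pos), by ring⟩
    · rw [mul_one]
      exact (show span {4} * S ≤ span {4} from Ideal.mul_le_left) hs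
    · rw [mul_one, mul_one]
      exact IsCoprime.of_mul_right_left hsc
    · exact isCoprime_one_right
  have hE : normSum Ψ (q b) (q (f * b) * q (4 * f) ^ 2) =
      normSum Ψ (q b) (q (1 * b) * q (4 * f) ^ 2) := by
    obtain ⟨x, y, hxy, hunit⟩ := exists_norm_unit ρ 𝔐 hr hk fun x hx => (hmem _).2 ⟨x, hx, rfl⟩
    rw [map_sub, map_mul, map_pow, map_pow] at hunit
    refine normSum_mul_norm Ψ hunit ?_
    have h1 := (hq0 _).2 (𝔐.mul_mem_left (4 * f) ((hmem _).2 ⟨_, hxy, rfl⟩))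
    simp only [map_sub, map_mul, map_pow, map_ofNat, map_one] at h1 ⊢
    linear_combination h1
  have hCr : ∃ c : ℝ, 0 < c ∧ C = c := ⟨Fintype.card (𝓞 K ⧸ 𝔐), by
    exact_mod_cast Fintype.card_pos, by simp [hC]⟩
  obtain ⟨c, hc, hCc⟩ := hCr
  have e1 := hA' 1
  have e2 := hA' f
  rw [hB] at e2
  have d1 := hD 1
  have d2 := hD f
  rw [hP₁] at e1
  rw [hP₂] at e2
  rw [hPP₁] at d1
  rw [hPP₂, hE] at d2
  rw [hCc] at e1 e2 d1 d2
  have hfinal : (c ^ 2 * P₂ * c * p₁ + P₁ * c ^ 2 * c * p₂ : ℂ) = 0 := by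
    linear_combination (-c ^ 2 * P₂ : ℂ) * e1 - (c ^ 2 * P₁ : ℂ) * e2 +
      P₂ * gaussQ Ψ (-q 1 * q (4 * f * r) ^ 2) * d1 -
      P₁ * gaussQ Ψ (-q 1 * q (4 * f * r) ^ 2) * d2
  have : c ^ 2 * P₂ * c * p₁ + P₁ * c ^ 2 * c * p₂ = 0 := by exact_mod_cast hfinal
  have : 0 < c ^ 2 * P₂ * c * p₁ + P₁ * c ^ 2 * c * p₂ := by positivity
  linarith

end GaussPhase

namespace LocalTools

open Polynomial

variable {K : Type*} [Field K] [NumberField K] (π : HeightOneSpectrum (𝓞 K))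

/-- The ring homomorphism from the integers of `K` to the completion at `π`. -/
noncomputable def toCompletion : 𝓞 K →+* π.adicCompletion K :=
  (algebraMap K (π.adicCompletion K)).comp (algebraMap (𝓞 K) K)

lemma toCompletion_injective : Function.Injective (toCompletion π) :=
  (algebraMap K (π.adicCompletion K)).injective.comp (FaithfulSMul.algebraMap_injective _ _)

lemma valued_toCompletion (x : 𝓞 K) : Valued.v (toCompletion π x) = π.intValuation x := by
  rw [← π.valuation_of_algebraMap (K := K)]
  exact HeightOneSpectrum.valuedAdicCompletion_eq_valuation' π (algebraMap (𝓞 K) K x)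

lemma exists_norm_le : ∃ ρ : ℝ, 0 ≤ ρ ∧ ρ < 1 ∧ ∀ (k : ℕ) (x : 𝓞 K), x ∈ π.asIdeal ^ k →
    ‖toCompletion π x‖ ≤ ρ ^ k := by
  have h1 := NumberField.HeightOneSpectrum.one_lt_absNorm_nnreal π
  refine ⟨WithZeroMulInt.toNNReal h1.ne_zero (WithZero.exp (-1)), NNReal.coe_nonneg _, ?_, ?_⟩
  · rw [← NNReal.coe_one, NNReal.coe_lt_coe, WithZeroMulInt.toNNReal_lt_one_iff h1]
    exact WithZero.exp_lt_exp.2 (by norm_num)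
  · intro k x hx
    rw [← HeightOneSpectrum.intValuation_le_pow_iff_mem, ← valued_toCompletion] at hx
    rw [NumberField.FinitePlace.norm_def, ← NNReal.coe_pow, NNReal.coe_le_coe, ← map_pow]
    refine (WithZeroMulInt.toNNReal_strictMono h1).monotone (hx.trans_eq ?_)
    rw [← WithZero.exp_nsmul]
    simp

theorem exists_root (P : (𝓞 K)[X]) (x₀ : 𝓞 K) (h0 : P.eval x₀ ∈ π.asIdeal)
    (h1 : P.derivative.eval x₀ ∉ π.asIdeal) :
    ∃ x : π.adicCompletion K, P.eval₂ (toCompletion π) x = 0 := by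
  have hmax := π.isMaximal
  obtain ⟨u, i, hi, hu⟩ := hmax.exists_inv h1
  let step : 𝓞 K → 𝓞 K := fun x => x - u * P.eval x
  let x : ℕ → 𝓞 K := fun k => step^[k] x₀
  have hx : ∀ k, x (k + 1) = x k - u * P.eval (x k) := fun k => by
    simp only [x, Function.iterate_succ_apply', step]
  have hinv : ∀ k, x k - x₀ ∈ π.asIdeal ∧ P.eval (x k) ∈ π.asIdeal ^ (k + 1) := by
    intro k
    induction k with
    | zero => simpa [x] using h0
    | succ k ih =>
      obtain ⟨ih1, ih2⟩ := ih
      have ih2' : P.eval (x k) ∈ π.asIdeal := Ideal.pow_le_self (by omega) ih2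
      refine ⟨?_, ?_⟩
      · rw [hx, sub_right_comm]
        exact sub_mem ih1 (Ideal.mul_mem_left _ _ ih2')
      · obtain ⟨c, hc⟩ := P.binomExpansion (x k) (-(u * P.eval (x k)))
        obtain ⟨e, he⟩ := sub_dvd_eval_sub (x k) x₀ P.derivative
        have h2 : P.eval (x (k + 1)) = P.eval (x k) *
            (i - u * ((x k - x₀) * e) + c * u ^ 2 * P.eval (x k)) := by
          rw [hx, sub_eq_add_neg, hc, ← he]
          linear_combination -(eval (x k) P) * hu
        rw [h2, pow_succ (n := k + 1)]
        refine Ideal.mul_mem_mul ih2 (Ideal.add_mem _ (sub_mem hi (Ideal.mul_mem_left _ _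
          (Ideal.mul_mem_right _ _ ih1))) (Ideal.mul_mem_left _ _ ih2'))
  obtain ⟨ρ, hρ0, hρ1, hρ⟩ := exists_norm_le π
  have hcau : CauchySeq fun k => toCompletion π (x k) := by
    refine cauchySeq_of_le_geometric ρ ρ hρ1 fun k => ?_
    rw [dist_eq_norm, ← map_sub, ← pow_succ']
    refine hρ _ _ ?_
    rw [hx, sub_sub_cancel]
    exact Ideal.mul_mem_left _ _ (hinv k).2
  obtain ⟨y, hy⟩ := cauchySeq_tendsto_of_complete hcau
  refine ⟨y, ?_⟩
  have hcont : Continuous fun z : π.adicCompletion K => P.eval₂ (toCompletion π) z :=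
    P.continuous_eval₂ _
  have ht := (hcont.tendsto y).comp hy
  refine tendsto_nhds_unique ht ?_
  refine squeeze_zero_norm (a := fun k => ρ ^ (k + 1)) (fun k => ?_) ?_
  · simp only [Function.comp]
    rw [eval₂_at_apply]
    exact hρ _ _ (hinv k).2
  · exact (tendsto_pow_atTop_nhds_zero_of_lt_one hρ0 hρ1).comp (Filter.tendsto_add_atTop_nat 1)

/-- An integer congruent to the `n`-th power of a unit is an `n`-th power in the completion. -/
lemma exists_pow_eq {n : ℕ} {A t : 𝓞 K} (h : t ^ n - A ∈ π.asIdeal)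
    (hn : (n : 𝓞 K) * t ∉ π.asIdeal) : ∃ x : π.adicCompletion K, x ^ n = toCompletion π A := by
  have hp := π.isPrime
  obtain ⟨x, hx⟩ := exists_root π (X ^ n - C A) t (by simpa using h) (by
    simp only [derivative_sub, derivative_X_pow, derivative_C, sub_zero, eval_mul, eval_pow,
      eval_X, map_natCast, eval_natCast]
    intro h
    rcases hp.mem_or_mem h with h | h
    · exact hn (Ideal.mul_mem_right _ _ h)
    · exact hn (Ideal.mul_mem_left _ _ (hp.mem_of_pow_mem _ h)))
  refine ⟨x, ?_⟩
  simpa [sub_eq_zero] using hx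

lemma isSquare_of_residue (h2 : (2 : 𝓞 K) ∉ π.asIdeal) {A : 𝓞 K} (hA : A ∉ π.asIdeal)
    (h : IsSquare (Ideal.Quotient.mk π.asIdeal A)) : IsSquare (toCompletion π A) := by
  have hp := π.isPrime
  obtain ⟨t, ht⟩ := h
  obtain ⟨t, rfl⟩ := Ideal.Quotient.mk_surjective t
  have h1 : t ^ 2 - A ∈ π.asIdeal := by
    rw [← Ideal.Quotient.eq, ht, map_pow, sq]
  obtain ⟨x, hx⟩ := exists_pow_eq π (n := 2) h1 (by
    intro h
    rcases hp.mem_or_mem h with h | h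
    · exact h2 (by simpa using h)
    · apply hA
      have := sub_mem (Ideal.pow_mem_of_mem _ h 2 two_pos) h1
      simpa using this)
  exact ⟨x, by rw [← hx, sq]⟩

lemma exists_sq_sub_mem {A : 𝓞 K} (h : IsSquare (toCompletion π A)) (k : ℕ) :
    ∃ s : 𝓞 K, s ^ 2 - A ∈ π.asIdeal ^ k := by
  obtain ⟨y, hy⟩ := h
  have hy1 : Valued.v y ≤ 1 := by
    have h1 : Valued.v y ^ 2 ≤ 1 := by
      rw [sq, ← map_mul, ← hy, valued_toCompletion]
      exact π.intValuation_le_one A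
    exact (pow_le_one_iff two_ne_zero).1 h1
  have hopen : IsOpen {z : π.adicCompletion K | Valued.v (z - y) < WithZero.exp (-(k : ℤ) : ℤ)} := by
    have h1 := NumberField.HeightOneSpectrum.one_lt_absNorm_nnreal π
    have e : {z : π.adicCompletion K | Valued.v (z - y) < WithZero.exp (-(k : ℤ) : ℤ)} =
        {z | ‖z - y‖ < WithZeroMulInt.toNNReal h1.ne_zero (WithZero.exp (-(k : ℤ)))} := by
      ext z
      rw [Set.mem_ofPred_eq, Set.mem_ofPred_eq, NumberField.FinitePlace.norm_def, NNReal.coe_lt_coe]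
      exact (WithZeroMulInt.toNNReal_strictMono h1).lt_iff_lt.symm
    rw [e]
    exact isOpen_lt (by fun_prop) continuous_const
  obtain ⟨z, hz⟩ := (π.denseRange_algebraMap K).exists_mem_open hopen
    ⟨y, by simp⟩
  have hz' : Valued.v (algebraMap K (π.adicCompletion K) z - y) < WithZero.exp (-(k : ℤ)) := hz
  have hk1 : WithZero.exp (-(k : ℤ)) ≤ 1 := by
    rw [← WithZero.exp_zero, WithZero.exp_le_exp]; omega
  have hz1 : π.valuation K z ≤ 1 := by
    rw [← HeightOneSpectrum.valuedAdicCompletion_eq_valuation']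
    have := Valuation.map_add_le Valued.v (hz'.le.trans hk1) hy1
    rwa [sub_add_cancel] at this
  obtain ⟨s, hs⟩ := π.exists_valuation_sub_lt_of_integer hz1
    (Units.mk0 (WithZero.exp (-(k : ℤ))) WithZero.exp_ne_zero)
  refine ⟨s, ?_⟩
  have hs' : Valued.v (toCompletion π s - y) ≤ WithZero.exp (-(k : ℤ)) := by
    have h1 : Valued.v (toCompletion π s - algebraMap K (π.adicCompletion K) z) ≤
        WithZero.exp (-(k : ℤ)) := by
      rw [← HeightOneSpectrum.valuedAdicCompletion_eq_valuation'] at hs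
      rw [Units.val_mk0] at hs
      convert hs.le using 2
      exact (map_sub (algebraMap K (π.adicCompletion K)) _ _).symm
    have := Valuation.map_add_le Valued.v h1 hz'.le
    rwa [sub_add_sub_cancel] at this
  rw [← HeightOneSpectrum.intValuation_le_pow_iff_mem, ← valued_toCompletion, map_sub, map_pow, hy]
  have e : toCompletion π s ^ 2 - y * y =
    (toCompletion π s - y) * (toCompletion π s + y) := by ring
  rw [e, map_mul]
  refine mul_le_of_le_of_le_one hs' (Valuation.map_add_le Valued.v ?_ hy1)
  rw [valued_toCompletion]
  exact π.intValuation_le_one s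

lemma isSquare_residue {A : 𝓞 K} (h : IsSquare (toCompletion π A)) :
    IsSquare (Ideal.Quotient.mk π.asIdeal A) := by
  obtain ⟨s, hs⟩ := exists_sq_sub_mem π h 1
  rw [pow_one, ← Ideal.Quotient.eq, map_pow, sq] at hs
  exact ⟨_, hs.symm⟩

end LocalTools

namespace CurveBound

open PowerSeries

variable {F : Type*} [Field F]

lemma exists_sq_eq_of_constantCoeff (h2 : (2 : F) ≠ 0) (P : F⟦X⟧) (y₀ : F)
    (hy : y₀ ^ 2 = constantCoeff P) (h0 : y₀ ≠ 0) :
    ∃ y : F⟦X⟧, y ^ 2 = P ∧ constantCoeff y = y₀ := by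
  have key : ∀ n : ℕ, ∃ Q : F⟦X⟧, constantCoeff Q = y₀ ∧ X ^ (n + 1) ∣ Q ^ 2 - P := by
    intro n
    induction n with
    | zero =>
      refine ⟨C y₀, by simp, ?_⟩
      rw [zero_add, pow_one, X_dvd_iff]
      simp [hy]
    | succ n ih =>
      obtain ⟨Q, hQ, R, hR⟩ := ih
      refine ⟨Q - C (constantCoeff R / (2 * y₀)) * X ^ (n + 1), by simp [hQ], ?_⟩
      have : (Q - C (constantCoeff R / (2 * y₀)) * X ^ (n + 1)) ^ 2 - P =
          X ^ (n + 1) * (R - 2 * C (constantCoeff R / (2 * y₀)) * Q +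
            C (constantCoeff R / (2 * y₀)) ^ 2 * X ^ (n + 1)) := by
        linear_combination hR
      rw [this, pow_succ]
      refine mul_dvd_mul_left _ ?_
      rw [X_dvd_iff]
      simp only [map_add, map_sub, map_mul, map_pow, constantCoeff_C, constantCoeff_X, hQ,
        map_ofNat]
      field_simp
      ring
  choose Q hQ0 hQ using key
  have hdiff : ∀ n k, n ≤ k → X ^ (n + 1) ∣ Q k - Q n := by
    intro n k hnk
    have h1 : X ^ (n + 1) ∣ (Q k - Q n) * (Q k + Q n) := by
      have e : (Q k - Q n) * (Q k + Q n) = (Q k ^ 2 - P) - (Q n ^ 2 - P) := by ring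
      rw [e]
      exact dvd_sub ((pow_dvd_pow _ (by omega)).trans (hQ k)) (hQ n)
    have hu : IsUnit (Q k + Q n) := by
      rw [isUnit_iff_constantCoeff, map_add, hQ0, hQ0, ← two_mul]
      exact (mul_ne_zero h2 h0).isUnit
    exact hu.dvd_mul_right.1 h1
  refine ⟨mk fun n => coeff n (Q n), ?_, ?_⟩
  · have happ : ∀ n, X ^ (n + 1) ∣ (mk fun n => coeff n (Q n)) - Q n := by
      intro n
      rw [X_pow_dvd_iff]
      intro i hi
      have := X_pow_dvd_iff.1 (hdiff i n (by omega)) i (by omega)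
      rw [map_sub, coeff_mk]
      rw [map_sub] at this
      linear_combination -this
    rw [← sub_eq_zero]
    ext n
    rw [map_zero]
    suffices h : X ^ (n + 1) ∣ (mk fun n => coeff n (Q n)) ^ 2 - P from
      X_pow_dvd_iff.1 h n (by omega)
    have e : (mk fun n => coeff n (Q n)) ^ 2 - P = ((mk fun n => coeff n (Q n)) - Q n) *
      ((mk fun n => coeff n (Q n)) + Q n) + (Q n ^ 2 - P) := by ring
    rw [e]
    exact dvd_add (dvd_mul_of_dvd_left (happ n) _) (hQ n)
  · rw [← coeff_zero_eq_constantCoeff_apply, coeff_mk, coeff_zero_eq_constantCoeff_apply, hQ0]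

/-- The derivation `y * d/dX` on power series. -/
noncomputable def scaledDeriv (y φ : F⟦X⟧) : F⟦X⟧ := y * d⁄dX F φ

lemma iterate_derivative_eq (y : F⟦X⟧) (hy : IsUnit y) (k : ℕ) :
    ∃ e : ℕ → F⟦X⟧, ∀ φ : F⟦X⟧, (d⁄dX F)^[k] φ =
      ∑ l ∈ Finset.range (k + 1), e l * (scaledDeriv y)^[l] φ := by
  obtain ⟨u, hu⟩ := hy.exists_left_inv
  induction k with
  | zero => exact ⟨fun _ => 1, fun φ => by simp⟩
  | succ k ih =>
    obtain ⟨e, he⟩ := ih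
    refine ⟨fun l => (if l ≤ k then d⁄dX F (e l) else 0) +
      (if l = 0 then 0 else e (l - 1) * u), fun φ => ?_⟩
    have hD : ∀ ψ, d⁄dX F ψ = u * scaledDeriv y ψ := fun ψ => by
      rw [scaledDeriv, ← mul_assoc, hu, one_mul]
    rw [Function.iterate_succ_apply', he, map_sum]
    simp only [Derivation.leibniz, smul_eq_mul, add_mul, Finset.sum_add_distrib]
    rw [add_comm]
    congr 1
    · rw [Finset.sum_range_succ _ (k + 1), if_neg (by omega), zero_mul, add_zero]
      refine Finset.sum_congr rfl fun l hl => ?_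
      rw [Finset.mem_range] at hl
      rw [if_pos (by omega)]
      ring
    · rw [Finset.sum_range_succ' _ (k + 1)]
      simp only [if_true, zero_mul, add_zero]
      refine Finset.sum_congr rfl fun l _ => ?_
      rw [if_neg (by omega), Nat.add_sub_cancel, hD, Function.iterate_succ_apply']
      ring

lemma taylor_dvd {n : ℕ} (hn : ∀ k : ℕ, k < n → ((k.factorial : ℕ) : F) ≠ 0) (φ : F⟦X⟧) :
    X ^ n ∣ C (constantCoeff φ) - ∑ k ∈ Finset.range n,
      (C ((-1) ^ k / (k.factorial : F)) * X ^ k) * (d⁄dX F)^[k] φ := by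
  rw [X_pow_dvd_iff]
  intro j hj
  rw [map_sub, map_sum]
  have h1 : ∀ k ∈ Finset.range n, coeff j
      ((C ((-1) ^ k / (k.factorial : F)) * X ^ k) * (d⁄dX F)^[k] φ) =
      (-1) ^ k * (j.choose k : F) * coeff j φ := by
    intro k hk
    rw [Finset.mem_range] at hk
    rw [mul_assoc, coeff_C_mul, coeff_X_pow_mul']
    split_ifs with hkj
    · rw [coeff_iterate_derivative, Nat.sub_add_cancel hkj]
      have : ((j - k + 1).ascFactorial k : F) = k.factorial * j.choose k := by
        rw [← Nat.add_descFactorial_eq_ascFactorial, Nat.sub_add_cancel hkj,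
          Nat.descFactorial_eq_factorial_mul_choose]
        push_cast
        ring
      have h2 := hn k hk
      rw [this]
      field_simp
    · rw [Nat.choose_eq_zero_of_lt (by omega)]
      simp
  rw [Finset.sum_congr rfl h1, ← Finset.sum_mul]
  have h2 : ∑ k ∈ Finset.range n, (-1 : F) ^ k * (j.choose k : F) = if j = 0 then 1 else 0 := by
    have h3 := congrArg (Int.cast : ℤ → F) (Int.alternating_sum_range_choose (n := j))
    push_cast at h3
    rw [← h3]
    symm
    refine Finset.sum_subset (Finset.range_subset_range.2 (by omega)) fun k _ hk => ?_
    rw [Finset.mem_range, not_lt] at hk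
    rw [Nat.choose_eq_zero_of_lt (by omega)]
    simp
  rw [h2, coeff_C]
  split_ifs with h
  · subst h; simp
  · simp

lemma exists_constant_combination {n : ℕ} (hn : ∀ k : ℕ, k < n → ((k.factorial : ℕ) : F) ≠ 0)
    (y : F⟦X⟧) (hy : IsUnit y) :
    ∃ e : ℕ → F⟦X⟧, ∀ φ : F⟦X⟧, X ^ n ∣ C (constantCoeff φ) -
      ∑ l ∈ Finset.range n, e l * (scaledDeriv y)^[l] φ := by
  choose e he using iterate_derivative_eq y hy
  refine ⟨fun l => ∑ k ∈ Finset.range n, if l < k + 1 then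
    (C ((-1) ^ k / (k.factorial : F)) * X ^ k) * e k l else 0, fun φ => ?_⟩
  have h := taylor_dvd hn φ
  convert h using 2
  simp only [he, Finset.mul_sum, Finset.sum_mul]
  rw [Finset.sum_comm]
  refine Finset.sum_congr rfl fun k hk => ?_
  rw [Finset.mem_range] at hk
  rw [← Finset.sum_subset (Finset.range_subset_range.2 (show k + 1 ≤ n by omega))]
  · refine Finset.sum_congr rfl fun l hl => ?_
    rw [if_pos (Finset.mem_range.1 hl), mul_assoc]
  · intro l _ hl
    rw [if_neg (by simpa using hl), zero_mul]

/-- The matrix with first row the `q`-th powers of `φ`, the other rows being `T k φ`. -/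
def frobMatrix {R : Type*} [CommRing R] (q n : ℕ) (T : ℕ → R → R) (φ : Fin (n + 1) → R) :
    Matrix (Fin (n + 1)) (Fin (n + 1)) R :=
  Matrix.of (Fin.cons (fun j => φ j ^ q) fun k j => T k (φ j))

theorem X_pow_dvd_det [Fintype F] {n : ℕ}
    (hn : ∀ k : ℕ, k < n → ((k.factorial : ℕ) : F) ≠ 0) (hq : n ≤ Fintype.card F)
    (y : F⟦X⟧) (hy : IsUnit y) (φ : Fin (n + 1) → F⟦X⟧) :
    X ^ n ∣ (frobMatrix (Fintype.card F) n (fun k => (scaledDeriv y)^[k]) φ).det := by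
  obtain ⟨e, he⟩ := exists_constant_combination hn y hy
  set M := frobMatrix (Fintype.card F) n (fun k => (scaledDeriv y)^[k]) φ with hM
  have hfrob : ∀ f : F⟦X⟧, X ^ n ∣ f ^ Fintype.card F - C (constantCoeff f) := by
    intro f
    obtain ⟨p, hp⟩ := CharP.exists F
    have : Fact p.Prime := ⟨CharP.char_is_prime F p⟩
    obtain ⟨r, _, hr⟩ := FiniteField.card F p
    have : CharP F⟦X⟧ p := charP_of_injective_algebraMap
      (algebraMap F F⟦X⟧).injective p
    have h1 : f ^ Fintype.card F - C (constantCoeff f) =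
        (f - C (constantCoeff f)) ^ Fintype.card F := by
      have hc : C (constantCoeff f) = C (constantCoeff f) ^ Fintype.card F := by
        rw [← map_pow, FiniteField.pow_card]
      conv_lhs => rw [hc]
      rw [hr, sub_pow_char_pow]
    rw [h1]
    refine (pow_dvd_pow _ hq).trans (pow_dvd_pow_of_dvd ?_ _)
    rw [X_dvd_iff]
    simp
  let v : Fin (n + 1) → F⟦X⟧ := Fin.cons 1 fun k => -e k
  have hv : ∀ j, X ^ n ∣ Matrix.vecMul v M j := by
    intro j
    have : Matrix.vecMul v M j = (φ j ^ Fintype.card F - C (constantCoeff (φ j))) +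
        (C (constantCoeff (φ j)) -
        ∑ l ∈ Finset.range n, e l * (scaledDeriv y)^[l] (φ j)) := by
      rw [Matrix.vecMul, dotProduct, Fin.sum_univ_succ, ← Fin.sum_univ_eq_sum_range
        (fun l => e l * (scaledDeriv y)^[l] (φ j))]
      simp [v, hM, frobMatrix, Finset.sum_neg_distrib]
      ring
    rw [this]
    exact dvd_add (hfrob _) (he _)
  have h2 : Matrix.vecMul (Matrix.vecMul v M) M.adjugate 0 = M.det := by
    rw [Matrix.vecMul_vecMul, Matrix.mul_adjugate, Matrix.vecMul_smul, Matrix.vecMul_one]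
    simp [v]
  rw [← h2, Matrix.vecMul, dotProduct]
  exact Finset.dvd_sum fun j _ => dvd_mul_of_dvd_left (hv j) _

end CurveBound

namespace CurveBound

open PowerSeries

variable {F : Type*} [Field F]

/-- The iterates at infinity of the derivation `y * d/dt` acting on `s ^ (-m) * φ`, `t = 1 / s`,
rescaled to have power series values. -/
noncomputable def infIter (w : F⟦X⟧) (γ m : ℕ) : ℕ → F⟦X⟧ → F⟦X⟧
  | 0, φ => φ
  | k + 1, φ => w * (C ((m + k * γ : ℕ) : F) * infIter w γ m k φ -
      X * d⁄dX F (infIter w γ m k φ))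

lemma infIter_X_pow_mul (w : F⟦X⟧) (γ m e k : ℕ) (η : F⟦X⟧) :
    ∃ ψ : F⟦X⟧, infIter w γ m k (X ^ e * η) = X ^ e * ψ ∧ constantCoeff ψ =
      constantCoeff w ^ k * (∏ l ∈ Finset.range k, ((m : F) - e + l * γ)) * constantCoeff η := by
  induction k with
  | zero => exact ⟨η, rfl, by simp⟩
  | succ k ih =>
    obtain ⟨ψ, h1, h2⟩ := ih
    refine ⟨w * (C ((m + k * γ : ℕ) : F) * ψ - C (e : F) * ψ - X * d⁄dX F ψ), ?_, ?_⟩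
    · rw [infIter, h1, Derivation.leibniz, derivative_pow, derivative_X]
      simp only [smul_eq_mul, map_natCast]
      rcases e with _ | e
      · simp
      · rw [Nat.add_sub_cancel]
        push_cast
        ring
    · rw [map_mul, map_sub, map_sub, map_mul, map_mul, map_mul, constantCoeff_C, constantCoeff_C,
        constantCoeff_X, h2, Finset.prod_range_succ]
      push_cast
      ring

lemma det_prod_ne_zero (γ n : ℕ) (x : Fin n → F) (hx : Function.Injective x) :
    (Matrix.of fun i j : Fin n => ∏ l ∈ Finset.range (j : ℕ), (x i + l * γ)).det ≠ 0 := by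
  have h := Matrix.det_eval_matrixOfPolynomials_eq_det_vandermonde x
    (fun j : Fin n => ∏ l ∈ Finset.range (j : ℕ),
      (Polynomial.X + Polynomial.C ((l : F) * γ)))
    (fun j => by
      rw [Polynomial.natDegree_prod_of_monic _ _ fun l _ => Polynomial.monic_X_add_C _,
        Finset.sum_congr rfl fun l _ => Polynomial.natDegree_X_add_C _]
      simp)
    (fun j => Polynomial.monic_prod_of_monic _ _ fun l _ => Polynomial.monic_X_add_C _)
  simp only [Polynomial.eval_prod, Polynomial.eval_add, Polynomial.eval_X,
    Polynomial.eval_C] at h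
  rw [← h]
  exact Matrix.det_vandermonde_ne_zero_iff.2 hx

theorem det_frobMatrix_infIter {p : ℕ} [CharP F p] {n q : ℕ} (hq : 2 ≤ q) (w : F⟦X⟧)
    (hw : constantCoeff w ≠ 0) (γ m : ℕ) (ε : Fin (n + 1) → ℕ) (hε : StrictMono ε)
    (hεp : ∀ j, ε j < p) (φ η : Fin (n + 1) → F⟦X⟧) (hφ : ∀ j, φ j = X ^ ε j * η j)
    (hη : ∀ j, constantCoeff (η j) ≠ 0) :
    ∃ V : F⟦X⟧, constantCoeff V ≠ 0 ∧ (frobMatrix q n (infIter w γ m) φ).det =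
      X ^ (∑ j, ε j + (q - 1) * ε 0) * V := by
  choose ψ hψ1 hψ2 using fun (k : ℕ) (j : Fin (n + 1)) =>
    infIter_X_pow_mul w γ m (ε j) k (η j)
  have hmin : ∀ j, ε 0 ≤ ε j := fun j => hε.monotone (Fin.zero_le j)
  let M : Matrix (Fin (n + 1)) (Fin (n + 1)) F⟦X⟧ := Matrix.of
    (Fin.cons (fun j => X ^ ((q - 1) * (ε j - ε 0)) * η j ^ q) fun k j => ψ k j)
  let r : Fin (n + 1) → F⟦X⟧ := Fin.cons (X ^ ((q - 1) * ε 0)) fun _ => 1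
  have hM : frobMatrix q n (infIter w γ m) φ = Matrix.of fun i j => X ^ ε j *
      (Matrix.of (fun i j => r i * M i j) i j) := by
    ext i j : 2
    refine Fin.cases ?_ (fun k => ?_) i
    · simp only [frobMatrix, M, r, Matrix.of_apply, Fin.cons_zero, hφ]
      obtain ⟨d, hd⟩ := Nat.exists_eq_add_of_le (hmin j)
      obtain ⟨q', rfl⟩ : ∃ q', q = q' + 1 := ⟨q - 1, by omega⟩
      rw [hd, Nat.add_sub_cancel_left, Nat.add_sub_cancel]
      ring_nf
    · simp only [frobMatrix, M, r, Matrix.of_apply, Fin.cons_succ, hφ, hψ1, one_mul]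
  refine ⟨M.det, ?_, ?_⟩
  · rw [RingHom.map_det, Matrix.det_succ_row_zero, Finset.sum_eq_single 0]
    · have h0 : (constantCoeff (R := F)).mapMatrix M 0 0 ≠ 0 := by
        simp only [RingHom.mapMatrix_apply, Matrix.map_apply, M, Matrix.of_apply, Fin.cons_zero,
          Nat.sub_self, mul_zero, pow_zero, one_mul, map_pow]
        exact pow_ne_zero _ (hη 0)
      refine mul_ne_zero (mul_ne_zero (pow_ne_zero _ (by simp)) h0) ?_
      have h1 : ((constantCoeff (R := F)).mapMatrix M).submatrix Fin.succ (Fin.succAbove 0) =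
          Matrix.of fun i j => constantCoeff (η j.succ) * (Matrix.of (fun i j : Fin n =>
            constantCoeff w ^ (i : ℕ) * (Matrix.of (fun i j : Fin n =>
              ∏ l ∈ Finset.range (j : ℕ), (((m : F) - ε i.succ) + l * γ))).transpose i j)
              i j) := by
        ext i j
        simp only [Matrix.submatrix_apply, RingHom.mapMatrix_apply, Matrix.map_apply, M,
          Matrix.of_apply, Fin.cons_succ, Matrix.transpose_apply, Fin.succAbove_zero, hψ2]
        exact mul_comm _ _
      rw [h1, Matrix.det_mul_row, Matrix.det_mul_column, Matrix.det_transpose]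
      refine mul_ne_zero (Finset.prod_ne_zero_iff.2 fun j _ => hη _)
        (mul_ne_zero (Finset.prod_ne_zero_iff.2 fun j _ => pow_ne_zero _ hw)
          (det_prod_ne_zero _ _ _ ?_))
      intro i j hij
      have h2 : ((ε i.succ : ℕ) : F) = ε j.succ := by simpa using hij
      rw [CharP.natCast_eq_natCast F p] at h2
      have h3 := Nat.ModEq.eq_of_lt_of_lt h2 (hεp _) (hεp _)
      exact Fin.succ_injective _ (hε.injective h3)
    · intro j _ hj
      have h0 : (constantCoeff (R := F)).mapMatrix M 0 j = 0 := by
        simp only [RingHom.mapMatrix_apply, Matrix.map_apply, M, Matrix.of_apply, Fin.cons_zero,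
          map_mul, map_pow, constantCoeff_X]
        have h4 : ε 0 < ε j := hε (Fin.pos_of_ne_zero hj)
        rw [zero_pow, zero_mul]
        exact Nat.mul_ne_zero (by omega) (by omega)
      rw [h0]
      ring
    · simp
  · rw [hM, Matrix.det_mul_row, Matrix.det_mul_column, Finset.prod_pow_eq_pow_sum,
      Fin.prod_univ_succ]
    simp only [r, Fin.cons_zero, Fin.cons_succ, Finset.prod_const_one, mul_one]
    ring

end CurveBound

namespace CurveBound

open PowerSeries

variable {F : Type*} [Field F]

lemma exists_echelon {n D : ℕ} (Φ : (Fin (n + 1) → F) →ₗ[F] F⟦X⟧)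
    (hΦ : ∀ x, x ≠ 0 → ∃ i ≤ D, coeff i (Φ x) ≠ 0) :
    ∃ ε : Fin (n + 1) → ℕ, StrictMono ε ∧ (∀ j, ε j ≤ D) ∧
      ∀ j, ∃ x η, Φ x = X ^ ε j * η ∧ constantCoeff η ≠ 0 := by
  classical
  let O : Finset ℕ := (Finset.range (D + 1)).filter fun e =>
    ∃ x η, Φ x = X ^ e * η ∧ constantCoeff η ≠ 0
  let L : (Fin (n + 1) → F) →ₗ[F] (O → F) := LinearMap.pi fun e => (coeff (e : ℕ)).comp Φ
  have hL : Function.Injective L := by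
    rw [injective_iff_map_eq_zero]
    intro x hx
    by_contra hne
    obtain ⟨i, hi, hc⟩ := hΦ x hne
    have hne' : Φ x ≠ 0 := fun h => hc (by rw [h, map_zero])
    have hord : (Φ x).order.toNat ≤ i := by
      have := order_le i hc
      rw [← coe_toNat_order hne'] at this
      exact_mod_cast this
    have h0 := coeff_order hne'
    obtain ⟨η, hη⟩ := X_pow_order_dvd (φ := Φ x)
    have hmem : (Φ x).order.toNat ∈ O := by
      refine Finset.mem_filter.2 ⟨Finset.mem_range.2 (by omega), x, η, hη, ?_⟩
      have h1 : coeff (0 + (Φ x).order.toNat) (Φ x) ≠ 0 := by rwa [zero_add]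
      rw [congrArg (coeff _) hη, coeff_X_pow_mul] at h1
      simpa using h1
    exact h0 (congrFun hx ⟨_, hmem⟩)
  have hcard : n + 1 ≤ O.card := by
    have := LinearMap.finrank_le_finrank_of_injective hL
    simpa using this
  refine ⟨O.orderEmbOfCardLe hcard, (O.orderEmbOfCardLe hcard).strictMono, fun j => ?_,
    fun j => ?_⟩
  · have := (Finset.mem_filter.1 (O.orderEmbOfCardLe_mem hcard j)).1
    rw [Finset.mem_range] at this
    omega
  · exact (Finset.mem_filter.1 (O.orderEmbOfCardLe_mem hcard j)).2

lemma infIter_sum (w : F⟦X⟧) (γ m k : ℕ) {ι : Type*} (s : Finset ι) (x : ι → F)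
    (φ : ι → F⟦X⟧) : infIter w γ m k (∑ i ∈ s, C (x i) * φ i) =
      ∑ i ∈ s, C (x i) * infIter w γ m k (φ i) := by
  induction k with
  | zero => rfl
  | succ k ih =>
    simp only [infIter, ih, map_sum, Derivation.leibniz, derivative_C,
      smul_eq_mul, mul_zero, add_zero, Finset.mul_sum, ← Finset.sum_sub_distrib]
    exact Finset.sum_congr rfl fun i _ => by ring

lemma sum_pow_card [Fintype F] {ι : Type*} (s : Finset ι) (x : ι → F) (φ : ι → F⟦X⟧) :
    (∑ i ∈ s, C (x i) * φ i) ^ Fintype.card F = ∑ i ∈ s, C (x i) * φ i ^ Fintype.card F := by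
  obtain ⟨p, hp⟩ := CharP.exists F
  have : Fact p.Prime := ⟨CharP.char_is_prime F p⟩
  obtain ⟨r, _, hr⟩ := FiniteField.card F p
  have : CharP F⟦X⟧ p := charP_of_injective_algebraMap (algebraMap F F⟦X⟧).injective p
  rw [hr, sum_pow_char_pow, ← hr]
  exact Finset.sum_congr rfl fun i _ => by rw [mul_pow, ← map_pow, FiniteField.pow_card]

theorem det_frobMatrix_of_bound [Fintype F] {p : ℕ} [CharP F p] {n D : ℕ} (w : F⟦X⟧)
    (hw : constantCoeff w ≠ 0) (γ m : ℕ) (hD : D < p) (φ : Fin (n + 1) → F⟦X⟧)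
    (hφ : ∀ x : Fin (n + 1) → F, x ≠ 0 → ∃ i ≤ D, coeff i (∑ j, C (x j) * φ j) ≠ 0) :
    ∃ (V : F⟦X⟧) (o : ℕ), constantCoeff V ≠ 0 ∧ n * (n + 1) ≤ 2 * o ∧
      (frobMatrix (Fintype.card F) n (infIter w γ m) φ).det = X ^ o * V := by
  let Φ : (Fin (n + 1) → F) →ₗ[F] F⟦X⟧ :=
    { toFun := fun x => ∑ j, C (x j) * φ j
      map_add' := fun x y => by simp [add_mul, Finset.sum_add_distrib]
      map_smul' := fun r x => by
        simp [Finset.mul_sum, mul_assoc, smul_eq_C_mul] }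
  obtain ⟨ε, hε, hεD, hx⟩ := exists_echelon Φ hφ
  choose x η hη hη0 using hx
  have hψ : ∀ j, Φ (x j) = ∑ i, C (x j i) * φ i := fun j => rfl
  obtain ⟨V, hV, hdet⟩ := det_frobMatrix_infIter (p := p) (q := Fintype.card F)
    Fintype.one_lt_card w hw γ m ε hε (fun j => (hεD j).trans_lt hD) (fun j => Φ (x j)) η hη hη0
  have hmul : frobMatrix (Fintype.card F) n (infIter w γ m) (fun j => Φ (x j)) =
      frobMatrix (Fintype.card F) n (infIter w γ m) φ *
        (C (R := F)).mapMatrix (Matrix.of fun i j => x j i) := by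
    refine Matrix.ext fun i j => ?_
    rw [Matrix.mul_apply]
    refine Fin.cases ?_ (fun k => ?_) i
    · simp only [frobMatrix, Matrix.of_apply, Fin.cons_zero, hψ, sum_pow_card,
        RingHom.mapMatrix_apply, Matrix.map_apply]
      exact Finset.sum_congr rfl fun i _ => mul_comm _ _
    · simp only [frobMatrix, Matrix.of_apply, Fin.cons_succ, hψ, infIter_sum,
        RingHom.mapMatrix_apply, Matrix.map_apply]
      exact Finset.sum_congr rfl fun i _ => mul_comm _ _
  rw [hmul, Matrix.det_mul, ← RingHom.map_det] at hdet
  set δ := (Matrix.of fun i j => x j i).det with hδ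
  have hδ0 : δ ≠ 0 := by
    intro h
    rw [h, map_zero, mul_zero] at hdet
    have : V = 0 := by
      rcases mul_eq_zero.1 hdet.symm with h | h
      · exact absurd h (pow_ne_zero _ X_ne_zero)
      · exact h
    exact hV (by rw [this, map_zero])
  refine ⟨V * C δ⁻¹, ∑ j, ε j + (Fintype.card F - 1) * ε 0, ?_, ?_, ?_⟩
  · rw [map_mul, constantCoeff_C]
    exact mul_ne_zero hV (inv_ne_zero hδ0)
  · have h1 : ∀ j : Fin (n + 1), (j : ℕ) ≤ ε j := fun j => by
      induction j using Fin.induction with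
      | zero => exact Nat.zero_le _
      | succ j ih =>
        have := hε (Fin.castSucc_lt_succ (i := j))
        simp only [Fin.val_castSucc, Fin.val_succ] at ih ⊢
        omega
    have h2 : ∑ j : Fin (n + 1), (j : ℕ) ≤ ∑ j, ε j := Finset.sum_le_sum fun j _ => h1 j
    rw [Fin.sum_univ_eq_sum_range (fun j => j)] at h2
    have h3 := Finset.sum_range_id_mul_two (n + 1)
    rw [Nat.add_sub_cancel] at h3
    nlinarith [Nat.zero_le ((Fintype.card F - 1) * ε 0)]
  · rw [← mul_assoc, ← hdet, mul_assoc, ← map_mul, mul_inv_cancel₀ hδ0, map_one, mul_one]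

end CurveBound

namespace CurveBound

open Polynomial

variable {F : Type*} [Field F]

/-- The reflected polynomial `s ^ N * P (1 / s)`, as a power series in `s`. -/
noncomputable def revSeries (N : ℕ) (P : F[X]) : PowerSeries F := (reflect N P : F[X])

lemma revSeries_add (N : ℕ) (P Q : F[X]) :
    revSeries N (P + Q) = revSeries N P + revSeries N Q := by
  rw [revSeries, reflect_add, Polynomial.coe_add]; rfl

lemma revSeries_C_mul (N : ℕ) (x : F) (P : F[X]) :
    revSeries N (C x * P) = PowerSeries.C x * revSeries N P := by
  rw [revSeries, reflect_C_mul, Polynomial.coe_mul, Polynomial.coe_C]; rfl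

lemma revSeries_mul {N M : ℕ} {P Q : F[X]} (hP : P.natDegree ≤ N) (hQ : Q.natDegree ≤ M) :
    revSeries (N + M) (P * Q) = revSeries N P * revSeries M Q := by
  rw [revSeries, reflect_mul _ _ hP hQ, Polynomial.coe_mul]; rfl

lemma revSeries_X_mul {N : ℕ} {P : F[X]} (hP : P.natDegree ≤ N) :
    revSeries (N + 1) (X * P) = revSeries N P := by
  rw [add_comm, revSeries_mul natDegree_X_le hP, revSeries, reflect_one_X]
  simp

lemma coeff_revSeries_of_le (N : ℕ) (P : F[X]) {i : ℕ} (h : i ≤ N) :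
    PowerSeries.coeff i (revSeries N P) = P.coeff (N - i) := by
  rw [revSeries, Polynomial.coeff_coe, coeff_reflect, revAt_le h]

lemma coeff_revSeries_of_lt {N : ℕ} {P : F[X]} (hP : P.natDegree ≤ N) {i : ℕ} (h : N < i) :
    PowerSeries.coeff i (revSeries N P) = 0 := by
  rw [revSeries, Polynomial.coeff_coe, coeff_reflect, revAt_eq_self_of_lt h,
    coeff_eq_zero_of_natDegree_lt (hP.trans_lt h)]

lemma revSeries_X_mul_derivative {N : ℕ} {P : F[X]} (hP : P.natDegree ≤ N) :
    revSeries N (X * derivative P) = PowerSeries.C (N : F) * revSeries N P -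
      PowerSeries.X * PowerSeries.derivative F (revSeries N P) := by
  have hX : ∀ (Q : F[X]) j, (X * derivative Q).coeff j = j * Q.coeff j := by
    intro Q j
    rcases j with _ | j
    · simp
    · rw [coeff_X_mul, coeff_derivative, mul_comm]
      push_cast
      rfl
  have hX' : ∀ (φ : PowerSeries F) j,
      PowerSeries.coeff j (PowerSeries.X * PowerSeries.derivative F φ) =
        j * PowerSeries.coeff j φ := by
    intro Q j
    rcases j with _ | j
    · simp
    · rw [PowerSeries.coeff_succ_X_mul, PowerSeries.coeff_derivative, mul_comm]
      push_cast
      rfl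
  have hdeg : (X * derivative P).natDegree ≤ N := by
    rw [natDegree_le_iff_coeff_eq_zero]
    intro j hj
    rw [hX, coeff_eq_zero_of_natDegree_lt (hP.trans_lt hj), mul_zero]
  ext i
  rw [map_sub, PowerSeries.coeff_C_mul, hX']
  rcases le_or_gt i N with h | h
  · rw [coeff_revSeries_of_le _ _ h, coeff_revSeries_of_le _ _ h, hX, Nat.cast_sub h]
    ring
  · rw [coeff_revSeries_of_lt hdeg h, coeff_revSeries_of_lt hP h]
    ring

lemma natDegree_X_mul_derivative_le {N : ℕ} {P : F[X]} (hP : P.natDegree ≤ N) :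
    (X * derivative P).natDegree ≤ N := by
  rcases Nat.eq_zero_or_pos P.natDegree with h | h
  · rw [eq_C_of_natDegree_eq_zero h]
    simp
  · have := natDegree_derivative_le P
    have h2 := natDegree_mul_le (p := X) (q := derivative P)
    have h3 := natDegree_X_le (R := F)
    omega

/-- The coordinate ring of `y ^ 2 = H`. -/
abbrev CoordRing (H : F[X]) := QuadraticAlgebra F[X] H 0

variable (H : F[X])

/-- The derivation `y * d/dX` of the coordinate ring of `y ^ 2 = H`. -/
noncomputable def theta (z : CoordRing H) : CoordRing H :=
  ⟨H * derivative z.im + C (2⁻¹ : F) * (derivative H * z.im), derivative z.re⟩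

/-- The point `(x, y)` of the curve with values in `A`. -/
noncomputable def evalAt {A : Type*} [CommRing A] (f : F[X] →+* A) (y : A) (hy : y ^ 2 = f H) :
    CoordRing H →+* A where
  toFun z := f z.re + f z.im * y
  map_one' := by
    rw [QuadraticAlgebra.re_one, QuadraticAlgebra.im_one, map_one, map_zero, zero_mul, add_zero]
  map_zero' := by
    rw [QuadraticAlgebra.re_zero, QuadraticAlgebra.im_zero, map_zero, zero_mul, add_zero]
  map_add' u v := by
    rw [QuadraticAlgebra.re_add, QuadraticAlgebra.im_add, map_add, map_add]
    ring
  map_mul' u v := by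
    simp only [QuadraticAlgebra.re_mul, QuadraticAlgebra.im_mul, map_add, map_mul, zero_mul,
      add_zero]
    linear_combination -(f u.im * f v.im) * hy

lemma evalAt_apply {A : Type*} [CommRing A] (f : F[X] →+* A) (y : A) (hy : y ^ 2 = f H)
    (z : CoordRing H) : evalAt H f y hy z = f z.re + f z.im * y := rfl

lemma evalAt_norm {A : Type*} [CommRing A] (f : F[X] →+* A) (y : A) (hy : y ^ 2 = f H)
    (z : CoordRing H) : f z.norm =
      evalAt H f y hy z * evalAt H f (-y) (by rw [neg_sq, hy]) z := by
  rw [evalAt_apply, evalAt_apply, QuadraticAlgebra.norm_def]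
  simp only [map_sub, map_mul, zero_mul, add_zero]
  linear_combination (f z.im * f z.im) * hy

/-- The expansion at the point at infinity given by the square root `w`, for functions with a
pole of order at most `N`. -/
noncomputable def infSeries (w : PowerSeries F) (γ N : ℕ) (z : CoordRing H) : PowerSeries F :=
  revSeries N z.re + w * revSeries (N - (γ + 1)) z.im

/-- Functions with a pole of order at most `N` at both points at infinity. -/
def PoleLE (γ N : ℕ) (z : CoordRing H) : Prop :=
  z.re.natDegree ≤ N ∧ z.im.natDegree + (γ + 1) ≤ N

variable {H} {γ : ℕ}

lemma X_mul_theta_re (z : CoordRing H) : X * (theta H z).re =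
    H * (X * derivative z.im) + C (2⁻¹ : F) * ((X * derivative H) * z.im) := by
  rw [theta]
  ring

lemma PoleLE.theta (hH : H.natDegree ≤ 2 * γ + 2) {N : ℕ} {z : CoordRing H}
    (hz : PoleLE H γ N z) : PoleLE H γ (N + γ) (theta H z) := by
  obtain ⟨h1, h2⟩ := hz
  constructor
  · have h3 : (X * (CurveBound.theta H z).re).natDegree ≤ N + γ + 1 := by
      rw [X_mul_theta_re]
      refine natDegree_add_le_of_degree_le ?_ (natDegree_C_mul_le _ _ |>.trans ?_)
      · have := natDegree_X_mul_derivative_le (le_refl z.im.natDegree)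
        exact natDegree_mul_le.trans (by omega)
      · have := natDegree_X_mul_derivative_le hH
        exact natDegree_mul_le.trans (by omega)
    rcases eq_or_ne (CurveBound.theta H z).re 0 with h0 | h0
    · rw [h0]; simp
    · rw [natDegree_X_mul h0] at h3
      omega
  · have := natDegree_derivative_le z.re
    change (derivative z.re).natDegree + (γ + 1) ≤ N + γ
    omega

lemma infSeries_theta (h2 : (2 : F) ≠ 0) (hH : H.natDegree ≤ 2 * γ + 2) (w : PowerSeries F)
    (hw : w ^ 2 = revSeries (2 * γ + 2) H) {N : ℕ} {z : CoordRing H} (hz : PoleLE H γ N z) :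
    infSeries H w γ (N + γ) (theta H z) = w * (PowerSeries.C (N : F) * infSeries H w γ N z -
      PowerSeries.X * PowerSeries.derivative F (infSeries H w γ N z)) := by
  have hth := PoleLE.theta hH hz
  obtain ⟨hz1, hz2⟩ := hz
  obtain ⟨M, rfl⟩ : ∃ M, N = M + (γ + 1) := ⟨N - (γ + 1), by omega⟩
  have hb : z.im.natDegree ≤ M := by omega
  have e1 : revSeries (M + (γ + 1) + γ) (theta H z).re =
      revSeries (2 * γ + 2) H * (PowerSeries.C (M : F) * revSeries M z.im -
        PowerSeries.X * PowerSeries.derivative F (revSeries M z.im)) +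
      PowerSeries.C (2⁻¹ : F) * ((PowerSeries.C ((2 * γ + 2 : ℕ) : F) *
        revSeries (2 * γ + 2) H -
        PowerSeries.X * PowerSeries.derivative F (revSeries (2 * γ + 2) H)) *
          revSeries M z.im) := by
    rw [← revSeries_X_mul hth.1, X_mul_theta_re, show M + (γ + 1) + γ + 1 = 2 * γ + 2 + M by ring,
      revSeries_add, revSeries_C_mul, revSeries_mul hH (natDegree_X_mul_derivative_le hb),
      revSeries_mul (natDegree_X_mul_derivative_le hH) hb, revSeries_X_mul_derivative hb,
      revSeries_X_mul_derivative hH]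
  have e2 : revSeries (M + (γ + 1) + γ - (γ + 1)) (theta H z).im =
      PowerSeries.C ((M + (γ + 1) : ℕ) : F) * revSeries (M + (γ + 1)) z.re -
        PowerSeries.X * PowerSeries.derivative F (revSeries (M + (γ + 1)) z.re) := by
    have hd : (derivative z.re).natDegree ≤ M + γ := (natDegree_derivative_le _).trans (by omega)
    rw [← revSeries_X_mul_derivative hz1, show M + (γ + 1) + γ - (γ + 1) = M + γ by omega]
    exact (revSeries_X_mul hd).symm
  have e3 : PowerSeries.derivative F (revSeries (2 * γ + 2) H) =
      2 * w * PowerSeries.derivative F w := by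
    rw [← hw, PowerSeries.derivative_pow]
    norm_num
  have e4 : PowerSeries.C (2⁻¹ : F) * 2 = 1 := by
    rw [← map_ofNat (PowerSeries.C (R := F)) 2, ← map_mul, inv_mul_cancel₀ h2, map_one]
  rw [infSeries, infSeries, e1, e2, e3, ← hw, Nat.add_sub_cancel]
  simp only [map_add, Derivation.leibniz, smul_eq_mul, Nat.cast_add, Nat.cast_mul, Nat.cast_one,
    map_mul, map_one, Nat.cast_ofNat, map_ofNat]
  set r := revSeries M z.im
  set D := PowerSeries.derivative F w
  linear_combination ((PowerSeries.C (γ : F) + 1) * w ^ 2 * r - PowerSeries.X * w * D * r) * e4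

lemma poleLE_iterate (hH : H.natDegree ≤ 2 * γ + 2) {m : ℕ} {z : CoordRing H}
    (hz : PoleLE H γ m z) (k : ℕ) : PoleLE H γ (m + k * γ) ((theta H)^[k] z) := by
  induction k with
  | zero => simpa using hz
  | succ k ih =>
    rw [Function.iterate_succ_apply', add_mul, one_mul, ← add_assoc]
    exact PoleLE.theta hH ih

lemma infSeries_iterate (h2 : (2 : F) ≠ 0) (hH : H.natDegree ≤ 2 * γ + 2) (w : PowerSeries F)
    (hw : w ^ 2 = revSeries (2 * γ + 2) H) {m : ℕ} {z : CoordRing H} (hz : PoleLE H γ m z)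
    (k : ℕ) : infSeries H w γ (m + k * γ) ((theta H)^[k] z) =
      infIter w γ m k (infSeries H w γ m z) := by
  induction k with
  | zero => simp [infIter]
  | succ k ih =>
    rw [Function.iterate_succ_apply', add_mul, one_mul, ← add_assoc,
      infSeries_theta h2 hH w hw (poleLE_iterate hH hz k), ih]
    rfl

end CurveBound

namespace CurveBound

open Polynomial

variable {F : Type*} [Field F]

lemma frobMatrix_map {A B : Type*} [CommRing A] [CommRing B] (e : A →+* B) (q n : ℕ)
    (T : ℕ → A → A) (T' : ℕ → B → B) (h : ∀ k z, e (T k z) = T' k (e z)) (f : Fin (n + 1) → A) :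
    e (frobMatrix q n T f).det = (frobMatrix q n T' fun j => e (f j)).det := by
  rw [RingHom.map_det]
  congr 1
  refine Matrix.ext fun i j => ?_
  refine Fin.cases ?_ (fun k => ?_) i
  · simp [frobMatrix]
  · simp [frobMatrix, h]

/-- Taylor expansion at `t`. -/
noncomputable def expandAt (t : F) : F[X] →+* PowerSeries F :=
  (coeToPowerSeries.ringHom (R := F)).comp (compRingHom (X + C t))

lemma expandAt_apply (t : F) (P : F[X]) : expandAt t P = (P.comp (X + C t) : F[X]) := rfl

lemma expandAt_derivative (t : F) (P : F[X]) :
    expandAt t (derivative P) = PowerSeries.derivative F (expandAt t P) := by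
  rw [expandAt_apply, expandAt_apply, PowerSeries.derivative_coe, derivative_comp]
  simp

lemma evalAt_theta (h2 : (2 : F) ≠ 0) (H : F[X]) (t : F) (y : PowerSeries F)
    (hy : y ^ 2 = expandAt t H) (z : CoordRing H) :
    evalAt H (expandAt t) y hy (theta H z) = scaledDeriv y (evalAt H (expandAt t) y hy z) := by
  have e3 : PowerSeries.derivative F (expandAt t H) = 2 * y * PowerSeries.derivative F y := by
    rw [← hy, PowerSeries.derivative_pow]
    norm_num
  have e4 : expandAt t (C (2⁻¹ : F)) * 2 = 1 := by
    rw [← map_ofNat (expandAt t) 2, ← map_mul, ← map_ofNat (C (R := F)) 2, ← map_mul,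
      inv_mul_cancel₀ h2, map_one, map_one]
  rw [evalAt_apply, evalAt_apply, scaledDeriv, theta]
  simp only [map_add, map_mul, expandAt_derivative, e3, Derivation.leibniz, smul_eq_mul]
  linear_combination (y * PowerSeries.derivative F y * expandAt t z.im) * e4 -
    PowerSeries.derivative F (expandAt t z.im) * hy

lemma pow_dvd_norm [Fintype F] (h2 : (2 : F) ≠ 0) {n : ℕ}
    (hn : ∀ k : ℕ, k < n → ((k.factorial : ℕ) : F) ≠ 0) (hq : n ≤ Fintype.card F)
    (H : F[X]) (t y₀ : F) (hy₀ : y₀ ≠ 0) (hy : y₀ ^ 2 = H.eval t)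
    (f : Fin (n + 1) → CoordRing H) :
    (X - C t) ^ (2 * n) ∣
      (frobMatrix (Fintype.card F) n (fun k => (theta H)^[k]) f).det.norm := by
  have hH : y₀ ^ 2 = PowerSeries.constantCoeff (expandAt t H) := by
    rw [expandAt_apply, Polynomial.constantCoeff_coe, hy, coeff_zero_eq_eval_zero, eval_comp]
    simp
  obtain ⟨y, hy1, hy2⟩ := exists_sq_eq_of_constantCoeff h2 _ y₀ hH hy₀
  have hloc : ∀ (u : PowerSeries F) (hu : u ^ 2 = expandAt t H), IsUnit u →
      PowerSeries.X ^ n ∣ evalAt H (expandAt t) u hu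
        (frobMatrix (Fintype.card F) n (fun k => (theta H)^[k]) f).det := by
    intro u hu hunit
    rw [frobMatrix_map _ _ _ _ (fun k => (scaledDeriv u)^[k])]
    · exact X_pow_dvd_det hn hq u hunit _
    · intro k z
      induction k generalizing z with
      | zero => rfl
      | succ k ih => rw [Function.iterate_succ_apply, ih, evalAt_theta h2,
          Function.iterate_succ_apply]
  have hyu : IsUnit y := by
    rw [PowerSeries.isUnit_iff_constantCoeff, hy2]
    exact hy₀.isUnit
  have h3 := mul_dvd_mul (hloc y hy1 hyu) (hloc (-y) (by rw [neg_sq, hy1]) hyu.neg)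
  rw [← evalAt_norm, ← pow_add, ← two_mul, expandAt_apply, PowerSeries.X_pow_dvd_iff] at h3
  obtain ⟨R, hR⟩ := X_pow_dvd_iff.2 fun d hd => by
    have := h3 d hd
    rwa [Polynomial.coeff_coe] at this
  refine ⟨R.comp (X - C t), ?_⟩
  have h4 := congrArg (fun P : F[X] => P.comp (X - C t)) hR
  simp only [comp_assoc, add_comp, X_comp, C_comp, sub_add_cancel, comp_X, mul_comp,
    X_pow_comp] at h4
  exact h4

/-- Expansion at infinity. -/
noncomputable def expandInf : F[X] →+* FractionRing (PowerSeries F) :=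
  eval₂RingHom ((algebraMap (PowerSeries F) (FractionRing (PowerSeries F))).comp
    (PowerSeries.C (R := F))) (algebraMap (PowerSeries F) _ PowerSeries.X)⁻¹

/-- The embedding of power series into Laurent series. -/
noncomputable abbrev toLaurent (F : Type*) [Field F] :
    PowerSeries F →+* FractionRing (PowerSeries F) :=
  algebraMap (PowerSeries F) (FractionRing (PowerSeries F))

lemma algebraMap_X_ne_zero : toLaurent F PowerSeries.X ≠ 0 := by
  rw [Ne, IsFractionRing.to_map_eq_zero_iff]
  exact PowerSeries.X_ne_zero

lemma expandInf_mul {N : ℕ} {P : F[X]} (hP : P.natDegree ≤ N) :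
    expandInf P * toLaurent F PowerSeries.X ^ N = toLaurent F (revSeries N P) := by
  have hx := algebraMap_X_ne_zero (F := F)
  let : Invertible (toLaurent F PowerSeries.X)⁻¹ := invertibleOfNonzero (inv_ne_zero hx)
  have h := eval₂_reflect_mul_pow ((toLaurent F).comp (PowerSeries.C (R := F)))
    (toLaurent F PowerSeries.X)⁻¹ N P hP
  rw [expandInf, coe_eval₂RingHom, ← h, invOf_eq_inv, inv_inv, inv_pow, mul_assoc,
    inv_mul_cancel₀ (pow_ne_zero _ hx), mul_one, revSeries]
  have h2 : eval₂RingHom ((toLaurent F).comp (PowerSeries.C (R := F))) (toLaurent F PowerSeries.X) =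
      (toLaurent F).comp (coeToPowerSeries.ringHom (R := F)) := by
    refine Polynomial.ringHom_ext (fun a => ?_) ?_
    · simp
    · simp
  exact congrArg (fun e : F[X] →+* _ => e (reflect N P)) h2

variable {H : F[X]} {γ : ℕ}

/-- The image of `y` at the point at infinity attached to the square root `w`. -/
noncomputable def infPoint (γ : ℕ) (w : PowerSeries F) : FractionRing (PowerSeries F) :=
  toLaurent F w * (toLaurent F PowerSeries.X ^ (γ + 1))⁻¹

lemma infPoint_sq (hH : H.natDegree ≤ 2 * γ + 2) (w : PowerSeries F)
    (hw : w ^ 2 = revSeries (2 * γ + 2) H) : infPoint γ w ^ 2 = expandInf H := by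
  have hx := algebraMap_X_ne_zero (F := F)
  have h := expandInf_mul hH
  rw [← hw, map_pow] at h
  rw [infPoint, mul_pow, ← h, inv_pow, ← pow_mul, show (γ + 1) * 2 = 2 * γ + 2 by ring,
    mul_assoc, mul_inv_cancel₀ (pow_ne_zero _ hx), mul_one]

lemma evalInf_mul (hH : H.natDegree ≤ 2 * γ + 2) (w : PowerSeries F)
    (hw : w ^ 2 = revSeries (2 * γ + 2) H) {N : ℕ} {z : CoordRing H} (hz : PoleLE H γ N z) :
    evalAt H expandInf (infPoint γ w) (infPoint_sq hH w hw) z * toLaurent F PowerSeries.X ^ N =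
      toLaurent F (infSeries H w γ N z) := by
  have hx := algebraMap_X_ne_zero (F := F)
  obtain ⟨M, rfl⟩ : ∃ M, N = M + (γ + 1) := ⟨N - (γ + 1), by have := hz.2; omega⟩
  rw [evalAt_apply, infSeries, map_add, map_mul, ← expandInf_mul hz.1, Nat.add_sub_cancel,
    ← expandInf_mul (N := M) (by have := hz.2; omega), infPoint, pow_add]
  field_simp
  ring

lemma evalInf_det [Fintype F] (h2 : (2 : F) ≠ 0) (hH : H.natDegree ≤ 2 * γ + 2)
    (w : PowerSeries F)
    (hw : w ^ 2 = revSeries (2 * γ + 2) H) {n m q : ℕ} (f : Fin (n + 1) → CoordRing H)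
    (hf : ∀ j, PoleLE H γ m (f j)) :
    evalAt H expandInf (infPoint γ w) (infPoint_sq hH w hw)
      (frobMatrix q n (fun k => (theta H)^[k]) f).det *
        toLaurent F PowerSeries.X ^ (q * m + ∑ k ∈ Finset.range n, (m + k * γ)) =
      toLaurent F (frobMatrix q n (infIter w γ m) fun j => infSeries H w γ m (f j)).det := by
  rw [RingHom.map_det, RingHom.map_det]
  have h : (toLaurent F).mapMatrix (frobMatrix q n (infIter w γ m) fun j => infSeries H w γ m (f j)) =
      Matrix.of fun i j => (Fin.cons (toLaurent F PowerSeries.X ^ (q * m)) (fun k : Fin n =>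
        toLaurent F PowerSeries.X ^ (m + (k : ℕ) * γ)) : Fin (n + 1) → _) i *
      ((evalAt H expandInf (infPoint γ w) (infPoint_sq hH w hw)).mapMatrix
        (frobMatrix q n (fun k => (theta H)^[k]) f)) i j := by
    refine Matrix.ext fun i j => ?_
    refine Fin.cases ?_ (fun k => ?_) i
    · simp only [frobMatrix, RingHom.mapMatrix_apply, Matrix.map_apply, Matrix.of_apply,
        Fin.cons_zero, map_pow]
      rw [← evalInf_mul hH w hw (hf j), mul_pow, ← pow_mul, mul_comm m, mul_comm]
    · simp only [frobMatrix, RingHom.mapMatrix_apply, Matrix.map_apply, Matrix.of_apply,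
        Fin.cons_succ]
      rw [← infSeries_iterate h2 hH w hw (hf j), ← evalInf_mul hH w hw (poleLE_iterate hH (hf j) _),
        mul_comm]
  rw [h, Matrix.det_mul_column, Fin.prod_univ_succ]
  simp only [Fin.cons_zero, Fin.cons_succ]
  rw [Fin.prod_univ_eq_prod_range (fun k => toLaurent F PowerSeries.X ^ (m + k * γ)),
    Finset.prod_pow_eq_pow_sum, ← pow_add, mul_comm]

end CurveBound

namespace CurveBound

open Polynomial

variable {F : Type*} [Field F] {H : F[X]} {γ : ℕ}

lemma revSeries_sub (N : ℕ) (P Q : F[X]) :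
    revSeries N (P - Q) = revSeries N P - revSeries N Q := by
  rw [revSeries, reflect_sub, Polynomial.coe_sub]; rfl

lemma revSeries_sum {ι : Type*} (N : ℕ) (s : Finset ι) (P : ι → F[X]) :
    revSeries N (∑ j ∈ s, P j) = ∑ j ∈ s, revSeries N (P j) :=
  map_sum (AddMonoidHom.mk' (revSeries (F := F) N) (revSeries_add N)) P s

lemma infSeries_sum {ι : Type*} (w : PowerSeries F) (N : ℕ) (s : Finset ι) (x : ι → F)
    (z : ι → CoordRing H) :
    infSeries H w γ N (⟨∑ j ∈ s, C (x j) * (z j).re, ∑ j ∈ s, C (x j) * (z j).im⟩ : CoordRing H) =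
      ∑ j ∈ s, PowerSeries.C (x j) * infSeries H w γ N (z j) := by
  simp only [infSeries, revSeries_sum, revSeries_C_mul, Finset.mul_sum, mul_add,
    Finset.sum_add_distrib]
  congr 1
  exact Finset.sum_congr rfl fun j _ => by ring

lemma coordRing_norm (z : CoordRing H) : z.norm = z.re * z.re - H * (z.im * z.im) := by
  rw [QuadraticAlgebra.norm_def]
  ring

lemma PoleLE.natDegree_norm_le (hH : H.natDegree ≤ 2 * γ + 2) {m : ℕ} {z : CoordRing H}
    (hz : PoleLE H γ m z) : z.norm.natDegree ≤ 2 * m := by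
  obtain ⟨h1, h3⟩ := hz
  rw [coordRing_norm]
  have h4 : (z.re * z.re).natDegree ≤ 2 * m := natDegree_mul_le.trans (by omega)
  have h5 : (z.im * z.im).natDegree ≤ 2 * z.im.natDegree := natDegree_mul_le.trans (by omega)
  have h6 : (H * (z.im * z.im)).natDegree ≤ 2 * m := natDegree_mul_le.trans (by omega)
  exact (natDegree_sub_le_of_le h4 h6).trans (max_self _).le

lemma infSeries_mul_neg (hH : H.natDegree ≤ 2 * γ + 2) (w : PowerSeries F)
    (hw : w ^ 2 = revSeries (2 * γ + 2) H) {m : ℕ} {z : CoordRing H} (hz : PoleLE H γ m z) :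
    infSeries H w γ m z * infSeries H (-w) γ m z = revSeries (2 * m) z.norm := by
  obtain ⟨h1, h3⟩ := hz
  obtain ⟨M, rfl⟩ : ∃ M, m = M + (γ + 1) := ⟨m - (γ + 1), by omega⟩
  have hb : z.im.natDegree ≤ M := by omega
  have e1 := revSeries_mul h1 h1
  have e2 := revSeries_mul hb hb
  have e3 := revSeries_mul hH (natDegree_mul_le.trans (by omega) : (z.im * z.im).natDegree ≤ M + M)
  rw [show M + (γ + 1) + (M + (γ + 1)) = 2 * (M + (γ + 1)) by ring] at e1
  rw [show 2 * γ + 2 + (M + M) = 2 * (M + (γ + 1)) by ring] at e3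
  rw [coordRing_norm, revSeries_sub, e1, e3, e2, ← hw, infSeries, infSeries, Nat.add_sub_cancel]
  ring

lemma norm_ne_zero (hnsq : ∀ Q, Q ^ 2 ≠ H) {z : CoordRing H} (hz : z ≠ 0) : z.norm ≠ 0 := by
  rw [coordRing_norm]
  intro h
  have h1 : z.re ^ 2 = H * z.im ^ 2 := by linear_combination h
  by_cases hb : z.im = 0
  · rw [hb] at h1
    have : z.re = 0 := by simpa using h1
    exact hz (QuadraticAlgebra.ext this hb)
  · obtain ⟨Q, hQ⟩ := (UniqueFactorizationMonoid.pow_dvd_pow_iff_dvd two_ne_zero).1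
      ⟨H, h1.trans (mul_comm _ _)⟩
    rw [hQ, mul_pow, mul_comm] at h1
    exact hnsq Q (mul_right_cancel₀ (pow_ne_zero 2 hb) h1)

lemma exists_coeff_infSeries_ne_zero (hH : H.natDegree ≤ 2 * γ + 2) (hnsq : ∀ Q, Q ^ 2 ≠ H)
    (w : PowerSeries F) (hw : w ^ 2 = revSeries (2 * γ + 2) H) {m : ℕ} {z : CoordRing H}
    (hz : PoleLE H γ m z) (h0 : z ≠ 0) :
    ∃ i ≤ 2 * m, PowerSeries.coeff i (infSeries H w γ m z) ≠ 0 := by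
  by_contra! hcon
  have h1 : PowerSeries.X ^ (2 * m + 1) ∣ infSeries H w γ m z :=
    PowerSeries.X_pow_dvd_iff.2 fun i hi => hcon i (by omega)
  have h2 := (h1.mul_right (infSeries H (-w) γ m z))
  rw [infSeries_mul_neg hH w hw hz, PowerSeries.X_pow_dvd_iff] at h2
  refine norm_ne_zero hnsq h0 (Polynomial.ext fun i => ?_)
  rw [coeff_zero]
  by_cases hi : i ≤ 2 * m
  · have := h2 (2 * m - i) (by omega)
    rwa [coeff_revSeries_of_le _ _ (by omega), Nat.sub_sub_self hi] at this
  · exact coeff_eq_zero_of_natDegree_lt ((hz.natDegree_norm_le hH).trans_lt (by omega))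

lemma natDegree_add_le_of_expandInf {P : F[X]} {N o : ℕ} {V : PowerSeries F}
    (hV : PowerSeries.constantCoeff V ≠ 0)
    (h : expandInf P * toLaurent F PowerSeries.X ^ N = toLaurent F (PowerSeries.X ^ o * V)) :
    P ≠ 0 ∧ P.natDegree + o ≤ N := by
  have h1 := expandInf_mul (le_refl P.natDegree)
  have h2 : revSeries P.natDegree P * PowerSeries.X ^ N =
      PowerSeries.X ^ (P.natDegree + o) * V := by
    refine IsFractionRing.injective (PowerSeries F) (FractionRing (PowerSeries F)) ?_
    rw [map_mul, map_pow, pow_add, mul_assoc, map_mul, ← h, map_pow, ← h1]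
    ring
  have hP : P ≠ 0 := by
    rintro rfl
    have h0 : revSeries (F := F) 0 0 = 0 := by
      rw [revSeries, reflect_zero]; simp
    rw [natDegree_zero, h0, zero_mul, eq_comm, mul_eq_zero] at h2
    rcases h2 with h2 | h2
    · exact pow_ne_zero _ PowerSeries.X_ne_zero h2
    · exact hV (by rw [h2, map_zero])
  refine ⟨hP, ?_⟩
  by_contra! hlt
  obtain ⟨k, hk⟩ := Nat.exists_eq_add_of_lt hlt
  rw [hk, add_assoc, pow_add, mul_comm, mul_assoc] at h2
  have h3 := mul_left_cancel₀ (pow_ne_zero N PowerSeries.X_ne_zero) h2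
  have h4 := congrArg (PowerSeries.coeff 0) h3
  rw [coeff_revSeries_of_le _ _ (Nat.zero_le _)] at h4
  simp [pow_succ] at h4
  exact hP h4

lemma exists_poleLE_family (H : F[X]) {γ m n : ℕ} (hn : n + γ = 2 * m) (hm : γ + 1 ≤ m) :
    ∃ f : Fin (n + 1) → CoordRing H, (∀ j, PoleLE H γ m (f j)) ∧
      ∀ x : Fin (n + 1) → F, x ≠ 0 →
        PoleLE H γ m
          (⟨∑ j, C (x j) * (f j).re, ∑ j, C (x j) * (f j).im⟩ : CoordRing H) ∧
        (⟨∑ j, C (x j) * (f j).re, ∑ j, C (x j) * (f j).im⟩ : CoordRing H) ≠ 0 := by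
  have hfin : Module.finrank F (degreeLT F (m + 1) × degreeLT F (m - γ)) = n + 1 := by
    rw [Module.finrank_prod, (degreeLTEquiv F _).finrank_eq, (degreeLTEquiv F _).finrank_eq,
      Module.finrank_fin_fun, Module.finrank_fin_fun]
    omega
  have h1 := Module.Finite.equiv (degreeLTEquiv F (m + 1)).symm
  have h2 := Module.Finite.equiv (degreeLTEquiv F (m - γ)).symm
  let B := Module.finBasisOfFinrankEq F (degreeLT F (m + 1) × degreeLT F (m - γ)) hfin
  have hpole : ∀ v : degreeLT F (m + 1) × degreeLT F (m - γ),
      PoleLE H γ m (⟨v.1.1, v.2.1⟩ : CoordRing H) := by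
    intro v
    have hlt : ∀ {k : ℕ}, 0 < k → ∀ P : degreeLT F k, P.1.natDegree < k := by
      intro k hk P
      by_cases h0 : P.1 = 0
      · rwa [h0, natDegree_zero]
      · exact (natDegree_lt_iff_degree_lt h0).2 (mem_degreeLT.1 P.2)
    have e1 := hlt m.succ_pos v.1
    have e2 := hlt (by omega) v.2
    exact ⟨Nat.lt_succ_iff.1 e1, show v.2.1.natDegree + (γ + 1) ≤ m by omega⟩
  have hsum : ∀ x : Fin (n + 1) → F,
      (⟨∑ j, C (x j) * (B j).1.1, ∑ j, C (x j) * (B j).2.1⟩ : CoordRing H) =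
        ⟨(∑ j, x j • B j).1.1, (∑ j, x j • B j).2.1⟩ := by
    intro x
    simp [Prod.fst_sum, Prod.snd_sum, smul_eq_C_mul]
  refine ⟨fun j => ⟨(B j).1.1, (B j).2.1⟩, fun j => hpole _, fun x hx => ?_⟩
  simp only [hsum]
  refine ⟨hpole _, fun h0 => hx ?_⟩
  have h3 : ∑ j, x j • B j = 0 :=
    Prod.ext (Subtype.ext (congrArg QuadraticAlgebra.re h0))
      (Subtype.ext (congrArg QuadraticAlgebra.im h0))
  exact funext fun j => Fintype.linearIndependent_iff.1 B.linearIndependent x h3 j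

theorem card_bound [Fintype F] {p : ℕ} [CharP F p] (h2 : (2 : F) ≠ 0) {m n : ℕ}
    (hn : n + γ = 2 * m) (hm : γ + 1 ≤ m) (hp : 2 * m < p) (hmon : H.Monic)
    (hdeg : H.natDegree = 2 * γ + 2) (hnsq : ∀ Q, Q ^ 2 ≠ H) (S : Finset F)
    (hS : ∀ t ∈ S, ∃ y ≠ 0, y ^ 2 = H.eval t) :
    2 * n * S.card + n * (n + 1) ≤
      2 * (Fintype.card F * m + n * m) + γ * (n * (n - 1)) := by
  have hH := hdeg.le
  have hprime : p.Prime := (CharP.char_is_prime_or_zero F p).resolve_right (by omega)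
  have hpq : p ≤ Fintype.card F := by
    obtain ⟨k, -, hk⟩ := FiniteField.card F p
    rw [hk]
    exact Nat.le_self_pow k.ne_zero p
  have hfac : ∀ k : ℕ, k < n → ((k.factorial : ℕ) : F) ≠ 0 := by
    intro k hk
    rw [Ne, CharP.cast_eq_zero_iff F p, hprime.dvd_factorial]
    omega
  obtain ⟨w, hw, hw1⟩ := exists_sq_eq_of_constantCoeff h2 (revSeries (2 * γ + 2) H) 1 (by
    rw [← PowerSeries.coeff_zero_eq_constantCoeff_apply, coeff_revSeries_of_le _ _ (Nat.zero_le _),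
      Nat.sub_zero, ← hdeg, one_pow]
    exact hmon.symm) one_ne_zero
  have hw' : (-w) ^ 2 = revSeries (2 * γ + 2) H := by rw [neg_sq, hw]
  obtain ⟨f, hf, hfx⟩ := exists_poleLE_family H hn hm
  have hinf : ∀ u : PowerSeries F, u ^ 2 = revSeries (2 * γ + 2) H →
      PowerSeries.constantCoeff u ≠ 0 →
      ∃ (V : PowerSeries F) (o : ℕ), PowerSeries.constantCoeff V ≠ 0 ∧ n * (n + 1) ≤ 2 * o ∧
      (frobMatrix (Fintype.card F) n (infIter u γ m) fun j => infSeries H u γ m (f j)).det =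
        PowerSeries.X ^ o * V := by
    intro u hu hu0
    refine det_frobMatrix_of_bound u hu0 γ m hp _ fun x hx => ?_
    rw [← infSeries_sum]
    exact exists_coeff_infSeries_ne_zero hH hnsq u hu (hfx x hx).1 (hfx x hx).2
  obtain ⟨V₁, o₁, hV₁, ho₁, e₁⟩ := hinf w hw (by rw [hw1]; exact one_ne_zero)
  obtain ⟨V₂, o₂, hV₂, ho₂, e₂⟩ := hinf (-w) hw' (by rw [map_neg, hw1]; simp)
  have d₁ := evalInf_det (q := Fintype.card F) (n := n) h2 hH w hw f hf
  have d₂ := evalInf_det (q := Fintype.card F) (n := n) h2 hH (-w) hw' f hf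
  set W := (frobMatrix (Fintype.card F) n (fun k => (theta H)^[k]) f).det with hW
  set s := Fintype.card F * m + ∑ k ∈ Finset.range n, (m + k * γ) with hs
  have hnorm : expandInf W.norm * toLaurent F PowerSeries.X ^ (s + s) =
      toLaurent F (PowerSeries.X ^ (o₁ + o₂) * (V₁ * V₂)) := by
    have : PowerSeries.X ^ (o₁ + o₂) * (V₁ * V₂) =
        (PowerSeries.X ^ o₁ * V₁) * (PowerSeries.X ^ o₂ * V₂) := by ring
    rw [this, map_mul, ← e₁, ← e₂, ← d₁, ← d₂, evalAt_norm H expandInf _ (infPoint_sq hH w hw)]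
    simp only [evalAt_apply, infPoint, map_neg]
    ring
  obtain ⟨hW0, hWd⟩ := natDegree_add_le_of_expandInf (by
    rw [map_mul]; exact mul_ne_zero hV₁ hV₂) hnorm
  have hdvd : ∏ t ∈ S, (X - C t) ^ (2 * n) ∣ W.norm := by
    refine Finset.prod_dvd_of_coprime (fun t _ u _ htu => ?_) fun t ht => ?_
    · exact (isCoprime_X_sub_C_of_isUnit_sub (sub_ne_zero.2 htu).isUnit).pow
    · obtain ⟨y, hy0, hy⟩ := hS t ht
      exact pow_dvd_norm h2 hfac (by omega) H t y hy0 hy f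
  have hd := natDegree_le_of_dvd hdvd hW0
  rw [natDegree_prod _ _ fun t _ => pow_ne_zero _ (X_sub_C_ne_zero t)] at hd
  simp only [natDegree_pow, natDegree_X_sub_C, mul_one, Finset.sum_const, smul_eq_mul] at hd
  have hsum : 2 * ∑ k ∈ Finset.range n, (m + k * γ) = 2 * (n * m) + γ * (n * (n - 1)) := by
    rw [Finset.sum_add_distrib, ← Finset.sum_mul, mul_add, ← mul_assoc 2 (∑ k ∈ _, k),
      mul_comm 2 (∑ k ∈ _, k), Finset.sum_range_id_mul_two, Finset.sum_const, Finset.card_range,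
      smul_eq_mul, mul_comm γ]
  have h8 : S.card * (2 * n) = 2 * n * S.card := mul_comm _ _
  have h9 : 2 * (Fintype.card F * m + n * m) = 2 * (Fintype.card F * m) + 2 * (n * m) := mul_add _ _ _
  omega

end CurveBound

namespace CurveBound

open Polynomial

variable {F : Type*} [Field F]

lemma ne_sq_of_separable {H : F[X]} (h : H.Separable) (hd : 0 < H.natDegree) (Q : F[X]) :
    Q ^ 2 ≠ H := by
  rintro rfl
  have hu := h.squarefree Q (by rw [sq])
  rw [natDegree_pow, natDegree_eq_zero_of_isUnit hu] at hd
  omega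

/-- A curve `y² = u (xⁿ - A) (xⁿ - B)` of genus `g` has a point over every large finite field. -/
theorem exists_value_not_nonzero_sq [Fintype F] {p g : ℕ} [CharP F p] (hg : Odd g)
    (hp : 4 * g ^ 2 < p) {A B : F} (hA : A ≠ 0) (hB : B ≠ 0) (hAB : A ≠ B) :
    ∃ t : F, ∀ y ≠ 0, y ^ 2 ≠ (t ^ (g + 1) - A) * (t ^ (g + 1) - B) := by
  by_contra! hcon
  have hg1 := hg.pos
  have hprime : p.Prime := (CharP.char_is_prime_or_zero F p).resolve_right (by omega)
  have hgp : 3 * g + 1 < p := by nlinarith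
  have hcast : ∀ k : ℕ, 0 < k → k < p → (k : F) ≠ 0 := fun k h0 hk h => by
    rw [CharP.cast_eq_zero_iff F p] at h
    exact absurd (Nat.le_of_dvd h0 h) (by omega)
  obtain ⟨r, hr⟩ := hg
  have hmonA := monic_X_pow_sub_C A (Nat.succ_ne_zero g)
  have hmonB := monic_X_pow_sub_C B (Nat.succ_ne_zero g)
  have hdeg : ((X ^ (g + 1) - C A) * (X ^ (g + 1) - C B)).natDegree = 2 * g + 2 := by
    rw [hmonA.natDegree_mul hmonB, natDegree_X_pow_sub_C, natDegree_X_pow_sub_C]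
    omega
  have h2 : (2 : F) ≠ 0 := by
    have := hcast 2 two_pos (by omega)
    exact_mod_cast this
  have hn0 : ((g + 1 : ℕ) : F) ≠ 0 := hcast _ (by omega) (by omega)
  have hcop : IsCoprime (X ^ (g + 1) - C A) (X ^ (g + 1) - C B) := by
    refine ⟨C (B - A)⁻¹, -C (B - A)⁻¹, ?_⟩
    have : C (B - A)⁻¹ * C (B - A) = (1 : F[X]) := by
      rw [← C_mul, inv_mul_cancel₀ (sub_ne_zero.2 hAB.symm), C_1]
    rw [C_sub] at this
    linear_combination this
  have hsep := (separable_X_pow_sub_C A hn0 hA).mul (separable_X_pow_sub_C B hn0 hB) hcop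
  have key := card_bound (γ := g) (m := 3 * r + 2) (n := 2 * g + 1) (p := p)
    h2 (by omega) (by omega) (by omega)
    (hmonA.mul hmonB) hdeg (ne_sq_of_separable hsep (by rw [hdeg]; omega)) Finset.univ fun t _ => by
      obtain ⟨y, hy⟩ := hcon t
      exact ⟨y, hy.1, by simpa using hy.2⟩
  have hpq : p ≤ Fintype.card F := by
    obtain ⟨k, -, hk⟩ := FiniteField.card F p
    rw [hk]
    exact Nat.le_self_pow k.ne_zero p
  rw [Finset.card_univ, Nat.add_sub_cancel] at key
  subst hr
  generalize Fintype.card F = q at *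
  nlinarith

/-- A curve `y² = u (xⁿ - B)` of genus `γ` has a point with `x ≠ 0` over every large finite
field. -/
theorem exists_value_not_nonzero_sq_of_node [Fintype F] {p g : ℕ} [CharP F p] (hg : Odd g)
    (hp : 4 * g ^ 2 < p) {B : F} (hB : B ≠ 0) :
    ∃ t : F, t ≠ 0 ∧ ∀ y ≠ 0, y ^ 2 ≠ t ^ (g + 1) - B := by
  by_contra! hcon
  have hg1 := hg.pos
  have hprime : p.Prime := (CharP.char_is_prime_or_zero F p).resolve_right (by omega)
  have hgp : 3 * g + 1 < p := by nlinarith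
  have hcast : ∀ k : ℕ, 0 < k → k < p → (k : F) ≠ 0 := fun k h0 hk h => by
    rw [CharP.cast_eq_zero_iff F p] at h
    exact absurd (Nat.le_of_dvd h0 h) (by omega)
  obtain ⟨γ, hγ⟩ := hg
  have h2 : (2 : F) ≠ 0 := by
    have := hcast 2 two_pos (by omega)
    exact_mod_cast this
  have hn0 : ((g + 1 : ℕ) : F) ≠ 0 := hcast _ (by omega) (by omega)
  have hdeg : (X ^ (g + 1) - C B).natDegree = 2 * γ + 2 := by
    rw [natDegree_X_pow_sub_C]
    omega
  classical
  have key := card_bound (γ := γ) (m := 2 * γ + 1) (n := 3 * γ + 2) (p := p)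
    h2 (by omega) (by omega) (by omega)
    (monic_X_pow_sub_C B (Nat.succ_ne_zero g)) hdeg
    (ne_sq_of_separable (separable_X_pow_sub_C B hn0 hB)
      (by rw [hdeg]; omega)) (Finset.univ.erase 0)
    fun t ht => by
      obtain ⟨y, hy⟩ := hcon t (Finset.ne_of_mem_erase ht)
      exact ⟨y, hy.1, by simpa using hy.2⟩
  have hpq : p ≤ Fintype.card F := by
    obtain ⟨k, -, hk⟩ := FiniteField.card F p
    rw [hk]
    exact Nat.le_self_pow k.ne_zero p
  rw [Finset.card_erase_of_mem (Finset.mem_univ _), Finset.card_univ,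
    show 3 * γ + 2 - 1 = 3 * γ + 1 by omega] at key
  subst hγ
  obtain ⟨q, hq⟩ : ∃ q, Fintype.card F = q + 1 := ⟨Fintype.card F - 1, by omega⟩
  rw [hq, Nat.add_sub_cancel] at key
  rw [hq] at hpq
  nlinarith

end CurveBound

namespace LocalTools

lemma isSquare_mul_of_not_isSquare {F : Type*} [Field F] [Finite F] {x y : F}
    (hx : ¬ IsSquare x) (hy : ¬ IsSquare y) : IsSquare (x * y) := by
  classical
  have := Fintype.ofFinite F
  by_contra h
  have h1 := quadraticChar_neg_one_iff_not_isSquare.2 h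
  rw [map_mul, quadraticChar_neg_one_iff_not_isSquare.2 hx,
    quadraticChar_neg_one_iff_not_isSquare.2 hy] at h1
  norm_num at h1

lemma exists_good_value {F : Type*} [Field F] [Finite F] {p g : ℕ} [CharP F p] (hg : Odd g)
    (hp : 4 * g ^ 2 < p) {A B : F} (hAB : A ≠ B) :
    ∃ t : F, (t ≠ 0 ∧ (t ^ (g + 1) = A ∨ t ^ (g + 1) = B)) ∨
      ¬ IsSquare ((t ^ (g + 1) - A) * (t ^ (g + 1) - B)) := by
  have := Fintype.ofFinite F
  obtain ⟨r, hr⟩ := hg.add_one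
  have hpow : ∀ t : F, t ^ (g + 1) = t ^ r * t ^ r := fun t => by rw [hr, pow_add]
  have hnode : ∀ B : F, B ≠ 0 → ∃ t : F, (t ≠ 0 ∧ t ^ (g + 1) = B) ∨
      ¬ IsSquare (t ^ (g + 1) * (t ^ (g + 1) - B)) := by
    intro B hB
    obtain ⟨t, ht0, ht⟩ := CurveBound.exists_value_not_nonzero_sq_of_node hg hp hB
    refine ⟨t, or_iff_not_imp_left.2 fun h => ?_⟩
    rintro ⟨y, hy⟩
    have htr : t ^ r ≠ 0 := pow_ne_zero r ht0
    refine ht (y / t ^ r) ?_ ?_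
    · rintro h0
      rw [div_eq_zero_iff, or_iff_left htr] at h0
      rw [h0, zero_mul, mul_eq_zero, or_iff_right (pow_ne_zero _ ht0), sub_eq_zero] at hy
      exact h ⟨ht0, hy⟩
    · rw [div_pow, sq y, ← hy, hpow t]
      field_simp
  by_cases hA : A = 0
  · subst hA
    obtain ⟨t, ht⟩ := hnode B hAB.symm
    refine ⟨t, ht.imp (fun h => ⟨h.1, Or.inr h.2⟩) fun h => by rwa [sub_zero]⟩
  by_cases hB : B = 0
  · subst hB
    obtain ⟨t, ht⟩ := hnode A hAB
    refine ⟨t, ht.imp (fun h => ⟨h.1, Or.inl h.2⟩) fun h => by rwa [sub_zero, mul_comm]⟩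
  obtain ⟨t, ht⟩ := CurveBound.exists_value_not_nonzero_sq hg hp hA hB hAB
  refine ⟨t, or_iff_not_imp_left.2 fun h => ?_⟩
  rintro ⟨y, hy⟩
  refine ht y ?_ (by rw [sq, hy])
  rintro rfl
  rw [zero_mul, mul_eq_zero, sub_eq_zero, sub_eq_zero] at hy
  refine h ⟨?_, hy⟩
  rintro rfl
  rw [zero_pow (Nat.succ_ne_zero g)] at hy
  exact hy.elim (fun h => hA h.symm) (fun h => hB h.symm)

end LocalTools

namespace LocalTools

section Point

variable {L M : Type*} [Field L] [Field M] {g : ℕ} {a b c d : L}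

lemma X0Point.map (f : L →+* M) (h : X0Point L g a b c d) :
    X0Point M g (f a) (f b) (f c) (f d) := by
  rcases h with ⟨s, t, h⟩ | ⟨s, t, h⟩
  · refine Or.inl ⟨f s, f t, ?_⟩
    simpa [map_ofNat] using congrArg f h
  · refine Or.inr ⟨f s, f t, ?_⟩
    simpa [map_ofNat] using congrArg f h

lemma X0Point.of_isSquare_mul (ha : a ≠ 0) (h : IsSquare (a * b)) : X0Point L g a b c d := by
  obtain ⟨r, hr⟩ := h
  refine Or.inr ⟨r / a, 0, ?_⟩
  rw [zero_pow (Nat.succ_ne_zero g)]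
  field_simp
  linear_combination -hr

lemma X0Point.of_pow_eq {t : L} (h : t ^ (g + 1) = b * c ^ 2 * d ∨
    t ^ (g + 1) = b * c ^ 2 * d + 2 * c) : X0Point L g a b c d := by
  refine Or.inl ⟨0, t, ?_⟩
  rcases h with h | h <;> rw [h] <;> ring

lemma X0Point.of_isSquare (ha : a ≠ 0) (t : L) (h : IsSquare (a * b *
    ((t ^ (g + 1) - b * c ^ 2 * d) * (t ^ (g + 1) - (b * c ^ 2 * d + 2 * c))))) :
    X0Point L g a b c d := by
  obtain ⟨r, hr⟩ := h
  refine Or.inl ⟨r / a, t, ?_⟩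
  generalize t ^ (g + 1) = x at *
  field_simp
  linear_combination -hr

end Point

variable {K : Type u} [Field K] [NumberField K] {g : ℕ} {a b c d : 𝓞 K}
  {va vb vc vd : HeightOneSpectrum (𝓞 K)}

lemma notMem_of_ne {π v : HeightOneSpectrum (𝓞 K)} {x : 𝓞 K} (hv : v.asIdeal = Ideal.span {x})
    (h : π ≠ v) : x ∉ π.asIdeal := by
  intro hx
  have hle : v.asIdeal ≤ π.asIdeal := by
    rwa [hv, Ideal.span_singleton_le_iff_mem]
  exact h (HeightOneSpectrum.ext (v.isMaximal.eq_of_le π.isPrime.ne_top hle).symm)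

lemma natCast_notMem (π : HeightOneSpectrum (𝓞 K)) {n : ℕ} (h0 : 0 < n)
    (h : n < ringChar (𝓞 K ⧸ π.asIdeal)) : (n : 𝓞 K) ∉ π.asIdeal := by
  intro hn
  rw [← Ideal.Quotient.eq_zero_iff_mem, map_natCast, ringChar.spec] at hn
  exact absurd (Nat.le_of_dvd h0 hn) (by omega)

lemma mk_ne_zero {π : HeightOneSpectrum (𝓞 K)} {x : 𝓞 K} (h : x ∉ π.asIdeal) :
    Ideal.Quotient.mk π.asIdeal x ≠ 0 := by
  rwa [Ne, Ideal.Quotient.eq_zero_iff_mem]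

lemma toCompletion_ne_zero (π : HeightOneSpectrum (𝓞 K)) {x : 𝓞 K} (h : x ≠ 0) :
    toCompletion π x ≠ 0 :=
  (map_ne_zero_iff _ (toCompletion_injective π)).2 h

lemma x0Point_generic (hg : Odd g) (π : HeightOneSpectrum (𝓞 K))
    (hπ : 4 * g ^ 2 < ringChar (𝓞 K ⧸ π.asIdeal)) (h2 : (2 : 𝓞 K) ∉ π.asIdeal)
    (ha : a ∉ π.asIdeal) (hb : b ∉ π.asIdeal) (hc : c ∉ π.asIdeal) :
    X0Point (π.adicCompletion K) g (toCompletion π a) (toCompletion π b)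
      (toCompletion π c) (toCompletion π d) := by
  have := π.isMaximal
  let := Ideal.Quotient.field π.asIdeal
  have : Finite (𝓞 K ⧸ π.asIdeal) := Ideal.finiteQuotientOfFreeOfNeBot _ π.ne_bot
  have ha0 : toCompletion π a ≠ 0 := toCompletion_ne_zero π (by rintro rfl; exact ha (zero_mem _))
  have hab : a * b ∉ π.asIdeal := π.isPrime.mul_notMem ha hb
  by_cases hsq : IsSquare (Ideal.Quotient.mk π.asIdeal (a * b))
  · refine X0Point.of_isSquare_mul ha0 ?_
    rw [← map_mul]
    exact isSquare_of_residue π h2 hab hsq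
  have hg1 := hg.pos
  obtain ⟨t, ht⟩ := exists_good_value (F := 𝓞 K ⧸ π.asIdeal) hg hπ
    (A := Ideal.Quotient.mk π.asIdeal (b * c ^ 2 * d))
    (B := Ideal.Quotient.mk π.asIdeal (b * c ^ 2 * d + 2 * c)) (by
      rw [map_add, Ne, left_eq_add]
      exact mk_ne_zero (π.isPrime.mul_notMem h2 hc))
  obtain ⟨t, rfl⟩ := Ideal.Quotient.mk_surjective t
  rcases ht with ⟨ht0, ht⟩ | ht
  · have hnt : ((g + 1 : ℕ) : 𝓞 K) * t ∉ π.asIdeal := π.isPrime.mul_notMem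
      (natCast_notMem π (Nat.succ_pos g) (by nlinarith))
      (by rwa [Ne, Ideal.Quotient.eq_zero_iff_mem] at ht0)
    rcases ht with ht | ht
    · rw [← map_pow, Ideal.Quotient.eq] at ht
      obtain ⟨x, hx⟩ := exists_pow_eq π ht hnt
      exact X0Point.of_pow_eq (t := x) (Or.inl (by simpa using hx))
    · rw [← map_pow, Ideal.Quotient.eq] at ht
      obtain ⟨x, hx⟩ := exists_pow_eq π ht hnt
      exact X0Point.of_pow_eq (t := x) (Or.inr (by simpa [map_ofNat] using hx))
  · refine X0Point.of_isSquare ha0 (toCompletion π t) ?_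
    rw [← map_pow, ← map_sub] at ht
    rw [← map_sub, ← map_mul] at ht
    have h3 := isSquare_mul_of_not_isSquare hsq ht
    rw [← map_mul] at h3
    have h4 : (t ^ (g + 1) - b * c ^ 2 * d) * (t ^ (g + 1) - (b * c ^ 2 * d + 2 * c)) ∉
        π.asIdeal := by
      intro h
      rw [← Ideal.Quotient.eq_zero_iff_mem] at h
      rw [h] at ht
      exact ht IsSquare.zero
    simpa [map_ofNat] using isSquare_of_residue π h2 (π.isPrime.mul_notMem hab h4) h3

lemma isSquare_residue_of_eq_one {π : HeightOneSpectrum (𝓞 K)} (h2 : (2 : 𝓞 K) ∉ π.asIdeal)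
    {x : 𝓞 K} (hx : x - 1 ∈ π.asIdeal) : IsSquare (toCompletion π x) := by
  have h1 : Ideal.Quotient.mk π.asIdeal x = 1 := by
    rw [← map_one (Ideal.Quotient.mk π.asIdeal), Ideal.Quotient.eq]
    exact hx
  refine isSquare_of_residue π h2 (fun h => ?_) ?_
  · rw [← Ideal.Quotient.eq_zero_iff_mem, h1] at h
    exact π.isPrime.ne_top ((Ideal.eq_top_iff_one _).2 (by
      rw [← Ideal.Quotient.eq_zero_iff_mem, map_one, h]))
  · rw [h1]
    exact IsSquare.one

end LocalTools

namespace Params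

open LocalTools

variable {K : Type u} [Field K] [NumberField K] {g : ℕ} {a b c d : 𝓞 K}
  {va vb vc vd : HeightOneSpectrum (𝓞 K)}

variable (hP : Params K g a b c d va vb vc vd)
include hP

lemma b_notMem_va : b ∉ va.asIdeal := notMem_of_ne hP.span_b hP.distinct.1

lemma a_ne_zero : a ≠ 0 := by
  rintro rfl
  exact va.ne_bot (by rw [hP.span_a, Ideal.span_singleton_eq_bot])

lemma a_notMem_vb : a ∉ vb.asIdeal := notMem_of_ne hP.span_a hP.distinct.1.symm
lemma c_notMem_vb : c ∉ vb.asIdeal := notMem_of_ne hP.span_c hP.distinct.2.2.2.1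
lemma d_notMem_vb : d ∉ vb.asIdeal := notMem_of_ne hP.span_d hP.distinct.2.2.2.2.1
lemma a_notMem_vc : a ∉ vc.asIdeal := notMem_of_ne hP.span_a hP.distinct.2.1.symm
lemma b_notMem_vc : b ∉ vc.asIdeal := notMem_of_ne hP.span_b hP.distinct.2.2.2.1.symm

lemma x0Point_va (hg1 : 1 ≤ g) : X0Point (va.adicCompletion K) g (toCompletion va a)
    (toCompletion va b) (toCompletion va c) (toCompletion va d) := by
  have ha : a ∈ va.asIdeal := by rw [hP.span_a]; exact Ideal.mem_span_singleton_self a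
  have h1 : (1 : 𝓞 K) ^ (g + 1) - (b * c ^ 2 * d - 2 * (a * b * c)) ∈ va.asIdeal := by
    obtain ⟨k, hk⟩ := hP.cong_bcd
    rw [one_pow, show 1 - (b * c ^ 2 * d - 2 * (a * b * c)) = a * (2 * (b * c) - k) by
      linear_combination -hk]
    exact Ideal.mul_mem_right _ _ ha
  obtain ⟨t, ht⟩ := exists_pow_eq va h1 (by
    rw [mul_one]
    exact natCast_notMem va (Nat.succ_pos g) (by have := hP.char_big.1; nlinarith))
  obtain ⟨r, hr⟩ := isSquare_residue_of_eq_one (x := 1 + a * b) hP.not_dvd_two.1 (by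
    rw [add_sub_cancel_left]
    exact Ideal.mul_mem_right _ _ ha)
  refine Or.inl ⟨2 * toCompletion va b * toCompletion va c * r, t, ?_⟩
  rw [ht]
  simp only [map_sub, map_mul, map_add, map_pow, map_ofNat, map_one] at hr ⊢
  linear_combination (-4 * toCompletion va a * toCompletion va b ^ 2 * toCompletion va c ^ 2) * hr

lemma x0Point_vb : X0Point (vb.adicCompletion K) g (toCompletion vb a)
    (toCompletion vb b) (toCompletion vb c) (toCompletion vb d) := by
  have := vb.isMaximal
  let := Ideal.Quotient.field vb.asIdeal
  have : Finite (𝓞 K ⧸ vb.asIdeal) := Ideal.finiteQuotientOfFreeOfNeBot _ vb.ne_bot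
  have hb : b ∈ vb.asIdeal := by rw [hP.span_b]; exact Ideal.mem_span_singleton_self b
  have h2 := hP.not_dvd_two.2.1
  have h3 : Ideal.Quotient.mk vb.asIdeal (b * c * d + 2) = Ideal.Quotient.mk vb.asIdeal 2 := by
    rw [Ideal.Quotient.eq, add_sub_cancel_right, mul_assoc]
    exact Ideal.mul_mem_right _ _ hb
  have h4 : b * c * d + 2 ∉ vb.asIdeal := by
    rw [← Ideal.Quotient.eq_zero_iff_mem, h3, Ideal.Quotient.eq_zero_iff_mem]
    exact h2
  have hc : ¬ IsSquare (Ideal.Quotient.mk vb.asIdeal c) := fun h =>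
    hP.c_nsq_b (isSquare_of_residue vb h2 hP.c_notMem_vb h)
  have hd : ¬ IsSquare (Ideal.Quotient.mk vb.asIdeal d) := fun h =>
    hP.d_nsq_b (isSquare_of_residue vb h2 hP.d_notMem_vb h)
  have h5 : IsSquare (toCompletion vb (c * d * (b * c * d + 2))) := by
    refine isSquare_of_residue vb h2 (vb.isPrime.mul_notMem
      (vb.isPrime.mul_notMem hP.c_notMem_vb hP.d_notMem_vb) h4) ?_
    rw [map_mul, map_mul, h3]
    refine (isSquare_mul_of_not_isSquare hc hd).mul (isSquare_residue vb ?_)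
    rw [map_ofNat]
    exact hP.sq_two_b
  refine X0Point.of_isSquare (toCompletion_ne_zero vb hP.a_ne_zero) 0 ?_
  have h6 : IsSquare (toCompletion vb a) := hP.a_sq_b
  obtain ⟨r, hr⟩ := h6.mul h5
  refine ⟨toCompletion vb b * toCompletion vb c * r, ?_⟩
  rw [zero_pow (Nat.succ_ne_zero g)]
  simp only [map_mul, map_add, map_ofNat] at hr
  linear_combination (toCompletion vb b * toCompletion vb c) ^ 2 * hr

lemma x0Point_vc : X0Point (vc.adicCompletion K) g (toCompletion vc a)
    (toCompletion vc b) (toCompletion vc c) (toCompletion vc d) := by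
  have := vc.isMaximal
  let := Ideal.Quotient.field vc.asIdeal
  have : Finite (𝓞 K ⧸ vc.asIdeal) := Ideal.finiteQuotientOfFreeOfNeBot _ vc.ne_bot
  have h2 := hP.not_dvd_two.2.2.1
  refine X0Point.of_isSquare_mul (toCompletion_ne_zero vc hP.a_ne_zero) ?_
  rw [← map_mul]
  refine isSquare_of_residue vc h2 (vc.isPrime.mul_notMem hP.a_notMem_vc hP.b_notMem_vc) ?_
  rw [map_mul]
  exact isSquare_mul_of_not_isSquare
    (fun h => hP.a_nsq_c (isSquare_of_residue vc h2 hP.a_notMem_vc h))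
    (fun h => hP.b_nsq_c (isSquare_of_residue vc h2 hP.b_notMem_vc h))

theorem x0Point_completion (hg1 : 1 ≤ g) (hg : Odd g) (π : HeightOneSpectrum (𝓞 K)) :
    X0Point (π.adicCompletion K) g (toCompletion π a)
      (toCompletion π b) (toCompletion π c) (toCompletion π d) := by
  by_cases hbad : (2 : 𝓞 K) ∈ π.asIdeal ∨ ringChar (𝓞 K ⧸ π.asIdeal) ≤ 4 * g ^ 2
  · obtain ⟨h1, h2⟩ := hP.sq_ab_bad π hbad
    exact X0Point.of_isSquare_mul (toCompletion_ne_zero π hP.a_ne_zero) (h1.mul h2)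
  push Not at hbad
  rcases eq_or_ne π va with rfl | hva
  · exact hP.x0Point_va hg1
  rcases eq_or_ne π vb with rfl | hvb
  · exact hP.x0Point_vb
  rcases eq_or_ne π vc with rfl | hvc
  · exact hP.x0Point_vc
  exact x0Point_generic hg π hbad.2 hbad.1 (notMem_of_ne hP.span_a hva)
    (notMem_of_ne hP.span_b hvb) (notMem_of_ne hP.span_c hvc)

theorem x0Point_real (σ : K →+* ℝ) : X0Point ℝ g (σ (algebraMap (𝓞 K) K a))
    (σ (algebraMap (𝓞 K) K b)) (σ (algebraMap (𝓞 K) K c)) (σ (algebraMap (𝓞 K) K d)) :=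
  X0Point.of_isSquare_mul (hP.pos_real σ).1.ne' ⟨√(σ _ * σ _), (Real.mul_self_sqrt
    (mul_pos (hP.pos_real σ).1 (hP.pos_real σ).2).le).symm⟩

theorem x0Point_complex (σ : K →+* ℂ) : X0Point ℂ g (σ (algebraMap (𝓞 K) K a))
    (σ (algebraMap (𝓞 K) K b)) (σ (algebraMap (𝓞 K) K c)) (σ (algebraMap (𝓞 K) K d)) :=
  X0Point.of_isSquare_mul ((map_ne_zero σ).2 (by simpa using hP.a_ne_zero))
    (isSquare_iff_exists_sq _ |>.2 <|
      (IsAlgClosed.exists_pow_nat_eq _ two_pos).imp fun _ h => h.symm)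

end Params

namespace LocalTools

open UniqueFactorizationMonoid

variable {R : Type*} [CommRing R] [IsDedekindDomain R]

lemma exists_mul_sq_eq {I : Ideal R} (hI : I ≠ 0) (good : Ideal R → Prop)
    (h : ∀ p : Ideal R, Prime p → p ∣ I → ¬ good p → ∃ n, p ^ (2 * n) ∣ I ∧ ¬ p ^ (2 * n + 1) ∣ I) :
    ∃ S T : Ideal R, S * T ^ 2 = I ∧ ∀ p : Ideal R, Prime p → p ∣ S → good p := by
  classical
  obtain ⟨U, hU⟩ := Multiset.exists_smul_of_dvd_count
    ((normalizedFactors I).filter fun p => ¬ good p) (k := 2) (by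
      intro p hp
      rw [Multiset.mem_filter] at hp
      have hprime := prime_of_normalized_factor p hp.1
      obtain ⟨n, h1, h2⟩ := h p hprime (dvd_of_mem_normalizedFactors hp.1) hp.2
      rw [Multiset.count_filter_of_pos (p := fun p => ¬ good p) hp.2,
        count_normalizedFactors_eq hprime.irreducible (normalize_eq p) h1 h2]
      exact dvd_mul_right 2 n)
  refine ⟨((normalizedFactors I).filter good).prod, U.prod, ?_, fun p hp hdvd => ?_⟩
  · rw [← Multiset.prod_nsmul, ← hU, ← Multiset.prod_add, Multiset.filter_add_not]
    exact associated_iff_eq.1 (prod_normalizedFactors hI)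
  · obtain ⟨r, hr, hpr⟩ := Prime.exists_mem_multiset_dvd hp hdvd
    rw [Multiset.mem_filter] at hr
    have : p = r := associated_iff_eq.1
      (hp.irreducible.associated_of_dvd (prime_of_normalized_factor r hr.1).irreducible hpr)
    rw [this]
    exact hr.2

theorem exists_descent {b F : R} (h20 : (2 : R) ≠ 0) (hF : F ≠ 0)
    (h1 : ∀ p : HeightOneSpectrum R, 2 * F ∈ p.asIdeal → b ∉ p.asIdeal)
    (h2 : ∀ p : HeightOneSpectrum R, (2 : R) ∈ p.asIdeal →
      ∀ k : ℕ, ∃ s, s ^ 2 - b ∈ p.asIdeal ^ k)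
    (h3 : ∀ p : HeightOneSpectrum R, F ∈ p.asIdeal →
      (∀ k : ℕ, ∃ s, s ^ 2 - b ∈ p.asIdeal ^ k) ∨
        ∃ n : ℕ, F ∈ p.asIdeal ^ (2 * n) ∧ F ∉ p.asIdeal ^ (2 * n + 1)) :
    ∃ (S T : Ideal R) (s : R), S * T ^ 2 = Ideal.span {F} ∧ s ^ 2 - b ∈ Ideal.span {4} * S ∧
      IsCoprime (Ideal.span {s}) (Ideal.span {2} * (S * T)) := by
  classical
  have hF0 : Ideal.span {F} ≠ 0 := by
    rwa [Ne, Ideal.zero_eq_bot, Ideal.span_singleton_eq_bot]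
  let toH : ∀ p : Ideal R, Prime p → HeightOneSpectrum R := fun p hp =>
    ⟨p, Ideal.isPrime_of_prime hp, hp.ne_zero⟩
  obtain ⟨S, T, hST, hS⟩ := exists_mul_sq_eq hF0 (fun p => ∀ k : ℕ, ∃ s, s ^ 2 - b ∈ p ^ k) (by
    intro p hp hdvd hbad
    rw [Ideal.dvd_span_singleton] at hdvd
    obtain ⟨n, hn1, hn2⟩ := (h3 (toH p hp) hdvd).resolve_left hbad
    exact ⟨n, Ideal.dvd_span_singleton.2 hn1, fun h => hn2 (Ideal.dvd_span_singleton.1 h)⟩)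
  have hS0 : S ≠ 0 := by rintro rfl; exact hF0 (by rw [← hST, zero_mul])
  have hT0 : T ≠ 0 := by rintro rfl; exact hF0 (by rw [← hST]; simp)
  have h40 : (Ideal.span {(4 : R)}) ≠ 0 := by
    rw [Ne, Ideal.zero_eq_bot, Ideal.span_singleton_eq_bot, show (4 : R) = 2 * 2 by norm_num]
    exact mul_ne_zero h20 h20
  set J := Ideal.span {(4 : R)} * S with hJ
  have hJ0 : J ≠ 0 := mul_ne_zero h40 hS0
  have hprime2 : ∀ p : Ideal R, Prime p → p ∣ Ideal.span {(4 : R)} → (2 : R) ∈ p := by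
    intro p hp h
    rw [Ideal.dvd_span_singleton, show (4 : R) = 2 * 2 by norm_num] at h
    exact ((Ideal.isPrime_of_prime hp).mem_or_mem h).elim id id
  have hgood : ∀ p : Ideal R, Prime p → p ∣ J → ∀ k : ℕ, ∃ s, s ^ 2 - b ∈ p ^ k := by
    intro p hp h
    rcases hp.dvd_or_dvd h with h | h
    · exact h2 (toH p hp) (hprime2 p hp h)
    · exact hS p hp h
  have hb : ∀ p : Ideal R, Prime p → p ∣ J * T → b ∉ p := by
    intro p hp h
    refine h1 (toH p hp) ?_
    rcases hp.dvd_or_dvd h with h | h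
    · rcases hp.dvd_or_dvd h with h | h
      · exact Ideal.mul_mem_right _ _ (hprime2 p hp h)
      · exact Ideal.mul_mem_left _ _ (Ideal.dvd_span_singleton.1
          (h.trans (by rw [← hST]; exact dvd_mul_right _ _)))
    · exact Ideal.mul_mem_left _ _ (Ideal.dvd_span_singleton.1
        (h.trans (by rw [← hST, sq]; exact (dvd_mul_right _ _).mul_left _)))
  let x : Ideal R → R := fun p =>
    if h : ∃ s, s ^ 2 - b ∈ p ^ (multiplicity p J + 1) then h.choose else 1
  have hx : ∀ p : Ideal R, x p ^ 2 - b ∈ p ^ (multiplicity p J + 1) ∨ x p = 1 := by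
    intro p
    by_cases h : ∃ s, s ^ 2 - b ∈ p ^ (multiplicity p J + 1)
    · left
      simp only [x, dif_pos h]
      exact h.choose_spec
    · right
      simp only [x, dif_neg h]
  have hmem : ∀ p : Ideal R, p ∈ (normalizedFactors (J * T)).toFinset ↔ Prime p ∧ p ∣ J * T := by
    intro p
    rw [Multiset.mem_toFinset, mem_normalizedFactors_iff (mul_ne_zero hJ0 hT0)]
  obtain ⟨s, hs⟩ := IsDedekindDomain.exists_forall_sub_mem_ideal
    (s := (normalizedFactors (J * T)).toFinset) (fun p => p) (fun p => multiplicity p J + 1)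
    (fun p hp => ((hmem p).1 hp).1) (fun _ _ _ _ h => h) (fun p => x p)
  have hs' : ∀ p : Ideal R, Prime p → p ∣ J * T → s - x p ∈ p ^ (multiplicity p J + 1) :=
    fun p hp h => hs p ((hmem p).2 ⟨hp, h⟩)
  refine ⟨S, T, s, hST, ?_, ?_⟩
  · rw [← Ideal.dvd_span_singleton, dvd_iff_emultiplicity_le hJ0]
    intro p hp
    rw [emultiplicity_le_emultiplicity_iff]
    intro n hn
    rcases Nat.eq_zero_or_pos n with rfl | hn0
    · rw [pow_zero]; exact one_dvd _
    have hpJ : p ∣ J := (dvd_pow_self p hn0.ne').trans hn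
    have hfin : FiniteMultiplicity p J := FiniteMultiplicity.of_prime_left hp hJ0
    have hle : n ≤ multiplicity p J := hfin.pow_dvd_iff_le_multiplicity.1 hn
    rw [Ideal.dvd_span_singleton]
    refine Ideal.pow_le_pow_right (hle.trans (Nat.le_succ _)) ?_
    have h4 : x p ^ 2 - b ∈ p ^ (multiplicity p J + 1) := by
      have := hgood p hp hpJ (multiplicity p J + 1)
      simp only [x, dif_pos this]
      exact this.choose_spec
    have h5 := hs' p hp (hpJ.mul_right T)
    have : s ^ 2 - b = (s + x p) * (s - x p) + (x p ^ 2 - b) := by ring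
    rw [this]
    exact add_mem (Ideal.mul_mem_left _ _ h5) h4
  · rw [Ideal.isCoprime_iff_sup_eq]
    by_contra hne
    obtain ⟨M, hM, hle⟩ := Ideal.exists_le_maximal _ hne
    have hsM : s ∈ M := hle (Ideal.mem_sup_left (Ideal.mem_span_singleton_self s))
    have hM2 : Ideal.span {2} * (S * T) ≤ M := le_sup_right.trans hle
    have hle2 : J * T ≤ Ideal.span {2} * (S * T) := by
      rw [hJ, mul_assoc]
      refine Ideal.mul_mono_left ?_
      rw [Ideal.span_singleton_le_span_singleton, show (4 : R) = 2 * 2 by norm_num]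
      exact dvd_mul_right _ _
    have hM0 : M ≠ ⊥ := by
      rintro rfl
      exact mul_ne_zero hJ0 hT0 (le_bot_iff.1 (hle2.trans hM2))
    have hMp : Prime M := Ideal.prime_of_isPrime hM0 hM.isPrime
    have hdvd : M ∣ J * T := Ideal.dvd_iff_le.2 (hle2.trans hM2)
    have hxM : x M ∈ M := by
      have := Ideal.pow_le_self (Nat.succ_ne_zero _) (hs' M hMp hdvd)
      have h6 := sub_mem hsM this
      rwa [sub_sub_cancel] at h6
    rcases hx M with h | h
    · refine hb M hMp hdvd ?_
      have h7 := sub_mem (Ideal.pow_mem_of_mem M hxM 2 two_pos)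
        (Ideal.pow_le_self (Nat.succ_ne_zero _) h)
      rwa [sub_sub_cancel] at h7
    · rw [h] at hxM
      exact hM.ne_top ((Ideal.eq_top_iff_one _).2 hxM)

end LocalTools

namespace LocalTools

open WithZero

lemma not_isSquare_exp_neg_one : ¬ IsSquare (exp (-1) : ℤᵐ⁰) := by
  rintro ⟨x, hx⟩
  have hx0 : x ≠ 0 := by
    rintro rfl
    rw [mul_zero] at hx
    exact exp_ne_zero hx
  have := congrArg log hx
  rw [log_exp, log_mul hx0 hx0] at this
  omega

lemma isSquare_of_mul_sq_eq {G : Type*} [CommGroupWithZero G] {x y z : G} (hy : y ≠ 0)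
    (h : x * y ^ 2 = z ^ 2) : IsSquare x := by
  refine ⟨z / y, ?_⟩
  rw [← sq, div_pow, ← h, mul_div_cancel_right₀ _ (pow_ne_zero 2 hy)]

variable {K : Type u} [Field K] [NumberField K]

lemma isSquare_mk_of_mul_sq (p : HeightOneSpectrum (𝓞 K)) {x y z : 𝓞 K} (hy : y ∉ p.asIdeal)
    (h : x * y ^ 2 - z ^ 2 ∈ p.asIdeal) : IsSquare (Ideal.Quotient.mk p.asIdeal x) := by
  have := p.isMaximal
  let := Ideal.Quotient.field p.asIdeal
  refine isSquare_of_mul_sq_eq (y := Ideal.Quotient.mk p.asIdeal y)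
    (z := Ideal.Quotient.mk p.asIdeal z) ?_ ?_
  · rwa [Ne, Ideal.Quotient.eq_zero_iff_mem]
  · rw [← map_pow, ← map_pow, ← map_mul]
    exact Ideal.Quotient.eq.2 h

lemma isSquare_mk_of_valuation_lt (p : HeightOneSpectrum (𝓞 K)) {u : K} {x : 𝓞 K}
    (hu : p.valuation K u ≤ 1) (h : p.valuation K (u ^ 2 - algebraMap (𝓞 K) K x) < 1) :
    IsSquare (Ideal.Quotient.mk p.asIdeal x) := by
  obtain ⟨n, ⟨y, hy⟩, hny⟩ := p.exists_primeCompl_mul_eq_of_integer u hu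
  refine isSquare_mk_of_mul_sq p (y := y) (z := n) hy ?_
  rw [← p.valuation_lt_one_iff_mem (K := K)]
  have h1 : algebraMap (𝓞 K) K (x * y ^ 2 - n ^ 2) =
      -((u ^ 2 - algebraMap (𝓞 K) K x) * algebraMap (𝓞 K) K y ^ 2) := by
    rw [map_sub, map_mul, map_pow, map_pow, ← hny]
    ring
  rw [Algebra.cast, h1, Valuation.map_neg, Valuation.map_mul, Valuation.map_pow,
    (p.valuation_eq_one_iff_notMem).2 hy, one_pow, mul_one]
  exact h

lemma exists_even_pow_of_isSquare (p : HeightOneSpectrum (𝓞 K)) {F : 𝓞 K} (hF : F ≠ 0)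
    (h : IsSquare (p.valuation K (algebraMap (𝓞 K) K F))) :
    ∃ n : ℕ, F ∈ p.asIdeal ^ (2 * n) ∧ F ∉ p.asIdeal ^ (2 * n + 1) := by
  obtain ⟨x, hx⟩ := h
  rw [HeightOneSpectrum.valuation_of_algebraMap] at hx
  have h0 : p.intValuation F ≠ 0 := p.intValuation_ne_zero F hF
  have hx0 : x ≠ 0 := by
    rintro rfl
    rw [mul_zero] at hx
    exact h0 hx
  have hlog := congrArg log hx
  rw [log_mul hx0 hx0, p.intValuation_if_neg hF, log_exp] at hlog
  set m := (Associates.mk p.asIdeal).count (Associates.mk (Ideal.span {F} : Ideal (𝓞 K))).factors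
    with hm
  obtain ⟨n, hn⟩ : ∃ n : ℕ, m = 2 * n := ⟨(-log x).toNat, by omega⟩
  have hv : p.intValuation F = exp (-((2 * n : ℕ) : ℤ)) := by
    rw [p.intValuation_if_neg hF, ← hm, hn]
  refine ⟨n, ?_, ?_⟩
  · rw [← p.intValuation_le_pow_iff_mem, hv]
  · rw [← p.intValuation_le_pow_iff_mem, hv, exp_le_exp]
    push_cast
    omega

end LocalTools

namespace Params

open LocalTools WithZero

variable {K : Type u} [Field K] [NumberField K] {g : ℕ} {a b c d : 𝓞 K}
  {va vb vc vd : HeightOneSpectrum (𝓞 K)}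

variable (hP : Params K g a b c d va vb vc vd)
include hP

lemma b_ne_zero : b ≠ 0 := by
  rintro rfl
  exact vb.ne_bot (by rw [hP.span_b, Ideal.span_singleton_eq_bot])

lemma c_ne_zero : c ≠ 0 := by
  rintro rfl
  exact vc.ne_bot (by rw [hP.span_c, Ideal.span_singleton_eq_bot])

lemma valuation_a : va.valuation K (algebraMap (𝓞 K) K a) = exp (-1) := by
  rw [HeightOneSpectrum.valuation_of_algebraMap, va.intValuation_singleton hP.a_ne_zero hP.span_a]

lemma valuation_b : vb.valuation K (algebraMap (𝓞 K) K b) = exp (-1) := by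
  rw [HeightOneSpectrum.valuation_of_algebraMap, vb.intValuation_singleton hP.b_ne_zero hP.span_b]

lemma valuation_c : vc.valuation K (algebraMap (𝓞 K) K c) = exp (-1) := by
  rw [HeightOneSpectrum.valuation_of_algebraMap, vc.intValuation_singleton hP.c_ne_zero hP.span_c]

/-- A rational point on either chart gives one on the first chart. -/
lemma exists_affine_point (h : X0Point K g (algebraMap (𝓞 K) K a) (algebraMap (𝓞 K) K b)
    (algebraMap (𝓞 K) K c) (algebraMap (𝓞 K) K d)) :
    ∃ s t : K, algebraMap (𝓞 K) K a * s ^ 2 = algebraMap (𝓞 K) K b *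
      ((t ^ (g + 1) - algebraMap (𝓞 K) K (b * c ^ 2 * d)) *
        (t ^ (g + 1) - algebraMap (𝓞 K) K (b * c ^ 2 * d) - 2 * algebraMap (𝓞 K) K c)) := by
  have hAB : algebraMap (𝓞 K) K b * algebraMap (𝓞 K) K c ^ 2 * algebraMap (𝓞 K) K d =
      algebraMap (𝓞 K) K (b * c ^ 2 * d) := by
    rw [map_mul, map_mul, map_pow]
  unfold X0Point XPoint at h
  rw [hAB] at h
  rcases h with ⟨s, t, h⟩ | ⟨s, t, h⟩
  · exact ⟨s, t, by rw [h, sub_sub]⟩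
  · rcases eq_or_ne t 0 with rfl | ht
    · exfalso
      rw [zero_pow (Nat.succ_ne_zero g), mul_zero, mul_zero, sub_zero, mul_one, mul_one] at h
      have hv := congrArg (va.valuation K) h
      rw [Valuation.map_mul, Valuation.map_pow, hP.valuation_a,
        va.valuation_eq_one_iff_notMem.2 hP.b_notMem_va] at hv
      refine not_isSquare_exp_neg_one (isSquare_of_mul_sq_eq (y := va.valuation K s) (z := 1) ?_ ?_)
      · intro h0
        rw [h0, zero_pow two_ne_zero, mul_zero] at hv
        exact zero_ne_one hv
      · rw [hv, one_pow]
    · refine ⟨s * t⁻¹ ^ (g + 1), t⁻¹, ?_⟩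
      have htn : t ^ (g + 1) ≠ 0 := pow_ne_zero _ ht
      rw [inv_pow]
      generalize t ^ (g + 1) = y at h htn
      field_simp
      linear_combination h

lemma two_notMem_of_b_nsq {p : HeightOneSpectrum (𝓞 K)} (hp : ¬ IsSquare (toCompletion p b)) :
    (2 : 𝓞 K) ∉ p.asIdeal := fun h => hp (hP.sq_ab_bad p (Or.inl h)).2

lemma a_notMem_of_b_nsq {p : HeightOneSpectrum (𝓞 K)} (hp : ¬ IsSquare (toCompletion p b)) :
    a ∉ p.asIdeal := by
  refine notMem_of_ne hP.span_a ?_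
  rintro rfl
  exact hp hP.b_sq_a

/-- Away from `b`, the value of `f = t ^ (g + 1) - b c² d` is a square in the value group at every
place where `b` is not a square. -/
lemma isSquare_valuation {s f x : K} (hf : f = x ^ 2 - algebraMap (𝓞 K) K (b * c ^ 2 * d))
    (h : algebraMap (𝓞 K) K a * s ^ 2 = algebraMap (𝓞 K) K b *
      (f * (f - 2 * algebraMap (𝓞 K) K c)))
    {p : HeightOneSpectrum (𝓞 K)} (hpb : p ≠ vb) (hp : ¬ IsSquare (toCompletion p b)) :
    IsSquare (p.valuation K f) := by
  have hA : p.valuation K (algebraMap (𝓞 K) K (b * c ^ 2 * d)) ≤ 1 := p.valuation_le_one _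
  rcases lt_trichotomy (p.valuation K f) 1 with hlt | heq | hgt
  · by_cases hpc : p = vc
    · subst hpc
      have hc := hP.valuation_c
      have hc0 : algebraMap (𝓞 K) K c ≠ 0 := by
        simpa using hP.c_ne_zero
      have hf2 : f = algebraMap (𝓞 K) K c ^ 2 * ((x / algebraMap (𝓞 K) K c) ^ 2 -
          algebraMap (𝓞 K) K (b * d)) := by
        rw [hf, map_mul, map_mul, map_mul, map_pow]
        field_simp
      have hx : p.valuation K x < 1 := by
        by_contra hx
        push Not at hx
        have hA' : p.valuation K (algebraMap (𝓞 K) K (b * c ^ 2 * d)) < 1 := by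
          have hcp : c ∈ p.asIdeal := by
            rw [hP.span_c]; exact Ideal.mem_span_singleton_self c
          refine (p.valuation_lt_one_iff_mem (K := K) _).2 ?_
          exact Ideal.mul_mem_right _ _ (Ideal.mul_mem_left _ _
            (Ideal.pow_mem_of_mem _ hcp 2 two_pos))
        have hx2 : 1 ≤ p.valuation K (x ^ 2) := by
          rw [Valuation.map_pow]
          exact one_le_pow₀ hx
        have := Valuation.map_sub_eq_of_lt_left (p.valuation K) (hA'.trans_le hx2)
        rw [hf, this] at hlt
        exact absurd hx2 (not_le.2 hlt)
      have hu : p.valuation K (x / algebraMap (𝓞 K) K c) ≤ 1 := by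
        rw [Valuation.map_div, hc]
        rcases eq_or_ne (p.valuation K x) 0 with h0 | h0
        · rw [h0, zero_div]; exact zero_le_one
        · rw [div_le_one₀ (exp_pos), ← log_le_log h0 exp_ne_zero, log_exp]
          rw [← log_lt_log h0 one_ne_zero, log_one] at hx
          omega
      have h1 : p.valuation K ((x / algebraMap (𝓞 K) K c) ^ 2 -
          algebraMap (𝓞 K) K (b * d)) = 1 := by
        by_contra hne
        have hle : p.valuation K ((x / algebraMap (𝓞 K) K c) ^ 2 -
          algebraMap (𝓞 K) K (b * d)) ≤ 1 := by
          refine (Valuation.map_sub _ _ _).trans (max_le ?_ (p.valuation_le_one _))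
          rw [Valuation.map_pow]
          exact pow_le_one₀ zero_le hu
        have hbd := isSquare_mk_of_valuation_lt p hu (lt_of_le_of_ne hle hne)
        obtain ⟨y, hy⟩ := isSquare_residue p hP.d_sq_c
        obtain ⟨y, rfl⟩ := Ideal.Quotient.mk_surjective y
        obtain ⟨z, hz⟩ := hbd
        obtain ⟨z, rfl⟩ := Ideal.Quotient.mk_surjective z
        have hdp : d ∉ p.asIdeal := notMem_of_ne hP.span_d hP.distinct.2.2.2.2.2
        rw [← map_mul, Ideal.Quotient.eq] at hy hz
        have hyp : y ∉ p.asIdeal := by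
          intro hyp
          have := add_mem hy (Ideal.mul_mem_left _ y hyp)
          rw [sub_add_cancel] at this
          exact hdp this
        refine hP.b_nsq_c (isSquare_of_residue p (hP.two_notMem_of_b_nsq hp) hP.b_notMem_vc
          (isSquare_mk_of_mul_sq p (y := y) (z := z) hyp ?_))
        have : b * y ^ 2 - z ^ 2 = (b * d - z * z) - b * (d - y * y) := by ring
        rw [this]
        exact sub_mem hz (Ideal.mul_mem_left _ _ hy)
      rw [hf2, Valuation.map_mul, h1, mul_one, Valuation.map_pow]
      exact IsSquare.sq _
    · have h2c : p.valuation K (2 * algebraMap (𝓞 K) K c) = 1 := by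
        have : (2 : K) * algebraMap (𝓞 K) K c = algebraMap (𝓞 K) K (2 * c) := by
          rw [map_mul, map_ofNat]
        rw [this, p.valuation_eq_one_iff_notMem]
        exact p.isPrime.mul_notMem (hP.two_notMem_of_b_nsq hp) (notMem_of_ne hP.span_c hpc)
      have h3 := congrArg (p.valuation K) h
      rw [Valuation.map_mul, Valuation.map_mul, Valuation.map_mul, Valuation.map_pow,
        p.valuation_eq_one_iff_notMem.2 (hP.a_notMem_of_b_nsq hp),
        p.valuation_eq_one_iff_notMem.2 (notMem_of_ne hP.span_b hpb),
        Valuation.map_sub_eq_of_lt_right _ (by rwa [h2c]), h2c, one_mul, one_mul, mul_one] at h3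
      rw [← h3]
      exact IsSquare.sq _
  · rw [heq]; exact IsSquare.one
  · have hfx : p.valuation K (x ^ 2) = p.valuation K f := by
      have : x ^ 2 = f + algebraMap (𝓞 K) K (b * c ^ 2 * d) := by rw [hf]; ring
      rw [this]
      exact Valuation.map_add_eq_of_lt_left _ (hA.trans_lt hgt)
    rw [← hfx, Valuation.map_pow]
    exact IsSquare.sq _

/-- At the place `b`, the coordinate `x = t ^ ((g + 1) / 2)` is divisible by `b`. -/
lemma valuation_lt_one {s x : K}
    (h : algebraMap (𝓞 K) K a * s ^ 2 = algebraMap (𝓞 K) K b *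
      ((x ^ 2 - algebraMap (𝓞 K) K (b * c ^ 2 * d)) *
        (x ^ 2 - algebraMap (𝓞 K) K (b * c ^ 2 * d) - 2 * algebraMap (𝓞 K) K c))) :
    vb.valuation K x < 1 := by
  have hA : vb.valuation K (algebraMap (𝓞 K) K (b * c ^ 2 * d)) < 1 := by
    have hbp : b ∈ vb.asIdeal := by
      rw [hP.span_b]; exact Ideal.mem_span_singleton_self b
    refine (vb.valuation_lt_one_iff_mem (K := K) _).2 ?_
    exact Ideal.mul_mem_right _ _ (Ideal.mul_mem_right _ _ hbp)
  have h2cm : (2 : K) * algebraMap (𝓞 K) K c = algebraMap (𝓞 K) K (2 * c) := by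
    rw [map_mul, map_ofNat]
  have h2 : (2 : 𝓞 K) ∉ vb.asIdeal := hP.not_dvd_two.2.1
  have h2c : vb.valuation K (2 * algebraMap (𝓞 K) K c) = 1 := by
    rw [h2cm, vb.valuation_eq_one_iff_notMem]
    exact vb.isPrime.mul_notMem h2 hP.c_notMem_vb
  have hv := congrArg (vb.valuation K) h
  rw [Valuation.map_mul, Valuation.map_mul, Valuation.map_mul, Valuation.map_pow,
    vb.valuation_eq_one_iff_notMem.2 hP.a_notMem_vb, hP.valuation_b, one_mul] at hv
  by_contra hx
  push Not at hx
  have hx2 : 1 ≤ vb.valuation K (x ^ 2) := by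
    rw [Valuation.map_pow]
    exact one_le_pow₀ hx
  have hf := Valuation.map_sub_eq_of_lt_left (vb.valuation K) (hA.trans_le hx2)
  have key : vb.valuation K (x ^ 2 - algebraMap (𝓞 K) K (b * c ^ 2 * d) -
      2 * algebraMap (𝓞 K) K c) ≠ vb.valuation K x ^ 2 := by
    intro h3
    rw [h3, hf, Valuation.map_pow] at hv
    refine not_isSquare_exp_neg_one (isSquare_of_mul_sq_eq (y := vb.valuation K x ^ 2)
      (z := vb.valuation K s) ?_ ?_)
    · exact pow_ne_zero 2 (zero_lt_one.trans_le hx).ne'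
    · rw [sq (vb.valuation K x ^ 2)]
      exact hv.symm
  rcases hx.eq_or_lt with heq | hlt
  · have hle : vb.valuation K (x ^ 2 - algebraMap (𝓞 K) K (b * c ^ 2 * d) -
      2 * algebraMap (𝓞 K) K c) < 1 := by
      refine lt_of_le_of_ne ?_ (by rwa [← heq, one_pow] at key)
      refine (Valuation.map_sub _ _ _).trans (max_le ?_ h2c.le)
      rw [hf, Valuation.map_pow, ← heq, one_pow]
    have hlt : vb.valuation K (x ^ 2 - algebraMap (𝓞 K) K (2 * c)) < 1 := by
      have : x ^ 2 - algebraMap (𝓞 K) K (2 * c) = (x ^ 2 - algebraMap (𝓞 K) K (b * c ^ 2 * d) -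
        2 * algebraMap (𝓞 K) K c) + algebraMap (𝓞 K) K (b * c ^ 2 * d) := by
        rw [← h2cm]; ring
      rw [this]
      exact (Valuation.map_add _ _ _).trans_lt (max_lt hle hA)
    obtain ⟨z, hz⟩ := isSquare_mk_of_valuation_lt vb heq.ge hlt
    obtain ⟨z, rfl⟩ := Ideal.Quotient.mk_surjective z
    have h2sq : IsSquare (toCompletion vb 2) := by
      rw [map_ofNat]; exact hP.sq_two_b
    obtain ⟨y, hy⟩ := isSquare_residue vb h2sq
    obtain ⟨y, rfl⟩ := Ideal.Quotient.mk_surjective y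
    rw [← map_mul, Ideal.Quotient.eq] at hy hz
    have hyp : y ∉ vb.asIdeal := by
      intro hyp
      have := add_mem hy (Ideal.mul_mem_left _ y hyp)
      rw [sub_add_cancel] at this
      exact h2 this
    refine hP.c_nsq_b (isSquare_of_residue vb h2 hP.c_notMem_vb
      (isSquare_mk_of_mul_sq vb (y := y) (z := z) hyp ?_))
    have : c * y ^ 2 - z ^ 2 = (2 * c - z * z) - c * (2 - y * y) := by ring
    rw [this]
    exact sub_mem hz (Ideal.mul_mem_left _ _ hy)
  · refine key ?_
    rw [Valuation.map_sub_eq_of_lt_left, hf, Valuation.map_pow]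
    rw [h2c, hf, Valuation.map_pow]
    exact one_lt_pow₀ hlt two_ne_zero

theorem not_x0Point (hg : Odd g) : ¬ X0Point K g (algebraMap (𝓞 K) K a) (algebraMap (𝓞 K) K b)
    (algebraMap (𝓞 K) K c) (algebraMap (𝓞 K) K d) := by
  intro hpt
  obtain ⟨s, t, hst⟩ := hP.exists_affine_point hpt
  obtain ⟨m, hm⟩ := hg.add_one
  rw [hm, pow_add, ← sq] at hst
  generalize t ^ m = x at hst
  have hx := hP.valuation_lt_one hst
  have hbm : (Ideal.span {b}).IsMaximal := hP.span_b ▸ vb.isMaximal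
  have hb0 : algebraMap (𝓞 K) K b ≠ 0 := by
    simpa using hP.b_ne_zero
  have hxb : vb.valuation K (x ^ 2 / algebraMap (𝓞 K) K b) < 1 := by
    rw [Valuation.map_div, Valuation.map_pow, hP.valuation_b]
    rcases eq_or_ne (vb.valuation K x) 0 with h0 | h0
    · rw [h0, zero_pow two_ne_zero, zero_div]; exact zero_lt_one
    · rw [← log_lt_log h0 one_ne_zero, log_one] at hx
      rw [div_lt_one₀ exp_pos, ← log_lt_log (pow_ne_zero 2 h0) exp_ne_zero, log_exp, log_pow,
        nsmul_eq_mul]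
      push_cast
      omega
  obtain ⟨f, hf⟩ : ∃ f : K, f = x ^ 2 - algebraMap (𝓞 K) K (b * c ^ 2 * d) := ⟨_, rfl⟩
  rw [← hf] at hst
  have hf' : -f / algebraMap (𝓞 K) K b =
      algebraMap (𝓞 K) K (c ^ 2 * d) - x ^ 2 / algebraMap (𝓞 K) K b := by
    rw [hf, mul_assoc, map_mul (algebraMap (𝓞 K) K) b]
    field_simp
    ring
  have hle : vb.valuation K (-f / algebraMap (𝓞 K) K b) ≤ 1 := by
    rw [hf']
    exact (Valuation.map_sub _ _ _).trans (max_le (vb.valuation_le_one _) hxb.le)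
  obtain ⟨n, ⟨y, hy⟩, hny⟩ := vb.exists_primeCompl_mul_eq_of_integer _ hle
  replace hny : -f / algebraMap (𝓞 K) K b * algebraMap (𝓞 K) K y = algebraMap (𝓞 K) K n := hny
  replace hy : y ∉ vb.asIdeal := hy
  have hFd : d * (c * y) ^ 2 - y * n ∈ vb.asIdeal := by
    rw [← vb.valuation_lt_one_iff_mem (K := K)]
    have : algebraMap (𝓞 K) K (d * (c * y) ^ 2 - y * n) =
        algebraMap (𝓞 K) K y ^ 2 * (x ^ 2 / algebraMap (𝓞 K) K b) := by
      rw [map_sub, map_mul (algebraMap (𝓞 K) K) y n, ← hny, hf']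
      simp only [map_mul, map_pow]
      ring
    rw [Algebra.cast, this, Valuation.map_mul, Valuation.map_pow,
      vb.valuation_eq_one_iff_notMem.2 hy, one_pow, one_mul]
    exact hxb
  have hF : y * n ∉ vb.asIdeal := by
    intro h
    have := add_mem hFd h
    rw [sub_add_cancel] at this
    exact vb.isPrime.mul_notMem hP.d_notMem_vb
      (fun h => vb.isPrime.mul_notMem hP.c_notMem_vb hy (vb.isPrime.mem_of_pow_mem _ h)) this
  have hF0 : y * n ≠ 0 := by
    intro h
    exact hF (h ▸ zero_mem _)
  have hbp : ∀ p : HeightOneSpectrum (𝓞 K), b ∈ p.asIdeal → p = vb := by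
    intro p hp
    by_contra hne
    exact notMem_of_ne hP.span_b hne hp
  obtain ⟨S, T, u, hST, hu, huc⟩ := exists_descent (b := b) (F := y * n) two_ne_zero hF0
    (fun p h hb => by
      obtain rfl := hbp p hb
      exact p.isPrime.mul_notMem hP.not_dvd_two.2.1 hF h)
    (fun p h => exists_sq_sub_mem p (hP.sq_ab_bad p (Or.inl h)).2)
    (fun p h => by
      by_cases hsq : IsSquare (toCompletion p b)
      · exact Or.inl (exists_sq_sub_mem p hsq)
      · refine Or.inr (exists_even_pow_of_isSquare p hF0 ?_)
        have hpb : p ≠ vb := by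
          rintro rfl
          exact hF h
        rw [map_mul (algebraMap (𝓞 K) K), ← hny, Valuation.map_mul, Valuation.map_mul,
          Valuation.map_div, Valuation.map_neg,
          p.valuation_eq_one_iff_notMem.2 (notMem_of_ne hP.span_b hpb), div_one, mul_left_comm]
        exact (hP.isSquare_valuation hf hst hpb hsq).mul ⟨_, rfl⟩)
  have h2b := hP.not_dvd_two.2.1
  have hsq : IsSquare (Ideal.Quotient.mk vb.asIdeal (y * n)) := by
    rw [hP.span_b] at hF h2b ⊢
    exact GaussPhase.isSquare_of_real_pos b (y * n) u hP.b_ne_zero h2b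
      (fun σ => (hP.pos_real σ).2) hF S T hST hu huc
  obtain ⟨z, hz⟩ := hsq
  obtain ⟨z, rfl⟩ := Ideal.Quotient.mk_surjective z
  rw [← map_mul, Ideal.Quotient.eq] at hz
  refine hP.d_nsq_b (isSquare_of_residue vb h2b hP.d_notMem_vb
    (isSquare_mk_of_mul_sq vb (y := c * y) (z := z)
      (vb.isPrime.mul_notMem hP.c_notMem_vb hy) ?_))
  have : d * (c * y) ^ 2 - z ^ 2 = (d * (c * y) ^ 2 - y * n) + (y * n - z * z) := by ring
  rw [this]
  exact add_mem hFd hz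

end Params

/-- Corollary 1.3 (the fiber at `θ = 0`): for odd `g`, the genus-`g` hyperelliptic
curve `X₀ : a s² = b (t^{g+1} − b c² d)(t^{g+1} − b c² d − 2c)` violates the Hasse
principle over `K`: it has points over every local field `L` containing `K` (every
finite extension of a completion of `K`; every finite extension of an archimedean
completion is `ℝ` or `ℂ`, reached by real and complex embeddings of `K`), but it has
no `K`-rational point. -/
theorem stmt18 (K : Type u) [Field K] [NumberField K] (g : ℕ) (hg1 : 1 ≤ g)
    (hgodd : Odd g) (a b c d : 𝓞 K)
    (va vb vc vd : HeightOneSpectrum (𝓞 K)) (hP : Params K g a b c d va vb vc vd) :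
    (∀ (π : HeightOneSpectrum (𝓞 K)) (L : Type u) [Field L]
        [Algebra (π.adicCompletion K) L] [FiniteDimensional (π.adicCompletion K) L],
      X0Point L g (intToLocalExt π L a) (intToLocalExt π L b)
        (intToLocalExt π L c) (intToLocalExt π L d)) ∧
    (∀ σ : K →+* ℝ,
      X0Point ℝ g (σ (algebraMap (𝓞 K) K a)) (σ (algebraMap (𝓞 K) K b))
        (σ (algebraMap (𝓞 K) K c)) (σ (algebraMap (𝓞 K) K d))) ∧
    (∀ σ : K →+* ℂ,
      X0Point ℂ g (σ (algebraMap (𝓞 K) K a)) (σ (algebraMap (𝓞 K) K b))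
        (σ (algebraMap (𝓞 K) K c)) (σ (algebraMap (𝓞 K) K d))) ∧
    ¬ X0Point K g (algebraMap (𝓞 K) K a) (algebraMap (𝓞 K) K b)
        (algebraMap (𝓞 K) K c) (algebraMap (𝓞 K) K d) := by
  exact ⟨fun π L _ _ _ => LocalTools.X0Point.map (algebraMap (π.adicCompletion K) L)
    (hP.x0Point_completion hg1 hgodd π), hP.x0Point_real, hP.x0Point_complex, hP.not_x0Point hgodd⟩
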